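/- arXiv:2402.06338 — 3 statements merged into one kernel-verified Lean document; each statement's English description precedes it below -/
import Mathlib

section
/- For every integer m ≥ 4, every finite simple graph with chromatic number at least m+1 has a 3-connected subgraph with chromatic number at least m. -/
/-- A graph is `k`-connected if it has at least `k+1` vertices and deleting any set of
at most `k-1` vertices leaves a connected (in particular nonempty) graph. -/
def SimpleGraph.IsKConnected {V : Type*} (G : SimpleGraph V) (k : ℕ) : Prop :=
  k + 1 ≤ Nat.card V ∧ ∀ S : Set V, S.ncard ≤ k - 1 → (G.induce Sᶜ).Connected

/-- A graph is fragile if it has no 3-connected subgraph. -/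
def SimpleGraph.Fragile {V : Type*} (G : SimpleGraph V) : Prop :=
  ∀ H : G.Subgraph, ¬ H.coe.IsKConnected 3

/-- A graph is `m`-fragile if every 3-connected subgraph of it is `(m-1)`-colourable. -/
def SimpleGraph.MFragile {V : Type*} (m : ℕ) (G : SimpleGraph V) : Prop :=
  ∀ H : G.Subgraph, H.coe.IsKConnected 3 → H.coe.Colorable (m - 1)

namespace SimpleGraph

variable {V α : Type*} {G : SimpleGraph V} {A A₁ A₂ : Set V} {p q : V}

/-- `c` is a proper colouring of the subgraph of `G` induced on `A`. -/
def ProperOn (G : SimpleGraph V) (A : Set V) (c : V → α) : Prop :=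
  ∀ u ∈ A, ∀ v ∈ A, G.Adj u v → c u ≠ c v

/-- Exactly two colours are used on `a`, `b`, `c`. -/
def TwoColoured (f : V → α) (a b c : V) : Prop :=
  (f a = f b ∧ f a ≠ f c) ∨ (f a = f c ∧ f a ≠ f b) ∨ (f b = f c ∧ f a ≠ f b)

/-- The colourings of `A` by `α` are flexible: nonadjacent vertices can be given the same colour,
any vertex can be given a colour avoiding those of two other vertices, and any three pairwise
nonadjacent vertices can be coloured with exactly two colours. -/
structure Flexible (G : SimpleGraph V) (α : Type*) (A : Set V) : Prop where
  ident : ∀ u ∈ A, ∀ v ∈ A, u ≠ v → ¬ G.Adj u v → ∃ c : V → α, G.ProperOn A c ∧ c u = c v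
  avoid : ∀ v ∈ A, ∀ x ∈ A, ∀ y ∈ A, v ≠ x → v ≠ y →
    ∃ c : V → α, G.ProperOn A c ∧ c v ≠ c x ∧ c v ≠ c y
  two : ∀ a ∈ A, ∀ b ∈ A, ∀ c ∈ A, a ≠ b → a ≠ c → b ≠ c →
    ¬ G.Adj a b → ¬ G.Adj a c → ¬ G.Adj b c →
    ∃ f : V → α, G.ProperOn A f ∧ TwoColoured f a b c

/-- `A` is the union of proper subsets `A₁` and `A₂` meeting exactly in `{p, q}`, with no edge of
`G` between `A₁ \ A₂` and `A₂ \ A₁`. -/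
structure TwoSep (G : SimpleGraph V) (A A₁ A₂ : Set V) (p q : V) : Prop where
  union : A₁ ∪ A₂ = A
  ne : p ≠ q
  left₁ : p ∈ A₁
  left₂ : p ∈ A₂
  right₁ : q ∈ A₁
  right₂ : q ∈ A₂
  inter : ∀ v ∈ A₁, v ∈ A₂ → v = p ∨ v = q
  not_adj : ∀ u ∈ A₁, ∀ v ∈ A₂, G.Adj u v → u ∈ A₂ ∨ v ∈ A₁
  ssub₁ : A₁ < A
  ssub₂ : A₂ < A

theorem TwoSep.symm (h : G.TwoSep A A₁ A₂ p q) : G.TwoSep A A₂ A₁ p q where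
  union := by rw [Set.union_comm, h.union]
  ne := h.ne
  left₁ := h.left₂
  left₂ := h.left₁
  right₁ := h.right₂
  right₂ := h.right₁
  inter v h₁ h₂ := h.inter v h₂ h₁
  not_adj u hu v hv huv := (h.not_adj v hv u hu huv.symm).symm
  ssub₁ := h.ssub₂
  ssub₂ := h.ssub₁

theorem TwoSep.swap (h : G.TwoSep A A₁ A₂ p q) : G.TwoSep A A₁ A₂ q p where
  union := h.union
  ne := h.ne.symm
  left₁ := h.right₁
  left₂ := h.right₂
  right₁ := h.left₁
  right₂ := h.left₂
  inter v h₁ h₂ := (h.inter v h₁ h₂).symm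
  not_adj := h.not_adj
  ssub₁ := h.ssub₁
  ssub₂ := h.ssub₂

theorem exists_perm_of_same_pattern (a b c a' b' c' : α) (hab : a = b ↔ a' = b')
    (hac : a = c ↔ a' = c') (hbc : b = c ↔ b' = c') :
    ∃ σ : Equiv.Perm α, σ a = a' ∧ σ b = b' ∧ σ c = c' := by
  classical
  obtain ⟨σ, hσa, hσb⟩ : ∃ σ : Equiv.Perm α, σ a = a' ∧ σ b = b' := by
    refine ⟨(Equiv.swap a a').trans (Equiv.swap (Equiv.swap a a' b) b'), ?_, ?_⟩
    · simp only [Equiv.trans_apply, Equiv.swap_apply_left]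
      by_cases h : a = b
      · have := hab.1 h
        subst h this
        simp
      · refine Equiv.swap_apply_of_ne_of_ne ?_ fun h' => h (hab.2 h')
        intro h'
        have : Equiv.swap a a' a = Equiv.swap a a' b := by simpa using h'
        exact h ((Equiv.swap a a').injective this)
    · simp
  by_cases h₁ : a = c
  · exact ⟨σ, hσa, hσb, by rw [← h₁, hσa, hac.1 h₁]⟩
  by_cases h₂ : b = c
  · exact ⟨σ, hσa, hσb, by rw [← h₂, hσb, hbc.1 h₂]⟩
  refine ⟨σ.trans (Equiv.swap (σ c) c'), ?_, ?_, by simp⟩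
  · rw [Equiv.trans_apply, hσa]
    refine Equiv.swap_apply_of_ne_of_ne ?_ fun h' => h₁ (hac.2 h')
    rw [← hσa]
    exact fun h' => h₁ (σ.injective h')
  · rw [Equiv.trans_apply, hσb]
    refine Equiv.swap_apply_of_ne_of_ne ?_ fun h' => h₂ (hbc.2 h')
    rw [← hσb]
    exact fun h' => h₂ (σ.injective h')

theorem TwoSep.glue (h : G.TwoSep A A₁ A₂ p q) {c₁ c₂ : V → α} (h₁ : G.ProperOn A₁ c₁)
    (h₂ : G.ProperOn A₂ c₂) {w : V} (hw : w ∈ A₂) {t : α}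
    (hpq : c₂ p = c₂ q ↔ c₁ p = c₁ q) (hpw : c₂ p = c₂ w ↔ c₁ p = t)
    (hqw : c₂ q = c₂ w ↔ c₁ q = t) :
    ∃ c : V → α, G.ProperOn A c ∧ (∀ v ∈ A₁, c v = c₁ v) ∧ c w = t := by
  classical
  obtain ⟨σ, hp, hq, hσw⟩ := exists_perm_of_same_pattern _ _ _ _ _ _ hpq hpw hqw
  have key : ∀ v ∈ A₁, v ∈ A₂ → c₁ v = σ (c₂ v) := by
    intro v hv₁ hv₂
    rcases h.inter v hv₁ hv₂ with rfl | rfl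
    exacts [hp.symm, hq.symm]
  have h₃ : ∀ u ∈ A₂, ∀ v ∈ A₂, G.Adj u v → σ (c₂ u) ≠ σ (c₂ v) :=
    fun u hu v hv huv he => h₂ u hu v hv huv (σ.injective he)
  refine ⟨fun v => if v ∈ A₁ then c₁ v else σ (c₂ v), ?_, fun v hv => by simp [hv], ?_⟩
  · intro u hu v hv huv
    rw [← h.union] at hu hv
    have e₁ := h.not_adj u
    have e₂ := h.not_adj v
    have := huv.symm
    have := h₁ u
    simp only [Set.mem_union] at hu hv
    dsimp only
    split_ifs <;> grind
  · by_cases hw₁ : w ∈ A₁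
    · simp [hw₁, key w hw₁ hw, hσw]
    · simp [hw₁, hσw]

theorem TwoSep.extend (h : G.TwoSep A A₁ A₂ p q) (hf : G.Flexible α A₂) {c₁ : V → α}
    (h₁ : G.ProperOn A₁ c₁) : ∃ c : V → α, G.ProperOn A c ∧ ∀ v ∈ A₁, c v = c₁ v := by
  by_cases hpq : c₁ p = c₁ q
  · have hn : ¬ G.Adj p q := fun ha => h₁ p h.left₁ q h.right₁ ha hpq
    obtain ⟨c₂, h₂, he⟩ := hf.ident p h.left₂ q h.right₂ h.ne hn
    obtain ⟨c, hc, hc', -⟩ := h.glue h₁ h₂ h.left₂ (t := c₁ p) (by simp [he, hpq]) (by simp)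
      (by simp [he, hpq])
    exact ⟨c, hc, hc'⟩
  · obtain ⟨c₂, h₂, he, -⟩ := hf.avoid p h.left₂ q h.right₂ q h.right₂ h.ne h.ne
    obtain ⟨c, hc, hc', -⟩ := h.glue h₁ h₂ h.left₂ (t := c₁ p) (by simp [he, hpq]) (by simp)
      (by simp [Ne.symm he, Ne.symm hpq])
    exact ⟨c, hc, hc'⟩

/-- Some proper colouring of `A` has the prescribed coincidences among the colours of `a`, `b`,
`c`. -/
def HasPattern (G : SimpleGraph V) (α : Type*) (A : Set V) (a b c : V) (ab ac bc : Prop) : Prop :=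
  ∃ f : V → α, G.ProperOn A f ∧ (f a = f b ↔ ab) ∧ (f a = f c ↔ ac) ∧ (f b = f c ↔ bc)

theorem ProperOn.hasPattern {f : V → α} (hf : G.ProperOn A f) (a b c : V) :
    (f a = f b ∧ f a = f c ∧ f b = f c ∧ G.HasPattern α A a b c True True True) ∨
    (f a ≠ f b ∧ f a ≠ f c ∧ f b = f c ∧ G.HasPattern α A a b c False False True) ∨
    (f a ≠ f b ∧ f a = f c ∧ f b ≠ f c ∧ G.HasPattern α A a b c False True False) ∨
    (f a = f b ∧ f a ≠ f c ∧ f b ≠ f c ∧ G.HasPattern α A a b c True False False) ∨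
    (f a ≠ f b ∧ f a ≠ f c ∧ f b ≠ f c ∧ G.HasPattern α A a b c False False False) := by
  by_cases h₁ : f a = f b <;> by_cases h₂ : f a = f c <;> by_cases h₃ : f b = f c
  · exact .inl ⟨h₁, h₂, h₃, f, hf, by simp_all⟩
  · exact absurd (h₁.symm.trans h₂) h₃
  · exact absurd (h₁.trans h₃) h₂
  · exact .inr (.inr (.inr (.inl ⟨h₁, h₂, h₃, f, hf, by simp_all⟩)))
  · exact absurd (h₂.trans h₃.symm) h₁
  · exact .inr (.inr (.inl ⟨h₁, h₂, h₃, f, hf, by simp_all⟩))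
  · exact .inr (.inl ⟨h₁, h₂, h₃, f, hf, by simp_all⟩)
  · exact .inr (.inr (.inr (.inr ⟨h₁, h₂, h₃, f, hf, by simp_all⟩)))

/-- The constraints that flexibility puts on the patterns realised on three vertices. -/
structure TripleFlexible (G : SimpleGraph V) (α : Type*) (A : Set V) (a b c : V) : Prop where
  ident₁₂ : ¬ G.Adj a b → G.HasPattern α A a b c True True True ∨
    G.HasPattern α A a b c True False False
  ident₁₃ : ¬ G.Adj a c → G.HasPattern α A a b c True True True ∨
    G.HasPattern α A a b c False True False
  ident₂₃ : ¬ G.Adj b c → G.HasPattern α A a b c True True True ∨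
    G.HasPattern α A a b c False False True
  avoid₁ : G.HasPattern α A a b c False False True ∨ G.HasPattern α A a b c False False False
  avoid₂ : G.HasPattern α A a b c False True False ∨ G.HasPattern α A a b c False False False
  avoid₃ : G.HasPattern α A a b c True False False ∨ G.HasPattern α A a b c False False False
  two : ¬ G.Adj a b → ¬ G.Adj a c → ¬ G.Adj b c → G.HasPattern α A a b c False False True ∨
    G.HasPattern α A a b c False True False ∨ G.HasPattern α A a b c True False False

theorem Flexible.triple (h : G.Flexible α A) {a b c : V} (ha : a ∈ A) (hb : b ∈ A) (hc : c ∈ A)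
    (hab : a ≠ b) (hac : a ≠ c) (hbc : b ≠ c) : G.TripleFlexible α A a b c where
  ident₁₂ hn := by
    obtain ⟨f, hf, he⟩ := h.ident a ha b hb hab hn
    have := hf.hasPattern a b c
    grind
  ident₁₃ hn := by
    obtain ⟨f, hf, he⟩ := h.ident a ha c hc hac hn
    have := hf.hasPattern a b c
    grind
  ident₂₃ hn := by
    obtain ⟨f, hf, he⟩ := h.ident b hb c hc hbc hn
    have := hf.hasPattern a b c
    grind
  avoid₁ := by
    obtain ⟨f, hf, he⟩ := h.avoid a ha b hb c hc hab hac
    have := hf.hasPattern a b c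
    grind
  avoid₂ := by
    obtain ⟨f, hf, he⟩ := h.avoid b hb a ha c hc hab.symm hbc
    have := hf.hasPattern a b c
    grind
  avoid₃ := by
    obtain ⟨f, hf, he⟩ := h.avoid c hc a ha b hb hac.symm hbc.symm
    have := hf.hasPattern a b c
    grind
  two h₁ h₂ h₃ := by
    obtain ⟨f, hf, he⟩ := h.two a ha b hb c hc hab hac hbc h₁ h₂ h₃
    have := hf.hasPattern a b c
    unfold TwoColoured at he
    grind

theorem HasPattern.not_adj₁₂ {a b c : V} {P Q : Prop} (h : G.HasPattern α A a b c True P Q)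
    (ha : a ∈ A) (hb : b ∈ A) : ¬ G.Adj a b := by
  obtain ⟨f, hf, h, -⟩ := h
  exact fun hab => hf a ha b hb hab (h.2 trivial)

theorem HasPattern.not_adj₁₃ {a b c : V} {P Q : Prop} (h : G.HasPattern α A a b c P True Q)
    (ha : a ∈ A) (hc : c ∈ A) : ¬ G.Adj a c := by
  obtain ⟨f, hf, -, h, -⟩ := h
  exact fun hac => hf a ha c hc hac (h.2 trivial)

theorem HasPattern.not_adj₂₃ {a b c : V} {P Q : Prop} (h : G.HasPattern α A a b c P Q True)
    (hb : b ∈ A) (hc : c ∈ A) : ¬ G.Adj b c := by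
  obtain ⟨f, hf, -, -, h⟩ := h
  exact fun hbc => hf b hb c hc hbc (h.2 trivial)

theorem TwoSep.glue_hasPattern (h : G.TwoSep A A₁ A₂ p q) {c₁ : V → α} (h₁ : G.ProperOn A₁ c₁)
    {w : V} (hw : w ∈ A₂) {P Q R : Prop} (hP : G.HasPattern α A₂ p q w P Q R) (t : α)
    (hpq : c₁ p = c₁ q ↔ P) (hpw : c₁ p = t ↔ Q) (hqw : c₁ q = t ↔ R) :
    ∃ c : V → α, G.ProperOn A c ∧ (∀ v ∈ A₁, c v = c₁ v) ∧ c w = t := by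
  obtain ⟨c₂, h₂, e₁, e₂, e₃⟩ := hP
  exact h.glue h₁ h₂ hw (e₁.trans hpq.symm) (e₂.trans hpw.symm) (e₃.trans hqw.symm)

theorem TwoSep.ident_of_separated (h : G.TwoSep A A₁ A₂ p q) (hf₁ : G.Flexible α A₁)
    (hf₂ : G.Flexible α A₂) {u v : V} (hu₁ : u ∈ A₁) (hu₂ : u ∉ A₂) (hv₁ : v ∉ A₁) (hv₂ : v ∈ A₂) :
    ∃ c : V → α, G.ProperOn A c ∧ c u = c v := by
  have key : ∀ P Q R : Prop, G.HasPattern α A₁ p q u P Q R → G.HasPattern α A₂ p q v P Q R →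
      ∃ c : V → α, G.ProperOn A c ∧ c u = c v := by
    rintro P Q R ⟨c₁, h₁, e₁, e₂, e₃⟩ hP
    obtain ⟨c, hc, hc', hv⟩ := h.glue_hasPattern h₁ hv₂ hP (c₁ u) e₁ e₂ e₃
    exact ⟨c, hc, by rw [hv, hc' u hu₁]⟩
  have k₀ := key True True True
  have k₁ := key False False True
  have k₂ := key False True False
  have k₃ := key True False False
  have k₄ := key False False False
  clear key
  by_contra hcon
  have T₁ := hf₁.triple h.left₁ h.right₁ hu₁ h.ne (fun e => hu₂ (e ▸ h.left₂))
    (fun e => hu₂ (e ▸ h.right₂))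
  have T₂ := hf₂.triple h.left₂ h.right₂ hv₂ h.ne (fun e => hv₁ (e ▸ h.left₁))
    (fun e => hv₁ (e ▸ h.right₁))
  have n₁ := fun (x : G.HasPattern α A₁ p q u True True True) => x.not_adj₁₂ h.left₁ h.right₁
  have n₂ := fun (x : G.HasPattern α A₁ p q u True True True) => x.not_adj₁₃ h.left₁ hu₁
  have n₃ := fun (x : G.HasPattern α A₁ p q u True True True) => x.not_adj₂₃ h.right₁ hu₁
  have n₄ := fun (x : G.HasPattern α A₁ p q u True False False) => x.not_adj₁₂ h.left₁ h.right₁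
  have n₅ := fun (x : G.HasPattern α A₁ p q u False True False) => x.not_adj₁₃ h.left₁ hu₁
  have n₆ := fun (x : G.HasPattern α A₁ p q u False False True) => x.not_adj₂₃ h.right₁ hu₁
  have m₁ := fun (x : G.HasPattern α A₂ p q v True True True) => x.not_adj₁₂ h.left₂ h.right₂
  have m₂ := fun (x : G.HasPattern α A₂ p q v True True True) => x.not_adj₁₃ h.left₂ hv₂
  have m₃ := fun (x : G.HasPattern α A₂ p q v True True True) => x.not_adj₂₃ h.right₂ hv₂
  have m₄ := fun (x : G.HasPattern α A₂ p q v True False False) => x.not_adj₁₂ h.left₂ h.right₂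
  have m₅ := fun (x : G.HasPattern α A₂ p q v False True False) => x.not_adj₁₃ h.left₂ hv₂
  have m₆ := fun (x : G.HasPattern α A₂ p q v False False True) => x.not_adj₂₃ h.right₂ hv₂
  obtain ⟨a₁, a₂, a₃, a₄, a₅, a₆, a₇⟩ := T₁
  obtain ⟨b₁, b₂, b₃, b₄, b₅, b₆, b₇⟩ := T₂
  generalize G.Adj p q = x₁ at *
  generalize G.Adj p u = x₂ at *
  generalize G.Adj q u = x₃ at *
  generalize G.Adj p v = x₄ at *
  generalize G.Adj q v = x₅ at *
  generalize G.HasPattern α A₁ p q u True True True = P₀ at *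
  generalize G.HasPattern α A₁ p q u False False True = P₁ at *
  generalize G.HasPattern α A₁ p q u False True False = P₂ at *
  generalize G.HasPattern α A₁ p q u True False False = P₃ at *
  generalize G.HasPattern α A₁ p q u False False False = P₄ at *
  generalize G.HasPattern α A₂ p q v True True True = Q₀ at *
  generalize G.HasPattern α A₂ p q v False False True = Q₁ at *
  generalize G.HasPattern α A₂ p q v False True False = Q₂ at *
  generalize G.HasPattern α A₂ p q v True False False = Q₃ at *
  generalize G.HasPattern α A₂ p q v False False False = Q₄ at *
  have k₀ := fun a b => hcon (k₀ a b)
  have k₁ := fun a b => hcon (k₁ a b)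
  have k₂ := fun a b => hcon (k₂ a b)
  have k₃ := fun a b => hcon (k₃ a b)
  have k₄ := fun a b => hcon (k₄ a b)
  clear hcon
  grind (splits := 30)

/-- A vertex of the cut can avoid the colours of vertices of `A₁ \ A₂` and `A₂ \ A₁`. -/
theorem TwoSep.avoid_cut (h : G.TwoSep A A₁ A₂ p q) (hf₁ : G.Flexible α A₁)
    (hf₂ : G.Flexible α A₂) (hα : ∀ a b c : α, ∃ t, t ≠ a ∧ t ≠ b ∧ t ≠ c) {x y : V}
    (hx₁ : x ∈ A₁) (hx : x ≠ p) (hy : y ≠ p) (hy₂ : y ∈ A₂) :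
    ∃ c : V → α, G.ProperOn A c ∧ c p ≠ c x ∧ c p ≠ c y := by
  obtain ⟨c₁, h₁, e₁, e₂⟩ := hf₁.avoid p h.left₁ q h.right₁ x hx₁ h.ne hx.symm
  obtain ⟨c₂, h₂, e₃, e₄⟩ := hf₂.avoid p h.left₂ q h.right₂ y hy₂ h.ne hy.symm
  obtain ⟨t, ht₁, ht₂⟩ : ∃ t, c₁ p ≠ t ∧ (c₂ q = c₂ y ↔ c₁ q = t) := by
    by_cases hq : c₂ q = c₂ y
    · exact ⟨c₁ q, e₁, by simp [hq]⟩
    · obtain ⟨t, ht₁, ht₂, -⟩ := hα (c₁ p) (c₁ q) (c₁ q)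
      exact ⟨t, ht₁.symm, by simp [hq, ht₂.symm]⟩
  obtain ⟨c, hc, hc', hw⟩ := h.glue h₁ h₂ hy₂ (t := t) (by simp [e₁, e₃]) (by simp [ht₁, e₄]) ht₂
  exact ⟨c, hc, by rw [hc' p h.left₁, hc' x hx₁]; exact e₂, by rw [hw, hc' p h.left₁]; exact ht₁⟩

/-- A vertex of `A₁ \ A₂` can avoid the colours of a vertex of `A₁` and a vertex of `A₂ \ A₁`. -/
theorem TwoSep.avoid_split (h : G.TwoSep A A₁ A₂ p q) (hf₁ : G.Flexible α A₁)
    (hf₂ : G.Flexible α A₂) (hα : ∀ a b c : α, ∃ t, t ≠ a ∧ t ≠ b ∧ t ≠ c) {v x y : V}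
    (hv₁ : v ∈ A₁) (hv₂ : v ∉ A₂) (hy₁ : y ∈ A₁) (hvy : v ≠ y) (hx₁ : x ∉ A₁) (hx₂ : x ∈ A₂) :
    ∃ c : V → α, G.ProperOn A c ∧ c v ≠ c x ∧ c v ≠ c y := by
  have hvp : v ≠ p := fun e => hv₂ (e ▸ h.left₂)
  have hvq : v ≠ q := fun e => hv₂ (e ▸ h.right₂)
  have hpx : p ≠ x := fun e => hx₁ (e ▸ h.left₁)
  have hqx : q ≠ x := fun e => hx₁ (e ▸ h.right₁)
  have T := hf₂.triple h.left₂ h.right₂ hx₂ h.ne hpx hqx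
  have fin : ∀ (c₁ : V → α) (t : α) (P Q R : Prop), G.ProperOn A₁ c₁ → c₁ v ≠ c₁ y → c₁ v ≠ t →
      G.HasPattern α A₂ p q x P Q R → (c₁ p = c₁ q ↔ P) → (c₁ p = t ↔ Q) → (c₁ q = t ↔ R) →
      ∃ c : V → α, G.ProperOn A c ∧ c v ≠ c x ∧ c v ≠ c y := by
    intro c₁ t P Q R h₁ hy ht hP e₁ e₂ e₃
    obtain ⟨c, hc, hc', hw⟩ := h.glue_hasPattern h₁ hx₂ hP t e₁ e₂ e₃
    exact ⟨c, hc, by rw [hw, hc' v hv₁]; exact ht, by rw [hc' v hv₁, hc' y hy₁]; exact hy⟩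
  have easy : ∀ c₁ : V → α, G.ProperOn A₁ c₁ → c₁ v ≠ c₁ p → c₁ v ≠ c₁ q → c₁ v ≠ c₁ y →
      ∃ c : V → α, G.ProperOn A c ∧ c v ≠ c x ∧ c v ≠ c y := by
    intro c₁ h₁ e₁ e₂ e₃
    obtain ⟨t, ht₁, ht₂, ht₃⟩ := hα (c₁ p) (c₁ q) (c₁ v)
    by_cases hpq : c₁ p = c₁ q
    · rcases T.ident₁₂ fun ha => h₁ p h.left₁ q h.right₁ ha hpq with P | P
      · exact fin c₁ (c₁ p) _ _ _ h₁ e₃ e₁ P (by grind) (by grind) (by grind)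
      · exact fin c₁ t _ _ _ h₁ e₃ ht₃.symm P (by grind) (by grind) (by grind)
    · rcases T.avoid₁ with P | P
      · exact fin c₁ (c₁ q) _ _ _ h₁ e₃ e₂ P (by grind) (by grind) (by grind)
      · exact fin c₁ t _ _ _ h₁ e₃ ht₃.symm P (by grind) (by grind) (by grind)
  obtain ⟨c₁, h₁, e₁, e₂⟩ := hf₁.avoid v hv₁ p h.left₁ y hy₁ hvp hvy
  obtain ⟨c₂, h₂, e₃, e₄⟩ := hf₁.avoid v hv₁ q h.right₁ y hy₁ hvq hvy
  by_cases hq : c₁ v = c₁ q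
  swap
  · exact easy c₁ h₁ e₁ hq e₂
  by_cases hp : c₂ v = c₂ p
  swap
  · exact easy c₂ h₂ hp e₃ e₄
  rcases T.avoid₁ with P | P
  · exact fin c₂ (c₂ q) _ _ _ h₂ e₄ e₃ P (by grind) (by grind) (by grind)
  · obtain ⟨t, ht₁, ht₂, -⟩ := hα (c₁ p) (c₁ q) (c₁ v)
    exact fin c₁ t _ _ _ h₁ e₂ (by grind) P (by grind) (by grind) (by grind)

/-- A vertex of `A₂ \ A₁` can avoid the colours of two vertices of `A₁ \ A₂`. -/
theorem TwoSep.avoid_right (h : G.TwoSep A A₁ A₂ p q) (hf₁ : G.Flexible α A₁)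
    (hf₂ : G.Flexible α A₂) (hα : ∀ a b c : α, ∃ t, t ≠ a ∧ t ≠ b ∧ t ≠ c)
    (hK : (∀ a b c d : α, ∃ t, t ≠ a ∧ t ≠ b ∧ t ≠ c ∧ t ≠ d) ∨
      ∀ a b c d, G.Adj a b → G.Adj a c → G.Adj a d → G.Adj b c → G.Adj b d → ¬ G.Adj c d) {v x y : V}
    (hv₁ : v ∉ A₁) (hv₂ : v ∈ A₂) (hx₁ : x ∈ A₁) (hx₂ : x ∉ A₂) (hy₁ : y ∈ A₁) (hy₂ : y ∉ A₂) :
    ∃ c : V → α, G.ProperOn A c ∧ c v ≠ c x ∧ c v ≠ c y := by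
  have hpx : p ≠ x := fun e => hx₂ (e ▸ h.left₂)
  have hqx : q ≠ x := fun e => hx₂ (e ▸ h.right₂)
  have hpy : p ≠ y := fun e => hy₂ (e ▸ h.left₂)
  have hqy : q ≠ y := fun e => hy₂ (e ▸ h.right₂)
  have hpv : p ≠ v := fun e => hv₁ (e ▸ h.left₁)
  have hqv : q ≠ v := fun e => hv₁ (e ▸ h.right₁)
  have T := hf₂.triple h.left₂ h.right₂ hv₂ h.ne hpv hqv
  have fin : ∀ (c₁ : V → α) (t : α) (P Q R : Prop), G.ProperOn A₁ c₁ → t ≠ c₁ x → t ≠ c₁ y →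
      G.HasPattern α A₂ p q v P Q R → (c₁ p = c₁ q ↔ P) → (c₁ p = t ↔ Q) → (c₁ q = t ↔ R) →
      ∃ c : V → α, G.ProperOn A c ∧ c v ≠ c x ∧ c v ≠ c y := by
    intro c₁ t P Q R h₁ hx hy hP e₁ e₂ e₃
    obtain ⟨c, hc, hc', hw⟩ := h.glue_hasPattern h₁ hv₂ hP t e₁ e₂ e₃
    exact ⟨c, hc, by rw [hw, hc' x hx₁]; exact hx, by rw [hw, hc' y hy₁]; exact hy⟩
  have equal : ∀ c₁ : V → α, G.ProperOn A₁ c₁ → c₁ p = c₁ q → c₁ p ≠ c₁ x → c₁ p ≠ c₁ y →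
      ∃ c : V → α, G.ProperOn A c ∧ c v ≠ c x ∧ c v ≠ c y := by
    intro c₁ h₁ hpq hx hy
    obtain ⟨t, ht₁, ht₂, ht₃⟩ := hα (c₁ p) (c₁ x) (c₁ y)
    rcases T.ident₁₂ fun ha => h₁ p h.left₁ q h.right₁ ha hpq with P | P
    · exact fin c₁ (c₁ p) _ _ _ h₁ hx hy P (by grind) (by grind) (by grind)
    · exact fin c₁ t _ _ _ h₁ ht₂ ht₃ P (by grind) (by grind) (by grind)
  by_cases P₂ : G.HasPattern α A₂ p q v False True False
  · obtain ⟨c₁, h₁, hx, hy⟩ := hf₁.avoid p h.left₁ x hx₁ y hy₁ hpx hpy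
    by_cases hpq : c₁ p = c₁ q
    · exact equal c₁ h₁ hpq hx hy
    · exact fin c₁ (c₁ p) _ _ _ h₁ hx hy P₂ (by grind) (by grind) (by grind)
  by_cases P₁ : G.HasPattern α A₂ p q v False False True
  · obtain ⟨c₁, h₁, hx, hy⟩ := hf₁.avoid q h.right₁ x hx₁ y hy₁ hqx hqy
    by_cases hpq : c₁ p = c₁ q
    · exact equal c₁ h₁ hpq (hpq ▸ hx) (hpq ▸ hy)
    · exact fin c₁ (c₁ q) _ _ _ h₁ hx hy P₁ (by grind) (by grind) (by grind)
  have P₄ := T.avoid₁.resolve_left P₁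
  by_cases hpq : G.Adj p q
  · obtain ⟨c₁, h₁, t, htp, htq, htx, hty⟩ : ∃ c₁ : V → α, G.ProperOn A₁ c₁ ∧
        ∃ t, t ≠ c₁ p ∧ t ≠ c₁ q ∧ t ≠ c₁ x ∧ t ≠ c₁ y := by
      rcases hK with hK | hK
      · obtain ⟨c₁, h₁, -⟩ := hf₁.avoid p h.left₁ q h.right₁ q h.right₁ h.ne h.ne
        exact ⟨c₁, h₁, hK _ _ _ _⟩
      · obtain ⟨c₁, h₁, hrep⟩ : ∃ c₁ : V → α, G.ProperOn A₁ c₁ ∧ (c₁ p = c₁ x ∨ c₁ p = c₁ y ∨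
            c₁ q = c₁ x ∨ c₁ q = c₁ y ∨ c₁ x = c₁ y) := by
          have i₁ := hf₁.ident p h.left₁ x hx₁ hpx
          have i₂ := hf₁.ident p h.left₁ y hy₁ hpy
          have i₃ := hf₁.ident q h.right₁ x hx₁ hqx
          have i₄ := hf₁.ident q h.right₁ y hy₁ hqy
          have i₅ := hf₁.ident x hx₁ y hy₁
          by_cases a₁ : G.Adj p x
          swap
          · obtain ⟨c₁, h₁, e⟩ := i₁ a₁
            exact ⟨c₁, h₁, .inl e⟩
          by_cases a₂ : G.Adj p y
          swap
          · obtain ⟨c₁, h₁, e⟩ := i₂ a₂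
            exact ⟨c₁, h₁, .inr (.inl e)⟩
          by_cases a₃ : G.Adj q x
          swap
          · obtain ⟨c₁, h₁, e⟩ := i₃ a₃
            exact ⟨c₁, h₁, .inr (.inr (.inl e))⟩
          by_cases a₄ : G.Adj q y
          swap
          · obtain ⟨c₁, h₁, e⟩ := i₄ a₄
            exact ⟨c₁, h₁, .inr (.inr (.inr (.inl e)))⟩
          by_cases a₅ : x = y
          · obtain ⟨c₁, h₁, -⟩ := hf₁.avoid p h.left₁ q h.right₁ q h.right₁ h.ne h.ne
            exact ⟨c₁, h₁, .inr (.inr (.inr (.inr (congrArg c₁ a₅))))⟩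
          · obtain ⟨c₁, h₁, e⟩ := i₅ a₅ (hK p q x y hpq a₁ a₂ a₃ a₄)
            exact ⟨c₁, h₁, .inr (.inr (.inr (.inr e)))⟩
        obtain ⟨t, ht₁, ht₂, ht₃⟩ := hα (c₁ p) (c₁ q) (c₁ x)
        obtain ⟨s, hs₁, hs₂, hs₃⟩ := hα (c₁ p) (c₁ q) (c₁ y)
        refine ⟨c₁, h₁, ?_⟩
        rcases hrep with e | e | e | e | e
        · exact ⟨s, hs₁, hs₂, e ▸ hs₁, hs₃⟩
        · exact ⟨t, ht₁, ht₂, ht₃, e ▸ ht₁⟩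
        · exact ⟨s, hs₁, hs₂, e ▸ hs₂, hs₃⟩
        · exact ⟨t, ht₁, ht₂, ht₃, e ▸ ht₂⟩
        · exact ⟨t, ht₁, ht₂, ht₃, e ▸ ht₃⟩
    have := h₁ p h.left₁ q h.right₁ hpq
    exact fin c₁ t _ _ _ h₁ htx hty P₄ (by grind) (by grind) (by grind)
  · have P₃ : G.HasPattern α A₂ p q v True False False := by
      rcases T.ident₁₂ hpq with P | P
      · have := T.two (P.not_adj₁₂ h.left₂ h.right₂) (P.not_adj₁₃ h.left₂ hv₂)
          (P.not_adj₂₃ h.right₂ hv₂)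
        tauto
      · exact P
    obtain ⟨c₁, h₁, e⟩ := hf₁.ident p h.left₁ q h.right₁ h.ne hpq
    obtain ⟨t, ht₁, ht₂, ht₃⟩ := hα (c₁ p) (c₁ x) (c₁ y)
    exact fin c₁ t _ _ _ h₁ ht₂ ht₃ P₃ (by grind) (by grind) (by grind)

/-- The case of `TwoSep.two_of_two_one` in which one of the vertices is in the cut. -/
theorem TwoSep.two_cut (h : G.TwoSep A A₁ A₂ p q) (hf₁ : G.Flexible α A₁)
    (hf₂ : G.Flexible α A₂) (hα : ∀ a b c : α, ∃ t, t ≠ a ∧ t ≠ b ∧ t ≠ c) {b c : V}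
    (hb₁ : b ∈ A₁) (hb₂ : b ∉ A₂) (hc₁ : c ∉ A₁) (hc₂ : c ∈ A₂) (hpb : ¬ G.Adj p b) :
    ∃ f : V → α, G.ProperOn A f ∧ TwoColoured f p b c := by
  have key : ∀ (c₁ : V → α) (t : α) (P Q R : Prop), G.ProperOn A₁ c₁ →
      G.HasPattern α A₂ p q c P Q R → (c₁ p = c₁ q ↔ P) → (c₁ p = t ↔ Q) → (c₁ q = t ↔ R) →
      ((c₁ p = c₁ b ∧ c₁ p ≠ t) ∨ (c₁ p = t ∧ c₁ p ≠ c₁ b) ∨ (c₁ b = t ∧ c₁ p ≠ c₁ b)) →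
      ∃ f : V → α, G.ProperOn A f ∧ TwoColoured f p b c := by
    intro c₁ t P Q R h₁ hP e₁ e₂ e₃ e₄
    obtain ⟨f, hf, hf', hw⟩ := h.glue_hasPattern h₁ hc₂ hP t e₁ e₂ e₃
    refine ⟨f, hf, ?_⟩
    rw [TwoColoured, hw, hf' p h.left₁, hf' b hb₁]
    exact e₄
  by_contra hcon
  have k₀₃ : G.HasPattern α A₁ p q b True True True → ¬ G.HasPattern α A₂ p q c True False False := by
    rintro ⟨c₁, h₁, e₁, e₂, e₃⟩ hP
    obtain ⟨t, ht, -⟩ := hα (c₁ p) (c₁ p) (c₁ p)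
    exact hcon (key c₁ t _ _ _ h₁ hP (by grind) (by grind) (by grind) (by grind))
  have k₃₀ : G.HasPattern α A₁ p q b True False False → ¬ G.HasPattern α A₂ p q c True True True := by
    rintro ⟨c₁, h₁, e₁, e₂, e₃⟩ hP
    exact hcon (key c₁ (c₁ p) _ _ _ h₁ hP (by grind) (by grind) (by grind) (by grind))
  have k₂₄ : G.HasPattern α A₁ p q b False True False →
      ¬ G.HasPattern α A₂ p q c False False False := by
    rintro ⟨c₁, h₁, e₁, e₂, e₃⟩ hP
    obtain ⟨t, ht, ht', -⟩ := hα (c₁ p) (c₁ q) (c₁ q)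
    exact hcon (key c₁ t _ _ _ h₁ hP (by grind) (by grind) (by grind) (by grind))
  have k₂₁ : G.HasPattern α A₁ p q b False True False →
      ¬ G.HasPattern α A₂ p q c False False True := by
    rintro ⟨c₁, h₁, e₁, e₂, e₃⟩ hP
    exact hcon (key c₁ (c₁ q) _ _ _ h₁ hP (by grind) (by grind) (by grind) (by grind))
  have k₄₂ : G.HasPattern α A₁ p q b False False False →
      ¬ G.HasPattern α A₂ p q c False True False := by
    rintro ⟨c₁, h₁, e₁, e₂, e₃⟩ hP
    exact hcon (key c₁ (c₁ p) _ _ _ h₁ hP (by grind) (by grind) (by grind) (by grind))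
  have k₁₂ : G.HasPattern α A₁ p q b False False True →
      ¬ G.HasPattern α A₂ p q c False True False := by
    rintro ⟨c₁, h₁, e₁, e₂, e₃⟩ hP
    exact hcon (key c₁ (c₁ p) _ _ _ h₁ hP (by grind) (by grind) (by grind) (by grind))
  have kb : ∀ P R, G.HasPattern α A₁ p q b P False R → ¬ G.HasPattern α A₂ p q c P False R := by
    rintro P R ⟨c₁, h₁, e₁, e₂, e₃⟩ hP
    exact hcon (key c₁ (c₁ b) _ _ _ h₁ hP (by grind) (by grind) (by grind) (by grind))
  have T₁ := hf₁.triple h.left₁ h.right₁ hb₁ h.ne (fun e => hb₂ (e ▸ h.left₂))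
    (fun e => hb₂ (e ▸ h.right₂))
  have T₂ := hf₂.triple h.left₂ h.right₂ hc₂ h.ne (fun e => hc₁ (e ▸ h.left₁))
    (fun e => hc₁ (e ▸ h.right₁))
  have k₃₃ := kb True False
  have k₁₁ := kb False True
  have k₄₄ := kb False False
  obtain ⟨a₁, a₂, a₃, a₄, a₅, a₆, a₇⟩ := T₁
  obtain ⟨b₁, b₂, b₃, b₄, b₅, b₆, b₇⟩ := T₂
  clear key kb hcon
  grind

theorem TwoSep.two_of_two_one (h : G.TwoSep A A₁ A₂ p q) (hf₁ : G.Flexible α A₁)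
    (hf₂ : G.Flexible α A₂) (hα : ∀ a b c : α, ∃ t, t ≠ a ∧ t ≠ b ∧ t ≠ c) {a b c : V}
    (ha₁ : a ∈ A₁) (ha₂ : a ∉ A₂) (hb₁ : b ∈ A₁) (hb₂ : b ∉ A₂) (hc₁ : c ∉ A₁) (hc₂ : c ∈ A₂)
    (hab : a ≠ b) (nab : ¬ G.Adj a b) :
    ∃ f : V → α, G.ProperOn A f ∧ TwoColoured f a b c := by
  have key : ∀ (c₁ : V → α) (t : α) (P Q R : Prop), G.ProperOn A₁ c₁ →
      G.HasPattern α A₂ p q c P Q R → (c₁ p = c₁ q ↔ P) → (c₁ p = t ↔ Q) → (c₁ q = t ↔ R) →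
      ((c₁ a = c₁ b ∧ c₁ a ≠ t) ∨ (c₁ a = t ∧ c₁ a ≠ c₁ b) ∨ (c₁ b = t ∧ c₁ a ≠ c₁ b)) →
      ∃ f : V → α, G.ProperOn A f ∧ TwoColoured f a b c := by
    intro c₁ t P Q R h₁ hP e₁ e₂ e₃ e₄
    obtain ⟨f, hf, hf', hw⟩ := h.glue_hasPattern h₁ hc₂ hP t e₁ e₂ e₃
    refine ⟨f, hf, ?_⟩
    rw [TwoColoured, hw, hf' a ha₁, hf' b hb₁]
    exact e₄
  have T := hf₂.triple h.left₂ h.right₂ hc₂ h.ne (fun e => hc₁ (e ▸ h.left₁))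
    (fun e => hc₁ (e ▸ h.right₁))
  have unequal : ∀ c₁ : V → α, G.ProperOn A₁ c₁ → c₁ a = c₁ b → c₁ p ≠ c₁ q →
      ∃ f : V → α, G.ProperOn A f ∧ TwoColoured f a b c := by
    intro c₁ h₁ e hpq
    obtain ⟨t, ht₁, ht₂, ht₃⟩ := hα (c₁ p) (c₁ q) (c₁ a)
    by_cases hp : c₁ p = c₁ a
    · rcases T.avoid₁ with P | P
      · exact key c₁ (c₁ q) _ _ _ h₁ P (by grind) (by grind) (by grind) (by grind)
      · exact key c₁ t _ _ _ h₁ P (by grind) (by grind) (by grind) (by grind)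
    · rcases T.avoid₂ with P | P
      · exact key c₁ (c₁ p) _ _ _ h₁ P (by grind) (by grind) (by grind) (by grind)
      · exact key c₁ t _ _ _ h₁ P (by grind) (by grind) (by grind) (by grind)
  obtain ⟨c₁, h₁, e⟩ := hf₁.ident a ha₁ b hb₁ hab nab
  by_cases hpq : c₁ p = c₁ q
  swap
  · exact unequal c₁ h₁ e hpq
  by_cases P₃ : G.HasPattern α A₂ p q c True False False
  · obtain ⟨t, ht₁, ht₂, -⟩ := hα (c₁ p) (c₁ a) (c₁ a)
    exact key c₁ t _ _ _ h₁ P₃ (by grind) (by grind) (by grind) (by grind)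
  have P₄ := T.avoid₃.resolve_left P₃
  have P₀ := (T.ident₁₂ fun ha => h₁ p h.left₁ q h.right₁ ha hpq).resolve_right P₃
  by_cases hpa : c₁ p = c₁ a
  swap
  · exact key c₁ (c₁ p) _ _ _ h₁ P₀ (by grind) (by grind) (by grind) (by grind)
  have P₁₂ : G.HasPattern α A₂ p q c False False True ∨ G.HasPattern α A₂ p q c False True False := by
    have := T.two (P₀.not_adj₁₂ h.left₂ h.right₂) (P₀.not_adj₁₃ h.left₂ hc₂)
      (P₀.not_adj₂₃ h.right₂ hc₂)
    tauto
  obtain ⟨f, hf, hf'⟩ := hf₁.two a ha₁ b hb₁ p h.left₁ hab (fun e => ha₂ (e ▸ h.left₂))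
    (fun e => hb₂ (e ▸ h.left₂)) nab (fun hd => h₁ a ha₁ p h.left₁ hd hpa.symm)
    (fun hd => h₁ b hb₁ p h.left₁ hd (e.symm.trans hpa.symm))
  by_cases hfpq : f p = f q
  · refine key f (f p) _ _ _ hf P₀ (by grind) (by grind) (by grind) ?_
    unfold TwoColoured at hf'
    grind
  rcases hf' with ⟨e₁, e₂⟩ | ⟨e₁, e₂⟩ | ⟨e₁, e₂⟩
  · exact unequal f hf e₁ hfpq
  · by_cases hqb : f q = f b
    · rcases P₁₂ with P | P
      · exact key f (f q) _ _ _ hf P (by grind) (by grind) (by grind) (by grind)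
      · exact key f (f p) _ _ _ hf P (by grind) (by grind) (by grind) (by grind)
    · exact key f (f b) _ _ _ hf P₄ (by grind) (by grind) (by grind) (by grind)
  · by_cases hqa : f q = f a
    · rcases P₁₂ with P | P
      · exact key f (f q) _ _ _ hf P (by grind) (by grind) (by grind) (by grind)
      · exact key f (f p) _ _ _ hf P (by grind) (by grind) (by grind) (by grind)
    · exact key f (f a) _ _ _ hf P₄ (by grind) (by grind) (by grind) (by grind)

theorem TwoSep.avoid_of_two_left (h : G.TwoSep A A₁ A₂ p q) (hf₁ : G.Flexible α A₁)
    (hf₂ : G.Flexible α A₂) (hα : ∀ a b c : α, ∃ t, t ≠ a ∧ t ≠ b ∧ t ≠ c)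
    {v x y : V} (hv : v ∈ A₁) (hx : x ∈ A) (hy : y ∈ A₁) (hvx : v ≠ x) (hvy : v ≠ y) :
    ∃ c : V → α, G.ProperOn A c ∧ c v ≠ c x ∧ c v ≠ c y := by
  by_cases hx₁ : x ∈ A₁
  · obtain ⟨c₁, h₁, e₁, e₂⟩ := hf₁.avoid v hv x hx₁ y hy hvx hvy
    obtain ⟨c, hc, hc'⟩ := h.extend hf₂ h₁
    exact ⟨c, hc, by rwa [hc' v hv, hc' x hx₁], by rwa [hc' v hv, hc' y hy]⟩
  have hx₂ : x ∈ A₂ := (h.union ▸ hx : x ∈ A₁ ∪ A₂).resolve_left hx₁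
  by_cases hv₂ : v ∈ A₂
  · have : ∃ c : V → α, G.ProperOn A c ∧ c v ≠ c y ∧ c v ≠ c x := by
      rcases h.inter v hv hv₂ with rfl | rfl
      · exact h.avoid_cut hf₁ hf₂ hα hy hvy.symm hvx.symm hx₂
      · exact h.swap.avoid_cut hf₁ hf₂ hα hy hvy.symm hvx.symm hx₂
    obtain ⟨c, hc, e₁, e₂⟩ := this
    exact ⟨c, hc, e₂, e₁⟩
  · exact h.avoid_split hf₁ hf₂ hα hv hv₂ hy hvy hx₁ hx₂

theorem TwoSep.avoid_of_one_left (h : G.TwoSep A A₁ A₂ p q) (hf₁ : G.Flexible α A₁)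
    (hf₂ : G.Flexible α A₂) (hα : ∀ a b c : α, ∃ t, t ≠ a ∧ t ≠ b ∧ t ≠ c)
    (hK : (∀ a b c d : α, ∃ t, t ≠ a ∧ t ≠ b ∧ t ≠ c ∧ t ≠ d) ∨
      ∀ a b c d, G.Adj a b → G.Adj a c → G.Adj a d → G.Adj b c → G.Adj b d → ¬ G.Adj c d)
    {v x y : V} (hv : v ∈ A₁) (hx : x ∈ A) (hy : y ∈ A) (hvx : v ≠ x) (hvy : v ≠ y) :
    ∃ c : V → α, G.ProperOn A c ∧ c v ≠ c x ∧ c v ≠ c y := by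
  have flip : (∃ c : V → α, G.ProperOn A c ∧ c v ≠ c y ∧ c v ≠ c x) →
      ∃ c : V → α, G.ProperOn A c ∧ c v ≠ c x ∧ c v ≠ c y :=
    fun ⟨c, hc, e₁, e₂⟩ => ⟨c, hc, e₂, e₁⟩
  by_cases hy₁ : y ∈ A₁
  · exact h.avoid_of_two_left hf₁ hf₂ hα hv hx hy₁ hvx hvy
  by_cases hx₁ : x ∈ A₁
  · exact flip (h.avoid_of_two_left hf₁ hf₂ hα hv hy hx₁ hvy hvx)
  have hx₂ : x ∈ A₂ := (h.union ▸ hx : x ∈ A₁ ∪ A₂).resolve_left hx₁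
  have hy₂ : y ∈ A₂ := (h.union ▸ hy : y ∈ A₁ ∪ A₂).resolve_left hy₁
  by_cases hv₂ : v ∈ A₂
  · exact h.symm.avoid_of_two_left hf₂ hf₁ hα hv₂ hx hy₂ hvx hvy
  · exact h.symm.avoid_right hf₂ hf₁ hα hK hv₂ hv hx₂ hx₁ hy₂ hy₁

theorem TwoColoured.rotate {f : V → α} {a b c : V} (h : TwoColoured f a b c) :
    TwoColoured f b c a := by
  unfold TwoColoured at *
  grind

theorem TwoColoured.swap {f : V → α} {a b c : V} (h : TwoColoured f a b c) :
    TwoColoured f b a c := by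
  unfold TwoColoured at *
  grind

theorem TwoSep.two_of_two_left (h : G.TwoSep A A₁ A₂ p q) (hf₁ : G.Flexible α A₁)
    (hf₂ : G.Flexible α A₂) (hα : ∀ a b c : α, ∃ t, t ≠ a ∧ t ≠ b ∧ t ≠ c) {a b c : V}
    (ha : a ∈ A₁) (hb : b ∈ A₁) (hc : c ∈ A) (hab : a ≠ b) (hac : a ≠ c) (hbc : b ≠ c)
    (nab : ¬ G.Adj a b) (nac : ¬ G.Adj a c) (nbc : ¬ G.Adj b c) :
    ∃ f : V → α, G.ProperOn A f ∧ TwoColoured f a b c := by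
  have same : ∀ {A₁ A₂ : Set V} {a b c : V}, G.TwoSep A A₁ A₂ p q → G.Flexible α A₁ →
      G.Flexible α A₂ → a ∈ A₁ → b ∈ A₁ → c ∈ A₁ → a ≠ b → a ≠ c → b ≠ c →
      ¬ G.Adj a b → ¬ G.Adj a c → ¬ G.Adj b c →
      ∃ f : V → α, G.ProperOn A f ∧ TwoColoured f a b c := by
    intro A₁ A₂ a b c h hf₁ hf₂ ha hb hc hab hac hbc nab nac nbc
    obtain ⟨c₁, h₁, e⟩ := hf₁.two a ha b hb c hc hab hac hbc nab nac nbc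
    obtain ⟨f, hf, hf'⟩ := h.extend hf₂ h₁
    refine ⟨f, hf, ?_⟩
    rwa [TwoColoured, hf' a ha, hf' b hb, hf' c hc]
  by_cases hc₁ : c ∈ A₁
  · exact same h hf₁ hf₂ ha hb hc₁ hab hac hbc nab nac nbc
  have hc₂ : c ∈ A₂ := (h.union ▸ hc : c ∈ A₁ ∪ A₂).resolve_left hc₁
  by_cases ha₂ : a ∈ A₂ <;> by_cases hb₂ : b ∈ A₂
  · exact same h.symm hf₂ hf₁ ha₂ hb₂ hc₂ hab hac hbc nab nac nbc
  · rcases h.inter a ha ha₂ with rfl | rfl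
    · exact h.two_cut hf₁ hf₂ hα hb hb₂ hc₁ hc₂ nab
    · exact h.swap.two_cut hf₁ hf₂ hα hb hb₂ hc₁ hc₂ nab
  · have : ∃ f : V → α, G.ProperOn A f ∧ TwoColoured f b a c := by
      rcases h.inter b hb hb₂ with rfl | rfl
      · exact h.two_cut hf₁ hf₂ hα ha ha₂ hc₁ hc₂ fun e => nab e.symm
      · exact h.swap.two_cut hf₁ hf₂ hα ha ha₂ hc₁ hc₂ fun e => nab e.symm
    obtain ⟨f, hf, e⟩ := this
    exact ⟨f, hf, e.swap⟩
  · exact h.two_of_two_one hf₁ hf₂ hα ha ha₂ hb hb₂ hc₁ hc₂ hab nab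

theorem TwoSep.ident_of_left (h : G.TwoSep A A₁ A₂ p q) (hf₁ : G.Flexible α A₁)
    (hf₂ : G.Flexible α A₂) {u v : V} (hu : u ∈ A₁) (hv : v ∈ A) (huv : u ≠ v)
    (nuv : ¬ G.Adj u v) : ∃ c : V → α, G.ProperOn A c ∧ c u = c v := by
  have same : ∀ {A₁ A₂ : Set V}, G.TwoSep A A₁ A₂ p q → G.Flexible α A₁ →
      G.Flexible α A₂ → u ∈ A₁ → v ∈ A₁ → ∃ c : V → α, G.ProperOn A c ∧ c u = c v := by
    intro A₁ A₂ h hf₁ hf₂ hu hv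
    obtain ⟨c₁, h₁, e⟩ := hf₁.ident u hu v hv huv nuv
    obtain ⟨c, hc, hc'⟩ := h.extend hf₂ h₁
    exact ⟨c, hc, by rwa [hc' u hu, hc' v hv]⟩
  by_cases hv₁ : v ∈ A₁
  · exact same h hf₁ hf₂ hu hv₁
  have hv₂ : v ∈ A₂ := (h.union ▸ hv : v ∈ A₁ ∪ A₂).resolve_left hv₁
  by_cases hu₂ : u ∈ A₂
  · exact same h.symm hf₂ hf₁ hu₂ hv₂
  · exact h.ident_of_separated hf₁ hf₂ hu hu₂ hv₁ hv₂

/-- Flexibility passes from the two sides of a 2-separation to their union. -/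
theorem TwoSep.flexible (h : G.TwoSep A A₁ A₂ p q) (hf₁ : G.Flexible α A₁)
    (hf₂ : G.Flexible α A₂) (hα : ∀ a b c : α, ∃ t, t ≠ a ∧ t ≠ b ∧ t ≠ c)
    (hK : (∀ a b c d : α, ∃ t, t ≠ a ∧ t ≠ b ∧ t ≠ c ∧ t ≠ d) ∨
      ∀ a b c d, G.Adj a b → G.Adj a c → G.Adj a d → G.Adj b c → G.Adj b d → ¬ G.Adj c d) :
    G.Flexible α A where
  ident u hu v hv huv nuv := by
    rcases (h.union ▸ hu : u ∈ A₁ ∪ A₂) with hu' | hu'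
    · exact h.ident_of_left hf₁ hf₂ hu' hv huv nuv
    · exact h.symm.ident_of_left hf₂ hf₁ hu' hv huv nuv
  avoid v hv x hx y hy hvx hvy := by
    rcases (h.union ▸ hv : v ∈ A₁ ∪ A₂) with hv' | hv'
    · exact h.avoid_of_one_left hf₁ hf₂ hα hK hv' hx hy hvx hvy
    · exact h.symm.avoid_of_one_left hf₂ hf₁ hα hK hv' hx hy hvx hvy
  two a ha b hb c hc hab hac hbc nab nac nbc := by
    have nba := fun e => nab (G.adj_comm b a |>.1 e)
    have nca := fun e => nac (G.adj_comm c a |>.1 e)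
    have key : ∀ {A₁ A₂ : Set V}, G.TwoSep A A₁ A₂ p q → G.Flexible α A₁ → G.Flexible α A₂ →
        (a ∈ A₁ ∧ b ∈ A₁) ∨ (b ∈ A₁ ∧ c ∈ A₁) ∨ (c ∈ A₁ ∧ a ∈ A₁) →
        ∃ f : V → α, G.ProperOn A f ∧ TwoColoured f a b c := by
      rintro A₁ A₂ h hf₁ hf₂ (⟨h₁, h₂⟩ | ⟨h₁, h₂⟩ | ⟨h₁, h₂⟩)
      · exact h.two_of_two_left hf₁ hf₂ hα h₁ h₂ hc hab hac hbc nab nac nbc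
      · obtain ⟨f, hf, e⟩ := h.two_of_two_left hf₁ hf₂ hα h₁ h₂ ha hbc hab.symm hac.symm nbc nba nca
        exact ⟨f, hf, e.rotate.rotate⟩
      · obtain ⟨f, hf, e⟩ := h.two_of_two_left hf₁ hf₂ hα h₁ h₂ hb hac.symm hbc.symm hab nca
          (fun e => nbc e.symm) nab
        exact ⟨f, hf, e.rotate⟩
    have ha' : a ∈ A₁ ∨ a ∈ A₂ := (h.union ▸ ha : a ∈ A₁ ∪ A₂)
    have hb' : b ∈ A₁ ∨ b ∈ A₂ := (h.union ▸ hb : b ∈ A₁ ∪ A₂)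
    have hc' : c ∈ A₁ ∨ c ∈ A₂ := (h.union ▸ hc : c ∈ A₁ ∪ A₂)
    by_cases hcase : (a ∈ A₁ ∧ b ∈ A₁) ∨ (b ∈ A₁ ∧ c ∈ A₁) ∨ (c ∈ A₁ ∧ a ∈ A₁)
    · exact key h hf₁ hf₂ hcase
    · exact key h.symm hf₂ hf₁ (by tauto)

theorem ProperOn.recolour {c : V → α} (hc : G.ProperOn A c) {t : α} (ht : ∀ v ∈ A, c v ≠ t)
    {I : Set V} (hI : ∀ u ∈ I, ∀ v ∈ I, ¬ G.Adj u v) [DecidablePred (· ∈ I)] :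
    G.ProperOn A fun v => if v ∈ I then t else c v := by
  intro u hu v hv huv
  have h₁ := ht u hu
  have h₂ := ht v hv
  have h₃ := hc u hu v hv huv
  have h₄ := hI u
  dsimp only
  split_ifs <;> grind

theorem ProperOn.flexible {c : V → α} (hc : G.ProperOn A c) {t : α} (ht : ∀ v ∈ A, c v ≠ t) :
    G.Flexible α A where
  ident u hu v hv _ huv := by
    classical
    refine ⟨_, hc.recolour ht (I := {u, v}) ?_, by simp⟩
    have := G.adj_comm u v
    rintro x (rfl | rfl) y (rfl | rfl) <;> simp_all
  avoid v hv x hx y hy hvx hvy := by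
    classical
    refine ⟨_, hc.recolour ht (I := {v}) ?_, ?_, ?_⟩
    · rintro x rfl y rfl
      exact G.irrefl
    · simpa [hvx.symm] using (ht x hx).symm
    · simpa [hvy.symm] using (ht y hy).symm
  two a ha b hb d hd hab had hbd nab nad nbd := by
    classical
    have ta := ht a ha
    have tb := ht b hb
    have td := ht d hd
    by_cases hcase : c a = c b ∧ c a = c d
    · refine ⟨_, hc.recolour ht (I := {a}) ?_, ?_⟩
      · rintro x rfl y rfl
        exact G.irrefl
      · unfold TwoColoured
        simp only [Set.mem_singleton_iff]
        grind
    by_cases hcase : TwoColoured c a b d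
    · exact ⟨c, hc, hcase⟩
    refine ⟨_, hc.recolour ht (I := {a, b}) ?_, ?_⟩
    · have := G.adj_comm a b
      rintro x (rfl | rfl) y (rfl | rfl) <;> simp_all
    · unfold TwoColoured at *
      simp only [Set.mem_insert_iff, Set.mem_singleton_iff]
      grind

theorem Colorable.flexible {k : ℕ} (h : (G.induce A).Colorable k) :
    G.Flexible (Fin (k + 1)) A := by
  classical
  obtain ⟨C⟩ := h
  refine ProperOn.flexible (t := Fin.last k)
    (c := fun v => if hv : v ∈ A then (C ⟨v, hv⟩).castSucc else 0) ?_ ?_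
  · intro u hu v hv huv
    have : C ⟨u, hu⟩ ≠ C ⟨v, hv⟩ := C.valid (by simpa using huv)
    simpa [hu, hv] using this
  · intro v hv
    simp [hv]

theorem exists_twoSep_of_ncard_inter_le [Finite V] (h4 : 4 ≤ A.ncard) (n : ℕ) {A₁ A₂ : Set V}
    (hn : n + (A₁ ∩ A₂).ncard = 2) (hA : A₁ ∪ A₂ = A) (h₁ : A₁ < A) (h₂ : A₂ < A)
    (hadj : ∀ u ∈ A₁, ∀ v ∈ A₂, G.Adj u v → u ∈ A₂ ∨ v ∈ A₁) :
    ∃ B₁ B₂ p q, G.TwoSep A B₁ B₂ p q := by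
  induction n generalizing A₁ A₂ with
  | zero =>
    obtain ⟨p, q, hpq, he⟩ := Set.ncard_eq_two.1 (by simpa using hn)
    have hp : p ∈ A₁ ∩ A₂ := by simp [he]
    have hq : q ∈ A₁ ∩ A₂ := by simp [he]
    exact ⟨A₁, A₂, p, q, hA, hpq, hp.1, hp.2, hq.1, hq.2,
      fun v h h' => by simpa using (he ▸ ⟨h, h'⟩ : v ∈ ({p, q} : Set V)), hadj, h₁, h₂⟩
  | succ n ih =>
    have enlarge : ∀ {A₁ A₂ : Set V}, n + 1 + (A₁ ∩ A₂).ncard = 2 → A₁ ∪ A₂ = A → A₁ < A →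
        A₂ < A → A₂.ncard + 1 < A.ncard →
        ∃ v, n + (A₁ ∩ insert v A₂).ncard = 2 ∧ A₁ ∪ insert v A₂ = A ∧ insert v A₂ < A ∧
          v ∈ A₁ := by
      intro A₁ A₂ hn hA h₁ h₂ hc
      obtain ⟨v, hv, hv₂⟩ := Set.exists_of_ssubset h₂
      have hv₁ : v ∈ A₁ := by
        rw [← hA] at hv
        exact hv.resolve_right hv₂
      refine ⟨v, ?_, ?_, ?_, hv₁⟩
      · rw [Set.inter_insert_of_mem hv₁, Set.ncard_insert_of_notMem (by simp [hv₂])]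
        omega
      · rw [Set.union_insert, hA, Set.insert_eq_of_mem hv]
      · refine lt_of_le_of_ne (Set.insert_subset hv h₂.le) fun e => ?_
        rw [← e, Set.ncard_insert_of_notMem hv₂] at hc
        exact lt_irrefl _ hc
    have hcard := Set.ncard_union_add_ncard_inter A₁ A₂
    rw [hA] at hcard
    by_cases hc : A₂.ncard + 1 < A.ncard
    · obtain ⟨v, e₁, e₂, e₃, hv⟩ := enlarge hn hA h₁ h₂ hc
      refine ih e₁ e₂ h₁ e₃ ?_
      rintro u hu w (rfl | hw) huw
      · exact .inr hv
      · exact (hadj u hu w hw huw).imp_left .inr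
    · have hlt := Set.ncard_lt_ncard h₂
      obtain ⟨v, e₁, e₂, e₃, hv⟩ := enlarge (A₁ := A₂) (A₂ := A₁) (by rwa [Set.inter_comm])
        (by rwa [Set.union_comm]) h₂ h₁ (by omega)
      rw [Set.inter_comm] at e₁
      rw [Set.union_comm] at e₂
      refine ih e₁ e₂ e₃ h₂ ?_
      rintro u (rfl | hu) w hw huw
      · exact .inl hv
      · exact (hadj u hu w hw huw).imp_right .inr

/-- A set of at least four vertices not inducing a 3-connected subgraph has a 2-separation. -/
theorem exists_twoSep [Finite V] (h4 : 4 ≤ A.ncard) (hA : ¬ (G.induce A).IsKConnected 3) :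
    ∃ A₁ A₂ p q, G.TwoSep A A₁ A₂ p q := by
  have hA' : ∃ S : Set A, S.ncard ≤ 2 ∧ ¬ ((G.induce A).induce Sᶜ).Connected := by
    by_contra! hcon
    exact hA ⟨by rwa [Nat.card_coe_set_eq], hcon⟩
  obtain ⟨S, hS, hcon⟩ := hA'
  have hne : Nonempty ↥Sᶜ := by
    rw [Set.nonempty_coe_sort, Set.nonempty_compl]
    rintro rfl
    rw [Set.ncard_univ, Nat.card_coe_set_eq] at hS
    omega
  obtain ⟨x, y, hxy⟩ : ∃ x y, ¬ ((G.induce A).induce Sᶜ).Reachable x y := by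
    by_contra! h
    exact hcon ⟨h⟩
  let C : Set V := (fun v : ↥Sᶜ => (v : V)) '' {v | ((G.induce A).induce Sᶜ).Reachable x v}
  have hC : ∀ v : ↥Sᶜ, (v : V) ∈ C ↔ ((G.induce A).induce Sᶜ).Reachable x v := by
    intro v
    constructor
    · rintro ⟨w, hw, e⟩
      rwa [← Subtype.ext (Subtype.ext e)]
    · exact fun hv => ⟨v, hv, rfl⟩
  let T : Set V := Subtype.val '' S
  have hT : ∀ v : A, (v : V) ∈ T ↔ v ∈ S := by simp [T]
  have hCA : C ⊆ A := by
    rintro _ ⟨v, -, rfl⟩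
    exact v.1.2
  have hTA : T ⊆ A := by
    rintro _ ⟨v, -, rfl⟩
    exact v.2
  have hCT : ∀ v ∈ C, v ∉ T := by
    rintro _ ⟨v, -, rfl⟩ h
    exact v.2 ((hT _).1 h)
  have hTc : T.ncard ≤ 2 := (Set.ncard_image_le).trans hS
  have hi : (T ∪ C) ∩ (A \ C) = T := by
    ext v
    have h₁ := hCT v
    have h₂ := @hTA v
    simp only [Set.mem_inter_iff, Set.mem_union, Set.mem_sdiff]
    tauto
  refine exists_twoSep_of_ncard_inter_le h4 (2 - T.ncard) (A₁ := T ∪ C) (A₂ := A \ C)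
    (by rw [hi]; omega) ?_ ?_ ?_ ?_
  · ext v
    have h₁ := @hCA v
    have h₂ := @hTA v
    simp only [Set.mem_union, Set.mem_sdiff]
    tauto
  · refine (Set.ssubset_iff_of_subset (Set.union_subset hTA hCA)).2 ⟨y, y.1.2, ?_⟩
    rintro (h | h)
    · exact y.2 ((hT _).1 h)
    · exact hxy ((hC y).1 h)
  · exact (Set.ssubset_iff_of_subset Set.sdiff_subset).2
      ⟨x, x.1.2, fun h => h.2 ((hC x).2 (Reachable.refl x))⟩
  · rintro u (hu | hu) v ⟨hv, hvC⟩ huv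
    · exact .inl ⟨hTA hu, fun h => hCT u h hu⟩
    · refine .inr (.inl ?_)
      by_contra hvT
      obtain ⟨u, hu, rfl⟩ := hu
      refine hvC ((hC ⟨⟨v, hv⟩, fun h => hvT ((hT _).2 h)⟩).2 (hu.trans (Adj.reachable ?_)))
      simpa using huv

theorem isKConnected_top [Finite V] {k : ℕ} (h : k + 1 ≤ Nat.card V) :
    (⊤ : SimpleGraph V).IsKConnected k := by
  refine ⟨h, fun S hS => ?_⟩
  have : Nonempty ↥Sᶜ := by
    rw [Set.nonempty_coe_sort, Set.nonempty_compl]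
    rintro rfl
    rw [Set.ncard_univ] at hS
    omega
  rw [show (⊤ : SimpleGraph V).induce Sᶜ = ⊤ by ext; simp [Subtype.ext_iff]]
  exact connected_top

theorem not_adj_of_forall_colorable [Finite V]
    (h : ∀ S : Set V, (G.induce S).IsKConnected 3 → (G.induce S).Colorable 3) {a b c d : V}
    (hab : G.Adj a b) (hac : G.Adj a c) (had : G.Adj a d) (hbc : G.Adj b c) (hbd : G.Adj b d) :
    ¬ G.Adj c d := by
  intro hcd
  have hS : ({a, b, c, d} : Set V).ncard = 4 := by
    rw [Set.ncard_insert_of_notMem, Set.ncard_insert_of_notMem, Set.ncard_pair hcd.ne] <;>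
      simp [hab.ne, hac.ne, had.ne, hbc.ne, hbd.ne]
  have htop : G.induce {a, b, c, d} = ⊤ := by
    rw [induce_eq_top]
    have := hab.symm
    have := hac.symm
    have := had.symm
    have := hbc.symm
    have := hbd.symm
    have := hcd.symm
    rintro x (rfl | rfl | rfl | rfl) y (rfl | rfl | rfl | rfl) hxy <;>
      first | assumption | simp at hxy
  have hcol := h {a, b, c, d} (by
    rw [htop]
    exact isKConnected_top (by rw [Nat.card_coe_set_eq, hS]))
  rw [htop] at hcol
  have := hcol.card_le_of_pairwise_adj id fun x y hxy => hxy
  rw [Nat.card_coe_set_eq, hS] at this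
  omega

/-- If every 3-connected induced subgraph is `k`-colourable with `k ≥ 3`, then the colourings of every
vertex set by `k + 1` colours are flexible. -/
theorem flexible_of_forall_colorable [Finite V] {k : ℕ} (hk : 3 ≤ k)
    (h : ∀ S : Set V, (G.induce S).IsKConnected 3 → (G.induce S).Colorable k) (A : Set V) :
    G.Flexible (Fin (k + 1)) A := by
  have fresh : ∀ s : Finset (Fin (k + 1)), s.card ≤ k → ∃ t, t ∉ s := by
    intro s hs
    by_contra! hcon
    have := Finset.card_le_card (fun x _ => hcon x : Finset.univ ⊆ s)
    simp at this
    omega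
  have hα : ∀ a b c : Fin (k + 1), ∃ t, t ≠ a ∧ t ≠ b ∧ t ≠ c := by
    intro a b c
    obtain ⟨t, ht⟩ := fresh {a, b, c} (Finset.card_le_three.trans hk)
    exact ⟨t, by simpa using ht⟩
  have hK : (∀ a b c d : Fin (k + 1), ∃ t, t ≠ a ∧ t ≠ b ∧ t ≠ c ∧ t ≠ d) ∨
      ∀ a b c d, G.Adj a b → G.Adj a c → G.Adj a d → G.Adj b c → G.Adj b d → ¬ G.Adj c d := by
    rcases hk.eq_or_lt with rfl | hk
    · exact .inr fun a b c d => not_adj_of_forall_colorable h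
    · refine .inl fun a b c d => ?_
      obtain ⟨t, ht⟩ := fresh {a, b, c, d} (Finset.card_le_four.trans hk)
      exact ⟨t, by simpa using ht⟩
  induction A using WellFoundedLT.induction with
  | ind A ih =>
    by_cases hA : (G.induce A).IsKConnected 3
    · exact (h A hA).flexible
    by_cases h4 : 4 ≤ A.ncard
    · obtain ⟨A₁, A₂, p, q, hs⟩ := exists_twoSep h4 hA
      exact hs.flexible (ih A₁ hs.ssub₁) (ih A₂ hs.ssub₂) hα hK
    · have := Fintype.ofFinite A
      have hcard := Nat.card_coe_set_eq A
      rw [Nat.card_eq_fintype_card] at hcard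
      exact ((G.induce A).colorable_of_fintype.mono (by omega)).flexible

theorem Flexible.colorable {k : ℕ} (h : G.Flexible (Fin (k + 1)) Set.univ) :
    G.Colorable (k + 1) := by
  rcases subsingleton_or_nontrivial V with hV | hV
  · exact ⟨Coloring.mk (fun _ => 0) fun {u v} huv => absurd (Subsingleton.elim u v) huv.ne⟩
  · obtain ⟨u, v, huv⟩ := exists_pair_ne V
    obtain ⟨c, hc, -⟩ := h.avoid u trivial v trivial v trivial huv huv
    exact ⟨Coloring.mk c fun {u v} => hc u trivial v trivial⟩

end SimpleGraph

/-- For all `m ≥ 4`, every graph with chromatic number at least `m+1` has a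
3-connected subgraph with chromatic number at least `m`. -/
theorem statement1 {V : Type*} [Fintype V] (G : SimpleGraph V) (m : ℕ) (hm : 4 ≤ m)
    (hchrom : (m + 1 : ℕ∞) ≤ G.chromaticNumber) :
    ∃ H : G.Subgraph, H.coe.IsKConnected 3 ∧ (m : ℕ∞) ≤ H.coe.chromaticNumber := by
  obtain ⟨k, rfl⟩ : ∃ k, m = k + 1 := ⟨m - 1, by omega⟩
  by_contra! hcon
  have h : ∀ S : Set V, (G.induce S).IsKConnected 3 → (G.induce S).Colorable k := by
    intro S hS
    rw [SimpleGraph.induce_eq_coe_induce_top] at hS ⊢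
    have hlt := hcon _ hS
    rw [Nat.cast_add, Nat.cast_one] at hlt
    exact SimpleGraph.chromaticNumber_le_iff_colorable.1 (Order.le_of_lt_add_one hlt)
  have hG := (SimpleGraph.flexible_of_forall_colorable (by omega) h Set.univ).colorable
  have := hchrom.trans hG.chromaticNumber_le
  norm_cast at this
  omega
end

section
/- Every fragile finite simple graph is 4-colourable, i.e., has chromatic number at most 4. -/
namespace FragileColoring

open Equiv

variable {V : Type*}

/-- `c` is a proper colouring of the subgraph of `G` induced on `W`. -/
def ProperOn (G : SimpleGraph V) (W : Finset V) (c : V → Fin 4) : Prop :=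
  ∀ ⦃a⦄, a ∈ W → ∀ ⦃b⦄, b ∈ W → G.Adj a b → c a ≠ c b

/-- The properties of 4-colourings, all true for induced subgraphs of fragile graphs, that are
proved by simultaneous induction. -/
structure Flexible (G : SimpleGraph V) (W : Finset V) : Prop where
  same : ∀ u ∈ W, ∀ x ∈ W, u ≠ x → ¬ G.Adj u x → ∃ c, ProperOn G W c ∧ c u = c x
  same_ne : ∀ u ∈ W, ∀ x ∈ W, ∀ y ∈ W, u ≠ x → ¬ G.Adj u x → y ≠ u → y ≠ x →
    ∃ c, ProperOn G W c ∧ c u = c x ∧ c y ≠ c x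
  nbrs_same : ∀ a ∈ W, ∀ b ∈ W, ∀ x ∈ W, ∀ y ∈ W, a ≠ b → ¬ G.Adj a b → G.Adj x a → G.Adj x b →
    y ≠ x → ∃ c, ProperOn G W c ∧ c a = c b ∧ c x ≠ c y
  triple : ∀ x ∈ W, ∀ y ∈ W, ∀ z ∈ W, x ≠ y → x ≠ z → y ≠ z →
    ¬ G.Adj x y → ¬ G.Adj x z → ¬ G.Adj y z →
    ∃ c, ProperOn G W c ∧ ((c x = c y ∧ c y = c z) ∨ (c x ≠ c y ∧ c x ≠ c z ∧ c y ≠ c z))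
  two_ne : ∀ a ∈ W, ∀ b ∈ W, ∀ x ∈ W, ∀ y ∈ W, a ≠ b → x ≠ y →
    ∃ c, ProperOn G W c ∧ c a ≠ c b ∧ c x ≠ c y
  star : ∀ u ∈ W, ∀ x ∈ W, ∀ y ∈ W, ∀ z ∈ W, u ≠ x → u ≠ y → u ≠ z →
    ∃ c, ProperOn G W c ∧ c u ≠ c x ∧ c u ≠ c y ∧ c u ≠ c z
  missing : ∀ T ⊆ W, T.card ≤ 5 → ∃ c, ∃ k, ProperOn G W c ∧ ∀ t ∈ T, c t ≠ k

/-- `W` is the union of `C` and `D`, which meet in the two vertices `p`, `q`, with no edges between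
the two nonempty differences. -/
structure Separation (G : SimpleGraph V) (W C D : Finset V) (p q : V) : Prop where
  mem_iff : ∀ v, v ∈ W ↔ v ∈ C ∨ v ∈ D
  inter_iff : ∀ v, (v ∈ C ∧ v ∈ D) ↔ (v = p ∨ v = q)
  ne : p ≠ q
  not_adj : ∀ a ∈ C, a ∉ D → ∀ b ∈ D, b ∉ C → ¬ G.Adj a b
  left : ∃ a ∈ C, a ∉ D
  right : ∃ b ∈ D, b ∉ C

/-- A separation both of whose sides are flexible. -/
structure FlexSep (G : SimpleGraph V) (W C D : Finset V) (p q : V) : Prop extends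
    Separation G W C D p q where
  flexC : Flexible G C
  flexD : Flexible G D

theorem exists_perm_two (P Q P' Q' : Fin 4) (h : P = Q ↔ P' = Q') :
    ∃ σ : Perm (Fin 4), σ P' = P ∧ σ Q' = Q := by
  refine ⟨(swap P' P).trans (swap (swap P' P Q') Q), ?_, ?_⟩
  · by_cases hP : P = Q
    · have := h.1 hP
      subst this; subst hP; simp
    · have hP' : P' ≠ Q' := fun e => hP (h.2 e)
      have h1 : swap P' P Q' ≠ P := by
        intro e
        apply hP'
        have : swap P' P P' = P := by simp
        exact (swap P' P).injective (this.trans e.symm)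
      simp [swap_apply_of_ne_of_ne h1.symm hP]
  · simp

theorem exists_perm_three (P Q k P' Q' k' : Fin 4) (h : P = Q ↔ P' = Q')
    (hp : k = P ↔ k' = P') (hq : k = Q ↔ k' = Q') :
    ∃ σ : Perm (Fin 4), σ P' = P ∧ σ Q' = Q ∧ σ k' = k := by
  obtain ⟨σ, h1, h2⟩ := exists_perm_two P Q P' Q' h
  by_cases e1 : k = P
  · exact ⟨σ, h1, h2, by rw [hp.1 e1, h1, e1]⟩
  by_cases e2 : k = Q
  · exact ⟨σ, h1, h2, by rw [hq.1 e2, h2, e2]⟩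
  have n1 : P ≠ σ k' := fun e => e1 (hp.2 (σ.injective (e.symm.trans h1.symm)))
  have n2 : Q ≠ σ k' := fun e => e2 (hq.2 (σ.injective (e.symm.trans h2.symm)))
  refine ⟨σ.trans (swap (σ k') k), ?_, ?_, by simp⟩
  · simp [h1, swap_apply_of_ne_of_ne n1 (Ne.symm e1)]
  · simp [h2, swap_apply_of_ne_of_ne n2 (Ne.symm e2)]

theorem exists_ne_three : ∀ a b c : Fin 4, ∃ k, k ≠ a ∧ k ≠ b ∧ k ≠ c := by decide

theorem exists_swap_ne_of_same : ∀ P a x b y : Fin 4, x ≠ P → b ≠ P →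
    ∃ i j, i ≠ P ∧ j ≠ P ∧ a ≠ swap i j b ∧ x ≠ swap i j y := by decide +kernel

set_option synthInstance.maxHeartbeats 400000 in
set_option synthInstance.maxSize 1000 in
theorem exists_swap_ne_of_ne : ∀ P Q a x b y : Fin 4, P ≠ Q →
    (a = P ∨ a = Q → a ≠ b) → (x = P ∨ x = Q → x ≠ y) →
    (a ≠ P → a ≠ Q → x ≠ P → x ≠ Q → a ≠ x ∧ b ≠ y) →
    ∃ i j, i ≠ P ∧ j ≠ P ∧ i ≠ Q ∧ j ≠ Q ∧ a ≠ swap i j b ∧ x ≠ swap i j y := by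
  decide +kernel

theorem ProperOn.comp {G : SimpleGraph V} {W : Finset V} {c : V → Fin 4} (h : ProperOn G W c)
    (σ : Perm (Fin 4)) : ProperOn G W (fun v => σ (c v)) :=
  fun _ ha _ hb hab e => h ha hb hab (σ.injective e)

/-- In a flexible graph, any third vertex can get a colour different from those of two adjacent
vertices. -/
theorem Flexible.rainbow {G : SimpleGraph V} {W : Finset V} (h : Flexible G W) {x y z : V}
    (hx : x ∈ W) (hy : y ∈ W) (hz : z ∈ W) (hxy : x ≠ y) (hxz : x ≠ z) (hyz : G.Adj y z) :
    ∃ c, ProperOn G W c ∧ c x ≠ c y ∧ c x ≠ c z ∧ c y ≠ c z := by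
  obtain ⟨c, hc, h1, h2⟩ := h.two_ne x hx y hy x hx z hz hxy hxz
  exact ⟨c, hc, h1, h2, hc hy hz hyz⟩

/-- One of two nonadjacent vertices can be made to share a colour within a triple, keeping `x` and
`y` different. -/
theorem Flexible.not_rainbow {G : SimpleGraph V} {W : Finset V} (h : Flexible G W) {p q x y : V}
    (hp : p ∈ W) (hq : q ∈ W) (hx : x ∈ W) (hy : y ∈ W) (hpq : p ≠ q) (hn : ¬ G.Adj p q)
    (hxp : x ≠ p) (hxq : x ≠ q) (hxy : x ≠ y) :
    ∃ c, ProperOn G W c ∧ c x ≠ c y ∧ (c p = c q ∨ c x = c p ∨ c x = c q) := by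
  by_cases h1 : G.Adj x p
  · by_cases h2 : G.Adj x q
    · obtain ⟨c, hc, e, n⟩ := h.nbrs_same p hp q hq x hx y hy hpq hn h1 h2 hxy.symm
      exact ⟨c, hc, n, .inl e⟩
    · by_cases e : y = q
      · subst e
        obtain ⟨c, hc, e⟩ := h.same p hp y hy hpq hn
        exact ⟨c, hc, e ▸ hc hx hp h1, .inl e⟩
      · obtain ⟨c, hc, e, n⟩ := h.same_ne x hx q hq y hy hxq h2 hxy.symm e
        exact ⟨c, hc, fun e' => n (e' ▸ e), .inr (.inr e)⟩
  · by_cases e : y = p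
    · subst e
      by_cases h2 : G.Adj x q
      · obtain ⟨c, hc, e⟩ := h.same y hp q hq hpq hn
        exact ⟨c, hc, e ▸ hc hx hq h2, .inl e⟩
      · obtain ⟨c, hc, e, n⟩ := h.same_ne x hx q hq y hp hxq h2 hxp.symm hpq
        exact ⟨c, hc, fun e' => n (e' ▸ e), .inr (.inr e)⟩
    · obtain ⟨c, hc, e, n⟩ := h.same_ne x hx p hp y hy hxp h1 hxy.symm e
      exact ⟨c, hc, fun e' => n (e' ▸ e), .inr (.inl e)⟩

/-- Either some colouring separates `p` from `q` while `p, q, s, t` miss a colour, or `s` and `t`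
are adjacent to both `p` and `q`. -/
theorem Flexible.missing_or_adj [DecidableEq V] {G : SimpleGraph V} {W : Finset V}
    (h : Flexible G W) {p q s t : V}
    (hp : p ∈ W) (hq : q ∈ W) (hs : s ∈ W) (ht : t ∈ W) (hpq : p ≠ q)
    (hsp : s ≠ p) (hsq : s ≠ q) (htp : t ≠ p) (htq : t ≠ q) :
    (∃ c, ∃ m, ProperOn G W c ∧ c p ≠ c q ∧ c p ≠ m ∧ c q ≠ m ∧ c s ≠ m ∧ c t ≠ m) ∨
    (¬ G.Adj p q ∧ G.Adj s p ∧ G.Adj s q ∧ G.Adj t p ∧ G.Adj t q) := by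
  have aux : ∀ c : V → Fin 4, ProperOn G W c → c p ≠ c q → (c s = c p ∨ c s = c q ∨ c t = c p ∨
      c t = c q) →
      ∃ c, ∃ m, ProperOn G W c ∧ c p ≠ c q ∧ c p ≠ m ∧ c q ≠ m ∧ c s ≠ m ∧ c t ≠ m := by
    intro c hc hne hor
    rcases hor with e | e | e | e
    · obtain ⟨m, h1, h2, h3⟩ := exists_ne_three (c p) (c q) (c t)
      exact ⟨c, m, hc, hne, h1.symm, h2.symm, e ▸ h1.symm, h3.symm⟩
    · obtain ⟨m, h1, h2, h3⟩ := exists_ne_three (c p) (c q) (c t)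
      exact ⟨c, m, hc, hne, h1.symm, h2.symm, e ▸ h2.symm, h3.symm⟩
    · obtain ⟨m, h1, h2, h3⟩ := exists_ne_three (c p) (c q) (c s)
      exact ⟨c, m, hc, hne, h1.symm, h2.symm, h3.symm, e ▸ h1.symm⟩
    · obtain ⟨m, h1, h2, h3⟩ := exists_ne_three (c p) (c q) (c s)
      exact ⟨c, m, hc, hne, h1.symm, h2.symm, h3.symm, e ▸ h2.symm⟩
  by_cases h0 : G.Adj p q
  · left
    obtain ⟨c, m, hc, hm⟩ := h.missing {p, q, s, t} (by
      intro v; simp only [Finset.mem_insert, Finset.mem_singleton]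
      rintro (rfl | rfl | rfl | rfl) <;> assumption) (Finset.card_le_four.trans (by norm_num))
    exact ⟨c, m, hc, hc hp hq h0, hm _ (by simp), hm _ (by simp), hm _ (by simp), hm _ (by simp)⟩
  by_cases h1 : G.Adj s p
  · by_cases h2 : G.Adj s q
    · by_cases h3 : G.Adj t p
      · by_cases h4 : G.Adj t q
        · exact .inr ⟨h0, h1, h2, h3, h4⟩
        · obtain ⟨c, hc, e, n⟩ := h.same_ne t ht q hq p hp htq h4 htp.symm hpq
          exact .inl (aux c hc n (by simp [e]))
      · obtain ⟨c, hc, e, n⟩ := h.same_ne t ht p hp q hq htp h3 htq.symm hpq.symm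
        exact .inl (aux c hc n.symm (by simp [e]))
    · obtain ⟨c, hc, e, n⟩ := h.same_ne s hs q hq p hp hsq h2 hsp.symm hpq
      exact .inl (aux c hc n (by simp [e]))
  · obtain ⟨c, hc, e, n⟩ := h.same_ne s hs p hp q hq hsp h1 hsq.symm hpq.symm
    exact .inl (aux c hc n.symm (by simp [e]))

namespace FlexSep

variable {G : SimpleGraph V} {W C D : Finset V} {p q : V}

theorem symm (s : FlexSep G W C D p q) : FlexSep G W D C p q where
  mem_iff v := (s.mem_iff v).trans or_comm
  inter_iff v := and_comm.trans (s.inter_iff v)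
  ne := s.ne
  not_adj a ha ha' b hb hb' h := s.not_adj b hb hb' a ha ha' h.symm
  left := s.right
  right := s.left
  flexC := s.flexD
  flexD := s.flexC

theorem swap (s : FlexSep G W C D p q) : FlexSep G W C D q p :=
  { s with
    inter_iff := fun v => (s.inter_iff v).trans or_comm
    ne := s.ne.symm }

theorem pC (s : FlexSep G W C D p q) : p ∈ C := ((s.inter_iff p).2 (.inl rfl)).1
theorem pD (s : FlexSep G W C D p q) : p ∈ D := ((s.inter_iff p).2 (.inl rfl)).2
theorem qC (s : FlexSep G W C D p q) : q ∈ C := s.swap.pC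
theorem qD (s : FlexSep G W C D p q) : q ∈ D := s.swap.pD

variable [DecidableEq V]

theorem glue (s : FlexSep G W C D p q) {c₁ c₂ : V → Fin 4} (h₁ : ProperOn G C c₁)
    (h₂ : ProperOn G D c₂) (hp : c₂ p = c₁ p) (hq : c₂ q = c₁ q) :
    ∃ c, ProperOn G W c ∧ (∀ v ∈ C, c v = c₁ v) ∧ ∀ v ∈ D, c v = c₂ v := by
  have hC : ∀ v ∈ C, (if v ∈ C then c₁ v else c₂ v) = c₁ v := fun v hv => if_pos hv
  have hD : ∀ v ∈ D, (if v ∈ C then c₁ v else c₂ v) = c₂ v := by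
    intro v hv
    split_ifs with h
    · rcases (s.inter_iff v).1 ⟨h, hv⟩ with rfl | rfl
      · exact hp.symm
      · exact hq.symm
    · rfl
  refine ⟨fun v => if v ∈ C then c₁ v else c₂ v, ?_, hC, hD⟩
  intro a ha b hb hab
  by_cases hCC : a ∈ C ∧ b ∈ C
  · simp only [hC a hCC.1, hC b hCC.2]
    exact h₁ hCC.1 hCC.2 hab
  by_cases hDD : a ∈ D ∧ b ∈ D
  · simp only [hD a hDD.1, hD b hDD.2]
    exact h₂ hDD.1 hDD.2 hab
  exfalso
  have h1 := s.not_adj a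
  have h2 := s.not_adj b
  have h3 := (s.mem_iff a).1 ha
  have h4 := (s.mem_iff b).1 hb
  have := hab.symm
  tauto

/-- Gluing after permuting the colours of the second colouring. -/
theorem glue_perm (s : FlexSep G W C D p q) {c₁ c₂ : V → Fin 4} (h₁ : ProperOn G C c₁)
    (h₂ : ProperOn G D c₂) (σ : Perm (Fin 4)) (hp : σ (c₂ p) = c₁ p) (hq : σ (c₂ q) = c₁ q) :
    ∃ c, ProperOn G W c ∧ (∀ v ∈ C, c v = c₁ v) ∧ ∀ v ∈ D, c v = σ (c₂ v) :=
  s.glue h₁ (h₂.comp σ) hp hq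

theorem extend_perm (s : FlexSep G W C D p q) {c₁ : V → Fin 4} (h₁ : ProperOn G C c₁) :
    ∃ c, ProperOn G W c ∧ ∀ v ∈ C, c v = c₁ v := by
  have : ∃ c₂, ProperOn G D c₂ ∧ (c₁ p = c₁ q ↔ c₂ p = c₂ q) := by
    by_cases h : c₁ p = c₁ q
    · obtain ⟨c₂, h₂, e⟩ := s.flexD.same p s.pD q s.qD s.ne fun hn => h₁ s.pC s.qC hn h
      exact ⟨c₂, h₂, by simp [h, e]⟩
    · obtain ⟨c₂, h₂, e, -⟩ := s.flexD.two_ne p s.pD q s.qD p s.pD q s.qD s.ne s.ne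
      exact ⟨c₂, h₂, by simp [h, e]⟩
  obtain ⟨c₂, h₂, e⟩ := this
  obtain ⟨σ, hp, hq⟩ := exists_perm_two _ _ _ _ e
  obtain ⟨c, hc, hC, -⟩ := s.glue_perm h₁ h₂ σ hp hq
  exact ⟨c, hc, hC⟩

/-- If `c₂` misses a colour on `p, q, x, y`, a matching colouring of the other side extends so that
`x` and `y` avoid any given colour not used on `p, q`. -/
theorem extend_avoid (s : FlexSep G W C D p q) {c₁ c₂ : V → Fin 4} (h₁ : ProperOn G C c₁)
    (h₂ : ProperOn G D c₂) (e : c₁ p = c₁ q ↔ c₂ p = c₂ q) {k m : Fin 4} (hkp : c₁ p ≠ k)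
    (hkq : c₁ q ≠ k) (hmp : c₂ p ≠ m) (hmq : c₂ q ≠ m) {x y : V} (hx : x ∈ D) (hy : y ∈ D)
    (hmx : c₂ x ≠ m) (hmy : c₂ y ≠ m) :
    ∃ c, ProperOn G W c ∧ (∀ v ∈ C, c v = c₁ v) ∧ c x ≠ k ∧ c y ≠ k := by
  obtain ⟨σ, hp, hq, hm⟩ := exists_perm_three (c₁ p) (c₁ q) k (c₂ p) (c₂ q) m e
    (by simp [hkp.symm, hmp.symm]) (by simp [hkq.symm, hmq.symm])
  obtain ⟨c, hc, hC, hD⟩ := s.glue_perm h₁ h₂ σ hp hq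
  refine ⟨c, hc, hC, ?_, ?_⟩
  · rw [hD x hx, ← hm]; exact fun e => hmx (σ.injective e)
  · rw [hD y hy, ← hm]; exact fun e => hmy (σ.injective e)

theorem extend_avoid_same (s : FlexSep G W C D p q) {c₁ : V → Fin 4} (h₁ : ProperOn G C c₁)
    (e : c₁ p = c₁ q) {k : Fin 4} (hk : c₁ p ≠ k) {x y : V} (hx : x ∈ D) (hy : y ∈ D) :
    ∃ c, ProperOn G W c ∧ (∀ v ∈ C, c v = c₁ v) ∧ c x ≠ k ∧ c y ≠ k := by
  obtain ⟨c₂, h₂, e₂⟩ := s.flexD.same p s.pD q s.qD s.ne fun hn => h₁ s.pC s.qC hn e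
  obtain ⟨m, hm, hmx, hmy⟩ := exists_ne_three (c₂ p) (c₂ x) (c₂ y)
  exact s.extend_avoid h₁ h₂ (by simp [e, e₂]) hk (e ▸ hk) hm.symm (e₂ ▸ hm.symm) hx hy
    hmx.symm hmy.symm

theorem extend_color (s : FlexSep G W C D p q) {c₁ c₂ : V → Fin 4} (h₁ : ProperOn G C c₁)
    (h₂ : ProperOn G D c₂) {k : Fin 4} {y : V} (hy : y ∈ D) (e : c₁ p = c₁ q ↔ c₂ p = c₂ q)
    (ep : k = c₁ p ↔ c₂ y = c₂ p) (eq : k = c₁ q ↔ c₂ y = c₂ q) :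
    ∃ c, ProperOn G W c ∧ (∀ v ∈ C, c v = c₁ v) ∧ c y = k := by
  obtain ⟨σ, hp, hq, hk⟩ := exists_perm_three _ _ _ _ _ _ e ep eq
  obtain ⟨c, hc, hC, hD⟩ := s.glue_perm h₁ h₂ σ hp hq
  exact ⟨c, hc, hC, by rw [hD y hy, hk]⟩

/-- The colours available at a single vertex of one side, given a colouring of the other side. -/
theorem lone (s : FlexSep G W C D p q) {y : V} (hy : y ∈ D) (hyC : y ∉ C) :
    (∀ c₁, ProperOn G C c₁ → ∀ k, k ≠ c₁ p → k ≠ c₁ q →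
      ∃ c, ProperOn G W c ∧ (∀ v ∈ C, c v = c₁ v) ∧ c y = k) ∨
    ((¬ G.Adj y p ∧ ¬ G.Adj y q ∧ ¬ G.Adj p q) ∧ ∀ c₁, ProperOn G C c₁ →
      ∀ k, (c₁ p = c₁ q ∨ k = c₁ p ∨ k = c₁ q) →
      ∃ c, ProperOn G W c ∧ (∀ v ∈ C, c v = c₁ v) ∧ c y = k) := by
  have hyp : y ≠ p := fun e => hyC (e ▸ s.pC)
  have hyq : y ≠ q := fun e => hyC (e ▸ s.qC)
  by_cases hr : ∃ c₂, ProperOn G D c₂ ∧ c₂ y ≠ c₂ p ∧ c₂ y ≠ c₂ q ∧ c₂ p ≠ c₂ q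
  · left
    intro c₁ h₁ k hkp hkq
    by_cases e : c₁ p = c₁ q
    · obtain ⟨c₂, h₂, e₂, n⟩ := s.flexD.same_ne p s.pD q s.qD y hy s.ne
        (fun hn => h₁ s.pC s.qC hn e) hyp hyq
      exact s.extend_color h₁ h₂ hy (by simp [e, e₂]) (by simp [hkp, e₂, n]) (by simp [hkq, n])
    · obtain ⟨c₂, h₂, n1, n2, n3⟩ := hr
      exact s.extend_color h₁ h₂ hy (by simp [e, n3]) (by simp [hkp, n1]) (by simp [hkq, n2])
  · right
    have a1 : ¬ G.Adj y p := fun ha => by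
      obtain ⟨c, hc, n1, n2, n3⟩ := s.flexD.rainbow s.qD hy s.pD hyq.symm s.ne.symm ha
      exact hr ⟨c, hc, n3, n1.symm, n2.symm⟩
    have a2 : ¬ G.Adj y q := fun ha => by
      obtain ⟨c, hc, n1, n2, n3⟩ := s.flexD.rainbow s.pD hy s.qD hyp.symm s.ne ha
      exact hr ⟨c, hc, n1.symm, n3, n2⟩
    have a3 : ¬ G.Adj p q := fun ha => by
      obtain ⟨c, hc, n1, n2, n3⟩ := s.flexD.rainbow hy s.pD s.qD hyp hyq ha
      exact hr ⟨c, hc, n1, n2, n3⟩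
    refine ⟨⟨a1, a2, a3⟩, fun c₁ h₁ k hk => ?_⟩
    by_cases e : c₁ p = c₁ q
    · by_cases ek : k = c₁ p
      · obtain ⟨c₂, h₂, ⟨e1, e2⟩ | hn⟩ := s.flexD.triple y hy p s.pD q s.qD hyp hyq s.ne a1 a2 a3
        · exact s.extend_color h₁ h₂ hy (by simp [e, e2]) (by simp [ek, e1])
            (by simp [ek, e, e1, e2])
        · exact absurd ⟨c₂, h₂, hn⟩ hr
      · obtain ⟨c₂, h₂, e₂, n⟩ := s.flexD.same_ne p s.pD q s.qD y hy s.ne a3 hyp hyq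
        exact s.extend_color h₁ h₂ hy (by simp [e, e₂]) (by simp [ek, e₂, n])
          (by simp [← e, ek, n])
    · rcases hk.resolve_left e with ek | ek
      · obtain ⟨c₂, h₂, e₂, n⟩ := s.flexD.same_ne y hy p s.pD q s.qD hyp a1 hyq.symm s.ne.symm
        exact s.extend_color h₁ h₂ hy (by simp [e, n.symm]) (by simp [ek, e₂])
          (by simp [ek, e, e₂, n.symm])
      · obtain ⟨c₂, h₂, e₂, n⟩ := s.flexD.same_ne y hy q s.qD p s.pD hyq a2 hyp.symm s.ne
        exact s.extend_color h₁ h₂ hy (by simp [e, n]) (by simp [ek, Ne.symm e, e₂, n.symm])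
          (by simp [ek, e₂])

theorem lone_avoid (s : FlexSep G W C D p q) {y : V} (hy : y ∈ D) (hyC : y ∉ C) {c₁ : V → Fin 4}
    (h₁ : ProperOn G C c₁) (k : Fin 4) :
    ∃ c, ProperOn G W c ∧ (∀ v ∈ C, c v = c₁ v) ∧ c y ≠ k := by
  rcases s.lone hy hyC with h | ⟨-, h⟩
  · obtain ⟨m, h1, h2, h3⟩ := exists_ne_three (c₁ p) (c₁ q) k
    obtain ⟨c, hc, hC, e⟩ := h c₁ h₁ m h1 h2
    exact ⟨c, hc, hC, e ▸ h3⟩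
  · have : ∃ m, (c₁ p = c₁ q ∨ m = c₁ p ∨ m = c₁ q) ∧ m ≠ k := by
      by_cases e : c₁ p = c₁ q
      · obtain ⟨m, h1, -⟩ := exists_ne_three k k k
        exact ⟨m, .inl e, h1⟩
      · by_cases e' : c₁ p = k
        · exact ⟨c₁ q, by simp, fun h => e (e'.trans h.symm)⟩
        · exact ⟨c₁ p, by simp, e'⟩
    obtain ⟨m, hm, hmk⟩ := this
    obtain ⟨c, hc, hC, e⟩ := h c₁ h₁ m hm
    exact ⟨c, hc, hC, e ▸ hmk⟩

/-- Any vertex outside `C` can avoid a given colour; a vertex of `C` is assumed to do so already. -/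
theorem extend_ne (s : FlexSep G W C D p q) {y : V} (hy : y ∈ W) {c₁ : V → Fin 4}
    (h₁ : ProperOn G C c₁) (k : Fin 4) (hk : y ∈ C → c₁ y ≠ k) :
    ∃ c, ProperOn G W c ∧ (∀ v ∈ C, c v = c₁ v) ∧ c y ≠ k := by
  by_cases h : y ∈ C
  · obtain ⟨c, hc, hC⟩ := s.extend_perm h₁
    exact ⟨c, hc, hC, by rw [hC y h]; exact hk h⟩
  · exact s.lone_avoid (((s.mem_iff y).1 hy).resolve_left h) h h₁ k

theorem star_three (s : FlexSep G W C D p q) {u x y z : V} (hu : u ∈ C) (hx : x ∈ C) (hy : y ∈ C)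
    (hz : z ∈ W) (ux : u ≠ x) (uy : u ≠ y) (uz : u ≠ z) :
    ∃ c, ProperOn G W c ∧ c u ≠ c x ∧ c u ≠ c y ∧ c u ≠ c z := by
  have : ∃ c, ProperOn G C c ∧ c u ≠ c x ∧ c u ≠ c y ∧ (z ∈ C → c z ≠ c u) := by
    by_cases hzC : z ∈ C
    · obtain ⟨c, hc, h1, h2, h3⟩ := s.flexC.star u hu x hx y hy z hzC ux uy uz
      exact ⟨c, hc, h1, h2, fun _ => h3.symm⟩
    · obtain ⟨c, hc, h1, h2, -⟩ := s.flexC.star u hu x hx y hy x hx ux uy ux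
      exact ⟨c, hc, h1, h2, fun h => absurd h hzC⟩
  obtain ⟨c₁, h₁, n1, n2, n3⟩ := this
  obtain ⟨c, hc, hC, n⟩ := s.extend_ne hz h₁ (c₁ u) n3
  refine ⟨c, hc, ?_, ?_, ?_⟩ <;> grind

theorem star_lone (s : FlexSep G W C D p q) {u x y z : V} (hu : u ∈ C) (hx : x ∈ D) (hy : y ∈ D)
    (hz : z ∈ D) (ux : u ≠ x) (uy : u ≠ y) (uz : u ≠ z) :
    ∃ c, ProperOn G W c ∧ c u ≠ c x ∧ c u ≠ c y ∧ c u ≠ c z := by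
  by_cases huD : u ∈ D
  · exact s.symm.star_three huD hx hy ((s.mem_iff z).2 (.inr hz)) ux uy uz
  rcases s.symm.lone hu huD with h | ⟨⟨-, -, npq⟩, h⟩
  · obtain ⟨c₁, k, h₁, hk⟩ := s.flexD.missing {p, q, x, y, z} (by
      intro v; simp only [Finset.mem_insert, Finset.mem_singleton]
      rintro (rfl | rfl | rfl | rfl | rfl)
      exacts [s.pD, s.qD, hx, hy, hz]) Finset.card_le_five
    obtain ⟨c, hc, hD, e⟩ := h c₁ h₁ k (hk p (by simp)).symm (hk q (by simp)).symm
    have := hk x (by simp)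
    have := hk y (by simp)
    have := hk z (by simp)
    refine ⟨c, hc, ?_, ?_, ?_⟩ <;> grind
  · by_cases hp : p ≠ x ∧ p ≠ y ∧ p ≠ z
    · obtain ⟨c₁, h₁, n1, n2, n3⟩ := s.flexD.star p s.pD x hx y hy z hz hp.1 hp.2.1 hp.2.2
      obtain ⟨c, hc, hD, e⟩ := h c₁ h₁ (c₁ p) (by simp)
      refine ⟨c, hc, ?_, ?_, ?_⟩ <;> grind
    by_cases hq : q ≠ x ∧ q ≠ y ∧ q ≠ z
    · obtain ⟨c₁, h₁, n1, n2, n3⟩ := s.flexD.star q s.qD x hx y hy z hz hq.1 hq.2.1 hq.2.2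
      obtain ⟨c, hc, hD, e⟩ := h c₁ h₁ (c₁ q) (by simp)
      refine ⟨c, hc, ?_, ?_, ?_⟩ <;> grind
    obtain ⟨c₁, h₁, e₁⟩ := s.flexD.same p s.pD q s.qD s.ne npq
    have : ∃ k, k ≠ c₁ x ∧ k ≠ c₁ y ∧ k ≠ c₁ z := exists_ne_three _ _ _
    obtain ⟨k, k1, k2, k3⟩ := this
    obtain ⟨c, hc, hD, e⟩ := h c₁ h₁ k (.inl e₁)
    refine ⟨c, hc, ?_, ?_, ?_⟩ <;> grind

theorem star_two (s : FlexSep G W C D p q) {u x y z : V} (hu : u ∈ C) (hx : x ∈ C) (hy : y ∈ D)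
    (hz : z ∈ D) (ux : u ≠ x) (uy : u ≠ y) (uz : u ≠ z) :
    ∃ c, ProperOn G W c ∧ c u ≠ c x ∧ c u ≠ c y ∧ c u ≠ c z := by
  have hyW : y ∈ W := (s.mem_iff y).2 (.inr hy)
  have hzW : z ∈ W := (s.mem_iff z).2 (.inr hz)
  by_cases huD : u ∈ D
  · obtain ⟨c, hc, n1, n2, n3⟩ :=
      s.symm.star_three huD hy hz ((s.mem_iff x).2 (.inl hx)) uy uz ux
    exact ⟨c, hc, n3, n1, n2⟩
  by_cases hxD : x ∈ D
  · exact s.star_lone hu hxD hy hz ux uy uz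
  by_cases hyC : y ∈ C
  · exact s.star_three hu hx hyC hzW ux uy uz
  by_cases hzC : z ∈ C
  · obtain ⟨c, hc, n1, n2, n3⟩ := s.star_three hu hx hzC hyW ux uz uy
    exact ⟨c, hc, n1, n3, n2⟩
  have hup : u ≠ p := fun e => huD (e ▸ s.pD)
  have huq : u ≠ q := fun e => huD (e ▸ s.qD)
  have hyp : y ≠ p := fun e => hyC (e ▸ s.pC)
  have hyq : y ≠ q := fun e => hyC (e ▸ s.qC)
  have hzp : z ≠ p := fun e => hzC (e ▸ s.pC)
  have hzq : z ≠ q := fun e => hzC (e ▸ s.qC)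
  rcases s.flexD.missing_or_adj s.pD s.qD hy hz s.ne hyp hyq hzp hzq with
    ⟨c₂, m, h₂, npq, np, nq, ny, nz⟩ | ⟨npq, yp, yq, zp, zq⟩
  · obtain ⟨c₁, h₁, n1, n2, n3⟩ := s.flexC.star u hu p s.pC q s.qC x hx hup huq ux
    by_cases e : c₁ p = c₁ q
    · obtain ⟨c, hc, hC, m1, m2⟩ := s.extend_avoid_same h₁ e n1.symm hy hz
      refine ⟨c, hc, ?_, ?_, ?_⟩ <;> grind
    · obtain ⟨c, hc, hC, m1, m2⟩ := s.extend_avoid h₁ h₂ (by simp [e, npq]) n1.symm n2.symm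
        np nq hy hz ny nz
      refine ⟨c, hc, ?_, ?_, ?_⟩ <;> grind
  · obtain ⟨c₁, h₁, n1, hor⟩ := s.flexC.not_rainbow s.pC s.qC hu hx s.ne npq hup huq ux
    have key : c₁ u = c₁ p ∨ c₁ u = c₁ q →
        ∃ c, ProperOn G W c ∧ c u ≠ c x ∧ c u ≠ c y ∧ c u ≠ c z := by
      intro ho
      obtain ⟨c, hc, hC⟩ := s.extend_perm h₁
      have hpW : p ∈ W := (s.mem_iff p).2 (.inl s.pC)
      have hqW : q ∈ W := (s.mem_iff q).2 (.inl s.qC)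
      have := hc hyW hpW yp
      have := hc hyW hqW yq
      have := hc hzW hpW zp
      have := hc hzW hqW zq
      have := hC p s.pC
      have := hC q s.qC
      refine ⟨c, hc, ?_, ?_, ?_⟩ <;> grind
    by_cases ho : c₁ u = c₁ p ∨ c₁ u = c₁ q
    · exact key ho
    · obtain ⟨c, hc, hC, m1, m2⟩ := s.extend_avoid_same h₁ (hor.resolve_right ho)
        (fun e => ho (.inl e.symm)) hy hz
      refine ⟨c, hc, ?_, ?_, ?_⟩ <;> grind

theorem star_left (s : FlexSep G W C D p q) {u x y z : V} (hu : u ∈ C) (hx : x ∈ W) (hy : y ∈ W)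
    (hz : z ∈ W) (ux : u ≠ x) (uy : u ≠ y) (uz : u ≠ z) :
    ∃ c, ProperOn G W c ∧ c u ≠ c x ∧ c u ≠ c y ∧ c u ≠ c z := by
  rcases (s.mem_iff x).1 hx with hx' | hx' <;> rcases (s.mem_iff y).1 hy with hy' | hy' <;>
    rcases (s.mem_iff z).1 hz with hz' | hz'
  · exact s.star_three hu hx' hy' hz ux uy uz
  · exact s.star_three hu hx' hy' hz ux uy uz
  · obtain ⟨c, hc, n1, n2, n3⟩ := s.star_three hu hx' hz' hy ux uz uy
    exact ⟨c, hc, n1, n3, n2⟩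
  · exact s.star_two hu hx' hy' hz' ux uy uz
  · obtain ⟨c, hc, n1, n2, n3⟩ := s.star_three hu hy' hz' hx uy uz ux
    exact ⟨c, hc, n3, n1, n2⟩
  · obtain ⟨c, hc, n1, n2, n3⟩ := s.star_two hu hy' hx' hz' uy ux uz
    exact ⟨c, hc, n2, n1, n3⟩
  · obtain ⟨c, hc, n1, n2, n3⟩ := s.star_two hu hz' hx' hy' uz ux uy
    exact ⟨c, hc, n2, n3, n1⟩
  · exact s.star_lone hu hx' hy' hz' ux uy uz

theorem star (s : FlexSep G W C D p q) {u x y z : V} (hu : u ∈ W) (hx : x ∈ W) (hy : y ∈ W)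
    (hz : z ∈ W) (ux : u ≠ x) (uy : u ≠ y) (uz : u ≠ z) :
    ∃ c, ProperOn G W c ∧ c u ≠ c x ∧ c u ≠ c y ∧ c u ≠ c z := by
  rcases (s.mem_iff u).1 hu with h | h
  · exact s.star_left h hx hy hz ux uy uz
  · exact s.symm.star_left h hx hy hz ux uy uz

theorem same_ne_two (s : FlexSep G W C D p q) {u x y : V} (hu : u ∈ C) (hx : x ∈ C) (hy : y ∈ W)
    (hux : u ≠ x) (hn : ¬ G.Adj u x) (yu : y ≠ u) (yx : y ≠ x) :
    ∃ c, ProperOn G W c ∧ c u = c x ∧ c y ≠ c x := by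
  have : ∃ c, ProperOn G C c ∧ c u = c x ∧ (y ∈ C → c y ≠ c x) := by
    by_cases hyC : y ∈ C
    · obtain ⟨c, hc, h1, h2⟩ := s.flexC.same_ne u hu x hx y hyC hux hn yu yx
      exact ⟨c, hc, h1, fun _ => h2⟩
    · obtain ⟨c, hc, h1⟩ := s.flexC.same u hu x hx hux hn
      exact ⟨c, hc, h1, fun h => absurd h hyC⟩
  obtain ⟨c₁, h₁, n1, n2⟩ := this
  obtain ⟨c, hc, hC, n⟩ := s.extend_ne hy h₁ (c₁ x) n2
  refine ⟨c, hc, ?_, ?_⟩ <;> grind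

theorem same_ne_one (s : FlexSep G W C D p q) {u x y : V} (hu : u ∈ C) (hx : x ∈ D) (hy : y ∈ D)
    (hux : u ≠ x) (hn : ¬ G.Adj u x) (yu : y ≠ u) (yx : y ≠ x) :
    ∃ c, ProperOn G W c ∧ c u = c x ∧ c y ≠ c x := by
  have hyW : y ∈ W := (s.mem_iff y).2 (.inr hy)
  by_cases huD : u ∈ D
  · exact s.symm.same_ne_two huD hx hyW hux hn yu yx
  by_cases hxC : x ∈ C
  · exact s.same_ne_two hu hxC hyW hux hn yu yx
  have hxp : x ≠ p := fun e => hxC (e ▸ s.pC)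
  have hxq : x ≠ q := fun e => hxC (e ▸ s.qC)
  rcases s.symm.lone hu huD with h | ⟨⟨-, -, npq⟩, h⟩
  · obtain ⟨c₁, h₁, n1, n2, n3⟩ := s.flexD.star x hx p s.pD q s.qD y hy hxp hxq yx.symm
    obtain ⟨c, hc, hD, e⟩ := h c₁ h₁ (c₁ x) n1 n2
    refine ⟨c, hc, ?_, ?_⟩ <;> grind
  · obtain ⟨c₁, h₁, n1, hor⟩ := s.flexD.not_rainbow s.pD s.qD hx hy s.ne npq hxp hxq yx.symm
    obtain ⟨c, hc, hD, e⟩ := h c₁ h₁ (c₁ x) hor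
    refine ⟨c, hc, ?_, ?_⟩ <;> grind

theorem same_ne_left (s : FlexSep G W C D p q) {u x y : V} (hu : u ∈ C) (hx : x ∈ W) (hy : y ∈ W)
    (hux : u ≠ x) (hn : ¬ G.Adj u x) (yu : y ≠ u) (yx : y ≠ x) :
    ∃ c, ProperOn G W c ∧ c u = c x ∧ c y ≠ c x := by
  rcases (s.mem_iff x).1 hx with hx' | hx'
  · exact s.same_ne_two hu hx' hy hux hn yu yx
  rcases (s.mem_iff y).1 hy with hy' | hy'
  · obtain ⟨c, hc, e, n⟩ :=
      s.symm.same_ne_one hx' hu hy' hux.symm (fun h => hn h.symm) yx yu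
    exact ⟨c, hc, e.symm, e ▸ n⟩
  · exact s.same_ne_one hu hx' hy' hux hn yu yx

theorem same_ne (s : FlexSep G W C D p q) {u x y : V} (hu : u ∈ W) (hx : x ∈ W) (hy : y ∈ W)
    (hux : u ≠ x) (hn : ¬ G.Adj u x) (yu : y ≠ u) (yx : y ≠ x) :
    ∃ c, ProperOn G W c ∧ c u = c x ∧ c y ≠ c x := by
  rcases (s.mem_iff u).1 hu with h | h
  · exact s.same_ne_left h hx hy hux hn yu yx
  · exact s.symm.same_ne_left h hx hy hux hn yu yx

theorem same (s : FlexSep G W C D p q) {u x : V} (hu : u ∈ W) (hx : x ∈ W)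
    (hux : u ≠ x) (hn : ¬ G.Adj u x) : ∃ c, ProperOn G W c ∧ c u = c x := by
  have : ∃ y ∈ W, y ≠ u ∧ y ≠ x := by
    by_contra! h
    obtain ⟨a, ha, haD⟩ := s.left
    have hap : a ≠ p := fun e => haD (e ▸ s.pD)
    have haq : a ≠ q := fun e => haD (e ▸ s.qD)
    have h1 := h a ((s.mem_iff a).2 (.inl ha))
    have h2 := h p ((s.mem_iff p).2 (.inl s.pC))
    have h3 := h q ((s.mem_iff q).2 (.inl s.qC))
    have := s.ne
    by_cases a = u <;> by_cases p = u <;> grind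
  obtain ⟨y, hy, yu, yx⟩ := this
  obtain ⟨c, hc, e, -⟩ := s.same_ne hu hx hy hux hn yu yx
  exact ⟨c, hc, e⟩

theorem nbrs_same_three (s : FlexSep G W C D p q) {a b x y : V} (ha : a ∈ C) (hb : b ∈ C)
    (hx : x ∈ C) (hy : y ∈ W) (hab : a ≠ b) (hn : ¬ G.Adj a b) (xa : G.Adj x a) (xb : G.Adj x b)
    (yx : y ≠ x) : ∃ c, ProperOn G W c ∧ c a = c b ∧ c x ≠ c y := by
  have : ∃ c, ProperOn G C c ∧ c a = c b ∧ (y ∈ C → c y ≠ c x) := by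
    by_cases hyC : y ∈ C
    · obtain ⟨c, hc, h1, h2⟩ := s.flexC.nbrs_same a ha b hb x hx y hyC hab hn xa xb yx
      exact ⟨c, hc, h1, fun _ => h2.symm⟩
    · obtain ⟨c, hc, h1⟩ := s.flexC.same a ha b hb hab hn
      exact ⟨c, hc, h1, fun h => absurd h hyC⟩
  obtain ⟨c₁, h₁, n1, n2⟩ := this
  obtain ⟨c, hc, hC, n⟩ := s.extend_ne hy h₁ (c₁ x) n2
  refine ⟨c, hc, ?_, ?_⟩ <;> grind

theorem nbrs_same_cut (s : FlexSep G W C D p q) {a b y : V} (ha : a ∈ C) (haD : a ∉ D)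
    (hb : b ∈ D) (hbC : b ∉ C) (hy : y ∈ D) (pa : G.Adj p a) (pb : G.Adj p b) (yp : y ≠ p) :
    ∃ c, ProperOn G W c ∧ c a = c b ∧ c p ≠ c y := by
  have hbq : b ≠ q := fun e => hbC (e ▸ s.qC)
  rcases s.symm.lone ha haD with h | ⟨⟨h, -, -⟩, -⟩
  · obtain ⟨c₁, h₁, n1, n2⟩ := s.flexD.two_ne b hb q s.qD p s.pD y hy hbq yp.symm
    obtain ⟨c, hc, hD, e⟩ := h c₁ h₁ (c₁ b) (h₁ hb s.pD pb.symm) n1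
    have := s.pD
    refine ⟨c, hc, ?_, ?_⟩ <;> grind
  · exact absurd pa.symm h

theorem nbrs_same_mem (s : FlexSep G W C D p q) {a b y : V} (ha : a ∈ W) (hb : b ∈ W)
    (hy : y ∈ W) (hab : a ≠ b) (hn : ¬ G.Adj a b) (pa : G.Adj p a) (pb : G.Adj p b)
    (yp : y ≠ p) : ∃ c, ProperOn G W c ∧ c a = c b ∧ c p ≠ c y := by
  by_cases hC : a ∈ C ∧ b ∈ C
  · exact s.nbrs_same_three hC.1 hC.2 s.pC hy hab hn pa pb yp
  by_cases hD : a ∈ D ∧ b ∈ D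
  · exact s.symm.nbrs_same_three hD.1 hD.2 s.pD hy hab hn pa pb yp
  have ha' := (s.mem_iff a).1 ha
  have hb' := (s.mem_iff b).1 hb
  have main : ∀ {a b : V}, a ∈ C → a ∉ D → b ∈ D → b ∉ C → G.Adj p a → G.Adj p b →
      ∃ c, ProperOn G W c ∧ c a = c b ∧ c p ≠ c y := by
    intro a b h1 h2 h3 h4 pa pb
    rcases (s.mem_iff y).1 hy with hy' | hy'
    · obtain ⟨c, hc, e, n⟩ := s.symm.nbrs_same_cut h3 h4 h1 h2 hy' pb pa yp
      exact ⟨c, hc, e.symm, n⟩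
    · exact s.nbrs_same_cut h1 h2 h3 h4 hy' pa pb yp
  by_cases haC : a ∈ C
  · exact main haC (by tauto) (by tauto) (by tauto) pa pb
  · obtain ⟨c, hc, e, n⟩ := main (a := b) (b := a) (by tauto) (by tauto) (by tauto) haC pb pa
    exact ⟨c, hc, e.symm, n⟩

theorem nbrs_same (s : FlexSep G W C D p q) {a b x y : V} (ha : a ∈ W) (hb : b ∈ W)
    (hx : x ∈ W) (hy : y ∈ W) (hab : a ≠ b) (hn : ¬ G.Adj a b) (xa : G.Adj x a) (xb : G.Adj x b)
    (yx : y ≠ x) : ∃ c, ProperOn G W c ∧ c a = c b ∧ c x ≠ c y := by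
  have mem : ∀ {C D : Finset V}, FlexSep G W C D p q → x ∉ C → ∀ v ∈ W, G.Adj x v → v ∈ D := by
    intro C D s hxC v hv hxv
    by_contra hvD
    exact s.not_adj v (((s.mem_iff v).1 hv).resolve_right hvD) hvD x
      (((s.mem_iff x).1 hx).resolve_left hxC) hxC hxv.symm
  by_cases hxC : x ∈ C
  · by_cases hxD : x ∈ D
    · rcases (s.inter_iff x).1 ⟨hxC, hxD⟩ with rfl | rfl
      · exact s.nbrs_same_mem ha hb hy hab hn xa xb yx
      · exact s.swap.nbrs_same_mem ha hb hy hab hn xa xb yx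
    · exact s.nbrs_same_three (mem s.symm hxD a ha xa) (mem s.symm hxD b hb xb) hxC hy hab hn
        xa xb yx
  · exact s.symm.nbrs_same_three (mem s hxC a ha xa) (mem s hxC b hb xb)
      (((s.mem_iff x).1 hx).resolve_left hxC) hy hab hn xa xb yx

theorem triple_lone (s : FlexSep G W C D p q) {x y z : V} (hx : x ∈ C) (hy : y ∈ D) (hz : z ∈ D)
    (xy : x ≠ y) (xz : x ≠ z) (yz : y ≠ z) (nxy : ¬ G.Adj x y) (nxz : ¬ G.Adj x z)
    (nyz : ¬ G.Adj y z) :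
    ∃ c, ProperOn G W c ∧ ((c x = c y ∧ c y = c z) ∨ (c x ≠ c y ∧ c x ≠ c z ∧ c y ≠ c z)) := by
  by_cases hxD : x ∈ D
  · obtain ⟨c₁, h₁, h⟩ := s.flexD.triple x hxD y hy z hz xy xz yz nxy nxz nyz
    obtain ⟨c, hc, hD⟩ := s.symm.extend_perm h₁
    refine ⟨c, hc, ?_⟩
    rwa [hD x hxD, hD y hy, hD z hz]
  rcases s.symm.lone hx hxD with h | ⟨⟨-, -, npq⟩, h⟩
  · have key : ∀ c₁, ProperOn G D c₁ → c₁ y ≠ c₁ z → (c₁ y = c₁ p ∨ c₁ y = c₁ q ∨ c₁ z = c₁ p ∨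
        c₁ z = c₁ q) → ∃ c, ProperOn G W c ∧
          ((c x = c y ∧ c y = c z) ∨ (c x ≠ c y ∧ c x ≠ c z ∧ c y ≠ c z)) := by
      intro c₁ h₁ n hor
      have : ∃ k, k ≠ c₁ p ∧ k ≠ c₁ q ∧ k ≠ c₁ y ∧ k ≠ c₁ z := by
        rcases hor with e | e | e | e
        · obtain ⟨k, h1, h2, h3⟩ := exists_ne_three (c₁ p) (c₁ q) (c₁ z)
          exact ⟨k, h1, h2, e ▸ h1, h3⟩
        · obtain ⟨k, h1, h2, h3⟩ := exists_ne_three (c₁ p) (c₁ q) (c₁ z)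
          exact ⟨k, h1, h2, e ▸ h2, h3⟩
        · obtain ⟨k, h1, h2, h3⟩ := exists_ne_three (c₁ p) (c₁ q) (c₁ y)
          exact ⟨k, h1, h2, h3, e ▸ h1⟩
        · obtain ⟨k, h1, h2, h3⟩ := exists_ne_three (c₁ p) (c₁ q) (c₁ y)
          exact ⟨k, h1, h2, h3, e ▸ h2⟩
      obtain ⟨k, k1, k2, k3, k4⟩ := this
      obtain ⟨c, hc, hD, e⟩ := h c₁ h₁ k k1 k2
      refine ⟨c, hc, .inr ?_⟩
      rw [hD y hy, hD z hz, e]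
      exact ⟨k3, k4, n⟩
    by_cases hor : y = p ∨ y = q ∨ z = p ∨ z = q
    · obtain ⟨c₁, h₁, n, -⟩ := s.flexD.two_ne y hy z hz y hy z hz yz yz
      exact key c₁ h₁ n (by grind)
    have aux : ∀ u ∈ D, ∀ t ∈ D, ∀ v ∈ D, u ≠ t → v ≠ u → v ≠ t → ¬ G.Adj u v →
        ∃ c₁, ProperOn G D c₁ ∧ c₁ u = c₁ v ∧ c₁ u ≠ c₁ t := by
      intro u hu t ht v hv ut vu vt n
      obtain ⟨c₁, h₁, e, m⟩ := s.flexD.same_ne u hu v hv t ht vu.symm n ut.symm vt.symm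
      exact ⟨c₁, h₁, e, fun e' => m (e' ▸ e)⟩
    have hp := s.pD
    have hq := s.qD
    by_cases a1 : G.Adj y p
    · by_cases a2 : G.Adj y q
      · by_cases a3 : G.Adj z p
        · by_cases a4 : G.Adj z q
          · obtain ⟨c₁, h₁, e₁⟩ := s.flexD.same y hy z hz yz nyz
            obtain ⟨c, hc, hD, e⟩ := h c₁ h₁ (c₁ y) (h₁ hy hp a1) (h₁ hy hq a2)
            refine ⟨c, hc, .inl ?_⟩
            rw [hD y hy, hD z hz, e]
            exact ⟨rfl, e₁⟩
          · obtain ⟨c₁, h₁, e, n⟩ := aux z hz y hy q hq yz.symm (by grind) (by grind) a4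
            exact key c₁ h₁ n.symm (by simp [e])
        · obtain ⟨c₁, h₁, e, n⟩ := aux z hz y hy p hp yz.symm (by grind) (by grind) a3
          exact key c₁ h₁ n.symm (by simp [e])
      · obtain ⟨c₁, h₁, e, n⟩ := aux y hy z hz q hq yz (by grind) (by grind) a2
        exact key c₁ h₁ n (by simp [e])
    · obtain ⟨c₁, h₁, e, n⟩ := aux y hy z hz p hp yz (by grind) (by grind) a1
      exact key c₁ h₁ n (by simp [e])
  · obtain ⟨c₁, h₁, e₁⟩ := s.flexD.same p s.pD q s.qD s.ne npq
    by_cases e' : c₁ y = c₁ z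
    · obtain ⟨c, hc, hD, e⟩ := h c₁ h₁ (c₁ y) (.inl e₁)
      refine ⟨c, hc, .inl ?_⟩
      rw [hD y hy, hD z hz, e]
      exact ⟨rfl, e'⟩
    · obtain ⟨k, k1, k2, -⟩ := exists_ne_three (c₁ y) (c₁ z) (c₁ z)
      obtain ⟨c, hc, hD, e⟩ := h c₁ h₁ k (.inl e₁)
      refine ⟨c, hc, .inr ?_⟩
      rw [hD y hy, hD z hz, e]
      exact ⟨k1, k2, e'⟩

theorem triple_left (s : FlexSep G W C D p q) {x y z : V} (hx : x ∈ C) (hy : y ∈ W) (hz : z ∈ W)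
    (xy : x ≠ y) (xz : x ≠ z) (yz : y ≠ z) (nxy : ¬ G.Adj x y) (nxz : ¬ G.Adj x z)
    (nyz : ¬ G.Adj y z) :
    ∃ c, ProperOn G W c ∧ ((c x = c y ∧ c y = c z) ∨ (c x ≠ c y ∧ c x ≠ c z ∧ c y ≠ c z)) := by
  have nyx := fun h : G.Adj y x => nxy h.symm
  have nzx := fun h : G.Adj z x => nxz h.symm
  have nzy := fun h : G.Adj z y => nyz h.symm
  rcases (s.mem_iff y).1 hy with hy' | hy' <;> rcases (s.mem_iff z).1 hz with hz' | hz'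
  · obtain ⟨c₁, h₁, h⟩ := s.flexC.triple x hx y hy' z hz' xy xz yz nxy nxz nyz
    obtain ⟨c, hc, hC⟩ := s.extend_perm h₁
    refine ⟨c, hc, ?_⟩
    rwa [hC x hx, hC y hy', hC z hz']
  · obtain ⟨c, hc, h⟩ := s.symm.triple_lone hz' hx hy' xz.symm yz.symm xy nzx nzy nxy
    exact ⟨c, hc, by grind⟩
  · obtain ⟨c, hc, h⟩ := s.symm.triple_lone hy' hx hz' xy.symm yz xz nyx nyz nxz
    exact ⟨c, hc, by grind⟩
  · exact s.triple_lone hx hy' hz' xy xz yz nxy nxz nyz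

theorem triple (s : FlexSep G W C D p q) {x y z : V} (hx : x ∈ W) (hy : y ∈ W) (hz : z ∈ W)
    (xy : x ≠ y) (xz : x ≠ z) (yz : y ≠ z) (nxy : ¬ G.Adj x y) (nxz : ¬ G.Adj x z)
    (nyz : ¬ G.Adj y z) :
    ∃ c, ProperOn G W c ∧ ((c x = c y ∧ c y = c z) ∨ (c x ≠ c y ∧ c x ≠ c z ∧ c y ≠ c z)) := by
  rcases (s.mem_iff x).1 hx with h | h
  · exact s.triple_left h hy hz xy xz yz nxy nxz nyz
  · exact s.symm.triple_left h hy hz xy xz yz nxy nxz nyz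

theorem two_ne_three (s : FlexSep G W C D p q) {a b x y : V} (ha : a ∈ C) (hb : b ∈ C)
    (hx : x ∈ C) (hy : y ∈ W) (hab : a ≠ b) (hxy : x ≠ y) :
    ∃ c, ProperOn G W c ∧ c a ≠ c b ∧ c x ≠ c y := by
  have : ∃ c, ProperOn G C c ∧ c a ≠ c b ∧ (y ∈ C → c y ≠ c x) := by
    by_cases hyC : y ∈ C
    · obtain ⟨c, hc, h1, h2⟩ := s.flexC.two_ne a ha b hb x hx y hyC hab hxy
      exact ⟨c, hc, h1, fun _ => h2.symm⟩
    · obtain ⟨c, hc, h1, -⟩ := s.flexC.two_ne a ha b hb a ha b hb hab hab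
      exact ⟨c, hc, h1, fun h => absurd h hyC⟩
  obtain ⟨c₁, h₁, n1, n2⟩ := this
  obtain ⟨c, hc, hC, n⟩ := s.extend_ne hy h₁ (c₁ x) n2
  refine ⟨c, hc, ?_, ?_⟩ <;> grind

theorem two_ne_parallel (s : FlexSep G W C D p q) {a b x y : V} (ha : a ∈ C) (hb : b ∈ C)
    (hx : x ∈ D) (hy : y ∈ D) (hab : a ≠ b) (hxy : x ≠ y) :
    ∃ c, ProperOn G W c ∧ c a ≠ c b ∧ c x ≠ c y := by
  obtain ⟨c₁, h₁, n1, m1⟩ := s.flexC.two_ne a ha b hb p s.pC q s.qC hab s.ne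
  obtain ⟨c₂, h₂, n2, m2⟩ := s.flexD.two_ne x hx y hy p s.pD q s.qD hxy s.ne
  obtain ⟨σ, hp, hq⟩ := exists_perm_two (c₁ p) (c₁ q) (c₂ p) (c₂ q) (by simp [m1, m2])
  obtain ⟨c, hc, hC, hD⟩ := s.glue_perm h₁ h₂ σ hp hq
  refine ⟨c, hc, ?_, ?_⟩
  · rwa [hC a ha, hC b hb]
  · rw [hD x hx, hD y hy]
    exact fun e => n2 (σ.injective e)

/-- Gluing colourings with `p`, `q` coloured differently so that two pairs across differ. -/
theorem glue_ne (s : FlexSep G W C D p q) {c₁ c₂ : V → Fin 4} (h₁ : ProperOn G C c₁)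
    (h₂ : ProperOn G D c₂) (n₁ : c₁ p ≠ c₁ q) (n₂ : c₂ p ≠ c₂ q) {a b x y : V} (ha : a ∈ C)
    (hb : b ∈ D) (hx : x ∈ C) (hy : y ∈ D) (ap : c₁ a = c₁ p → c₂ b ≠ c₂ p)
    (aq : c₁ a = c₁ q → c₂ b ≠ c₂ q) (xp : c₁ x = c₁ p → c₂ y ≠ c₂ p)
    (xq : c₁ x = c₁ q → c₂ y ≠ c₂ q) (hne : c₁ a ≠ c₁ p → c₁ a ≠ c₁ q → c₁ x ≠ c₁ p →
      c₁ x ≠ c₁ q → c₁ a ≠ c₁ x ∧ c₂ b ≠ c₂ y) :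
    ∃ c, ProperOn G W c ∧ c a ≠ c b ∧ c x ≠ c y := by
  obtain ⟨σ, hp, hq⟩ := exists_perm_two (c₁ p) (c₁ q) (c₂ p) (c₂ q) (by simp [n₁, n₂])
  have inj : ∀ u v, c₂ u ≠ c₂ v → σ (c₂ v) ≠ σ (c₂ u) := fun u v h e => h (σ.injective e.symm)
  obtain ⟨i, j, ip, jp, iq, jq, h1, h2⟩ := exists_swap_ne_of_ne (c₁ p) (c₁ q) (c₁ a) (c₁ x)
    (σ (c₂ b)) (σ (c₂ y)) n₁
    (by
      rintro (e | e)
      · rw [e, ← hp]; exact inj _ _ (ap e)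
      · rw [e, ← hq]; exact inj _ _ (aq e))
    (by
      rintro (e | e)
      · rw [e, ← hp]; exact inj _ _ (xp e)
      · rw [e, ← hq]; exact inj _ _ (xq e))
    (fun e1 e2 e3 e4 => ⟨(hne e1 e2 e3 e4).1, (inj _ _ (hne e1 e2 e3 e4).2).symm⟩)
  obtain ⟨c, hc, hC, hD⟩ := s.glue_perm h₁ h₂ (σ.trans (Equiv.swap i j))
    (by simp [hp, swap_apply_of_ne_of_ne ip.symm jp.symm])
    (by simp [hq, swap_apply_of_ne_of_ne iq.symm jq.symm])
  refine ⟨c, hc, ?_, ?_⟩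
  · rwa [hC a ha, hD b hb]
  · rwa [hC x hx, hD y hy]

theorem two_ne_cross_adj (s : FlexSep G W C D p q) {a b x y : V} (ha : a ∈ C)
    (hb : b ∈ D) (hx : x ∈ C) (hy : y ∈ D) (hbC : b ∉ C) (hyC : y ∉ C) (hby : b ≠ y)
    (hpq : G.Adj p q) : ∃ c, ProperOn G W c ∧ c a ≠ c b ∧ c x ≠ c y := by
  have hp := s.pD
  have hq := s.qD
  have hpq' := s.ne
  have hbp : b ≠ p := fun e => hbC (e ▸ s.pC)
  have hbq : b ≠ q := fun e => hbC (e ▸ s.qC)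
  have hyp : y ≠ p := fun e => hyC (e ▸ s.pC)
  have hyq : y ≠ q := fun e => hyC (e ▸ s.qC)
  have nD : ∀ c₂, ProperOn G D c₂ → c₂ p ≠ c₂ q := fun c₂ h₂ => h₂ hp hq hpq
  obtain ⟨c₁, h₁, n₁, -⟩ := s.flexC.two_ne p s.pC q s.qC p s.pC q s.qC hpq' hpq'
  have end_of : ∀ u, c₁ u = c₁ p ∨ c₁ u = c₁ q → ∃ v ∈ D, (v = p ∨ v = q) ∧ c₁ u = c₁ v := by
    rintro u (e | e)
    · exact ⟨p, hp, .inl rfl, e⟩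
    · exact ⟨q, hq, .inr rfl, e⟩
  by_cases oa : c₁ a = c₁ p ∨ c₁ a = c₁ q
  · obtain ⟨v, hv, hvpq, ev⟩ := end_of a oa
    by_cases ox : c₁ x = c₁ p ∨ c₁ x = c₁ q
    · obtain ⟨w, hw, hwpq, ew⟩ := end_of x ox
      obtain ⟨c₂, h₂, m1, m2⟩ := s.flexD.two_ne b hb v hv y hy w hw (by grind) (by grind)
      exact s.glue_ne h₁ h₂ n₁ (nD c₂ h₂) ha hb hx hy (by grind) (by grind) (by grind) (by grind)
        (by grind)
    · obtain ⟨c₂, h₂, m1, m2⟩ := s.flexD.two_ne b hb v hv b hb v hv (by grind) (by grind)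
      exact s.glue_ne h₁ h₂ n₁ (nD c₂ h₂) ha hb hx hy (by grind) (by grind) (by grind) (by grind)
        (by grind)
  · by_cases ox : c₁ x = c₁ p ∨ c₁ x = c₁ q
    · obtain ⟨w, hw, hwpq, ew⟩ := end_of x ox
      obtain ⟨c₂, h₂, m1, m2⟩ := s.flexD.two_ne y hy w hw y hy w hw (by grind) (by grind)
      exact s.glue_ne h₁ h₂ n₁ (nD c₂ h₂) ha hb hx hy (by grind) (by grind) (by grind) (by grind)
        (by grind)
    · by_cases e : c₁ a = c₁ x
      · obtain ⟨c₂, m, h₂, hm⟩ := s.flexD.missing {p, q, b, y} (by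
          intro v; simp only [Finset.mem_insert, Finset.mem_singleton]
          rintro (rfl | rfl | rfl | rfl) <;> assumption)
          (Finset.card_le_four.trans (by norm_num))
        obtain ⟨c, hc, hC, k1, k2⟩ := s.extend_avoid h₁ h₂ (by simp [n₁, nD c₂ h₂])
          (k := c₁ a) (by grind) (by grind) (hm p (by simp)) (hm q (by simp)) hb hy
          (hm b (by simp)) (hm y (by simp))
        refine ⟨c, hc, ?_, ?_⟩ <;> grind
      · obtain ⟨c₂, h₂, m1, m2⟩ := s.flexD.two_ne b hb y hy b hb y hy hby hby
        exact s.glue_ne h₁ h₂ n₁ (nD c₂ h₂) ha hb hx hy (by grind) (by grind) (by grind)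
          (by grind) (by grind)

theorem two_ne_cross (s : FlexSep G W C D p q) {a b x y : V} (ha : a ∈ C)
    (hb : b ∈ D) (hx : x ∈ C) (hy : y ∈ D) (hxD : x ∉ D) (hbC : b ∉ C) (hyC : y ∉ C)
    (hby : b ≠ y) : ∃ c, ProperOn G W c ∧ c a ≠ c b ∧ c x ≠ c y := by
  by_cases hpq : G.Adj p q
  · exact s.two_ne_cross_adj ha hb hx hy hbC hyC hby hpq
  obtain ⟨c₁, h₁, e₁, n₁⟩ := s.flexC.same_ne p s.pC q s.qC x hx s.ne hpq
    (fun e => hxD (e ▸ s.pD)) (fun e => hxD (e ▸ s.qD))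
  obtain ⟨c₂, h₂, e₂, n₂⟩ := s.flexD.same_ne p s.pD q s.qD b hb s.ne hpq
    (fun e => hbC (e ▸ s.pC)) (fun e => hbC (e ▸ s.qC))
  obtain ⟨σ, hp, hq⟩ := exists_perm_two (c₁ p) (c₁ q) (c₂ p) (c₂ q) (by simp [e₁, e₂])
  obtain ⟨i, j, ip, jp, h1, h2⟩ := exists_swap_ne_of_same (c₁ p) (c₁ a) (c₁ x)
    (σ (c₂ b)) (σ (c₂ y)) (e₁ ▸ n₁) (by rw [← hp, e₂]; exact fun e => n₂ (σ.injective e))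
  obtain ⟨c, hc, hC, hD⟩ := s.glue_perm h₁ h₂ (σ.trans (Equiv.swap i j))
    (by simp [hp, swap_apply_of_ne_of_ne ip.symm jp.symm])
    (by simp [hq, ← e₁, swap_apply_of_ne_of_ne ip.symm jp.symm])
  refine ⟨c, hc, ?_, ?_⟩
  · rwa [hC a ha, hD b hb]
  · rwa [hC x hx, hD y hy]

theorem two_ne_left (s : FlexSep G W C D p q) {a b x y : V} (ha : a ∈ C) (hb : b ∈ W)
    (hx : x ∈ W) (hy : y ∈ W) (hab : a ≠ b) (hxy : x ≠ y) (hby : b ≠ y) (hbx : b ≠ x) :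
    ∃ c, ProperOn G W c ∧ c a ≠ c b ∧ c x ≠ c y := by
  have haW : a ∈ W := (s.mem_iff a).2 (.inl ha)
  by_cases hbC : b ∈ C
  · by_cases hxC : x ∈ C
    · exact s.two_ne_three ha hbC hxC hy hab hxy
    by_cases hyC : y ∈ C
    · obtain ⟨c, hc, h1, h2⟩ := s.two_ne_three ha hbC hyC hx hab hxy.symm
      exact ⟨c, hc, h1, h2.symm⟩
    exact s.two_ne_parallel ha hbC (((s.mem_iff x).1 hx).resolve_left hxC)
      (((s.mem_iff y).1 hy).resolve_left hyC) hab hxy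
  have hbD := ((s.mem_iff b).1 hb).resolve_left hbC
  have main : ∀ {x y : V}, x ∈ C → y ∈ W → x ≠ y → b ≠ y →
      ∃ c, ProperOn G W c ∧ c a ≠ c b ∧ c x ≠ c y := by
    intro x y hxC hy hxy hby
    by_cases hyC : y ∈ C
    · obtain ⟨c, hc, h1, h2⟩ := s.two_ne_three hxC hyC ha hb hxy hab
      exact ⟨c, hc, h2, h1⟩
    have hyD := ((s.mem_iff y).1 hy).resolve_left hyC
    by_cases hxD : x ∈ D
    · obtain ⟨c, hc, h1, h2⟩ := s.symm.two_ne_three hxD hyD hbD haW hxy hab.symm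
      exact ⟨c, hc, h2.symm, h1⟩
    exact s.two_ne_cross ha hbD hxC hyD hxD hbC hyC hby
  by_cases hxC : x ∈ C
  · exact main hxC hy hxy hby
  by_cases hyC : y ∈ C
  · obtain ⟨c, hc, h1, h2⟩ := main hyC hx hxy.symm hbx
    exact ⟨c, hc, h1, h2.symm⟩
  obtain ⟨c, hc, h1, h2⟩ := s.symm.two_ne_three (((s.mem_iff x).1 hx).resolve_left hxC)
    (((s.mem_iff y).1 hy).resolve_left hyC) hbD haW hxy hab.symm
  exact ⟨c, hc, h2.symm, h1⟩

theorem two_ne (s : FlexSep G W C D p q) {a b x y : V} (ha : a ∈ W) (hb : b ∈ W)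
    (hx : x ∈ W) (hy : y ∈ W) (hab : a ≠ b) (hxy : x ≠ y) :
    ∃ c, ProperOn G W c ∧ c a ≠ c b ∧ c x ≠ c y := by
  by_cases hbx : b = x
  · subst hbx
    obtain ⟨c, hc, h1, h2, -⟩ := s.star hb ha hy hy hab.symm hxy hxy
    exact ⟨c, hc, h1.symm, h2⟩
  by_cases hby : b = y
  · subst hby
    obtain ⟨c, hc, h1, h2, -⟩ := s.star hb ha hx hx hab.symm hxy.symm hxy.symm
    exact ⟨c, hc, h1.symm, h2.symm⟩
  rcases (s.mem_iff a).1 ha with h | h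
  · exact s.two_ne_left h hb hx hy hab hxy hby hbx
  · exact s.symm.two_ne_left h hb hx hy hab hxy hby hbx

theorem missing_erase (s : FlexSep G W C D p q) {T : Finset V} (hcard : T.card ≤ 5) {t : V}
    (ht : T.filter (· ∉ D) ⊆ {t}) (htC : t ∈ C) (htD : t ∉ D) :
    ∃ c, ∃ k, ProperOn G W c ∧ ∀ v ∈ T, c v ≠ k := by
  obtain ⟨c₁, k, h₁, hk⟩ := s.flexD.missing (T.filter (· ∈ D)) (by intro v; simp)
    ((Finset.card_filter_le _ _).trans hcard)
  obtain ⟨c, hc, hD, n⟩ := s.symm.lone_avoid htC htD h₁ k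
  refine ⟨c, k, hc, fun v hv => ?_⟩
  by_cases hvD : v ∈ D
  · rw [hD v hvD]
    exact hk v (by simp [hv, hvD])
  · have := ht (Finset.mem_filter.2 ⟨hv, hvD⟩)
    rw [Finset.mem_singleton.1 this]
    exact n

theorem missing_pair (s : FlexSep G W C D p q) {T : Finset V} (hT : T ⊆ W) (hcard : T.card ≤ 5)
    {x y : V} (hxy : x ≠ y) (e : T.filter (· ∉ C) = {x, y})
    (hCcard : 2 ≤ (T.filter (· ∉ D)).card) :
    ∃ c, ∃ k, ProperOn G W c ∧ ∀ v ∈ T, c v ≠ k := by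
  have mem : ∀ v, (v ∈ T ∧ v ∉ C) ↔ (v = x ∨ v = y) := by
    intro v
    simpa using Finset.ext_iff.1 e v
  obtain ⟨hxT, hxC⟩ := (mem x).2 (.inl rfl)
  obtain ⟨hyT, hyC⟩ := (mem y).2 (.inr rfl)
  have hxD := ((s.mem_iff x).1 (hT hxT)).resolve_left hxC
  have hyD := ((s.mem_iff y).1 (hT hyT)).resolve_left hyC
  have hXcard : (T.filter (· ∈ C)).card ≤ 3 := by
    have h1 := Finset.card_filter_add_card_filter_not (s := T) (· ∈ C)
    rw [e, Finset.card_pair hxy] at h1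
    omega
  have finish : ∀ c k, ProperOn G W c → (∀ v ∈ T, v ∈ C → c v ≠ k) → c x ≠ k → c y ≠ k →
      ∃ c, ∃ k, ProperOn G W c ∧ ∀ v ∈ T, c v ≠ k := by
    intro c k hc hk hx hy
    refine ⟨c, k, hc, fun v hv => ?_⟩
    by_cases hvC : v ∈ C
    · exact hk v hv hvC
    · rcases (mem v).1 ⟨hv, hvC⟩ with rfl | rfl <;> assumption
  rcases s.flexD.missing_or_adj s.pD s.qD hxD hyD s.ne (fun e => hxC (e ▸ s.pC))
    (fun e => hxC (e ▸ s.qC)) (fun e => hyC (e ▸ s.pC)) (fun e => hyC (e ▸ s.qC)) with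
    ⟨c₂, m, h₂, npq, np, nq, nx, ny⟩ | ⟨npq, xp, xq, yp, yq⟩
  · obtain ⟨c₁, k, h₁, hk⟩ := s.flexC.missing (T.filter (· ∈ C) ∪ {p, q}) (by
      intro v; simp only [Finset.mem_union, Finset.mem_filter, Finset.mem_insert,
        Finset.mem_singleton]
      rintro (h | rfl | rfl)
      exacts [h.2, s.pC, s.qC])
      ((Finset.card_union_le _ _).trans (by have := Finset.card_le_two (a := p) (b := q); omega))
    have kp := hk p (by simp)
    have kq := hk q (by simp)
    have : ∃ c, ProperOn G W c ∧ (∀ v ∈ C, c v = c₁ v) ∧ c x ≠ k ∧ c y ≠ k := by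
      by_cases e' : c₁ p = c₁ q
      · exact s.extend_avoid_same h₁ e' kp hxD hyD
      · exact s.extend_avoid h₁ h₂ (by simp [e', npq]) kp kq np nq hxD hyD nx ny
    obtain ⟨c, hc, hC, k1, k2⟩ := this
    exact finish c k hc (fun v hv hvC => by rw [hC v hvC]; exact hk v (by simp [hv, hvC])) k1 k2
  · have key : ∀ r ∈ C, r ∈ D → r ∉ T → G.Adj x r → G.Adj y r →
        ∃ c, ∃ k, ProperOn G W c ∧ ∀ v ∈ T, c v ≠ k := by
      intro r hrC hrD hrT xr yr
      have hst : ∃ c, ProperOn G C c ∧ ∀ v ∈ T, v ∈ C → c v ≠ c r := by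
        obtain ⟨X, hTX, hX⟩ : ∃ X, T.filter (· ∈ C) = X ∧ X.card ≤ 3 := ⟨_, rfl, hXcard⟩
        have hne : X.Nonempty := by
          rw [← Finset.card_pos, ← hTX]
          have : T.filter (· ∉ D) ⊆ T.filter (· ∈ C) := by
            intro v hv
            rw [Finset.mem_filter] at hv ⊢
            exact ⟨hv.1, ((s.mem_iff v).1 (hT hv.1)).resolve_right hv.2⟩
          have := Finset.card_le_card this
          omega
        obtain ⟨a, b, d, rfl⟩ : ∃ a b d, X = {a, b, d} := by
          have h0 := hne.card_pos
          obtain h | h | h : X.card = 1 ∨ X.card = 2 ∨ X.card = 3 := by omega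
          · obtain ⟨a, rfl⟩ := Finset.card_eq_one.1 h
            exact ⟨a, a, a, by simp⟩
          · obtain ⟨a, b, -, rfl⟩ := Finset.card_eq_two.1 h
            exact ⟨a, b, b, by simp⟩
          · obtain ⟨a, b, d, -, -, -, rfl⟩ := Finset.card_eq_three.1 h
            exact ⟨a, b, d, rfl⟩
        have hm : ∀ v, (v ∈ T ∧ v ∈ C) ↔ (v = a ∨ v = b ∨ v = d) := by
          intro v
          simpa using Finset.ext_iff.1 hTX v
        have ha := (hm a).2 (by simp)
        have hb := (hm b).2 (by simp)
        have hd := (hm d).2 (by simp)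
        obtain ⟨c₁, h₁, n1, n2, n3⟩ := s.flexC.star r hrC a ha.2 b hb.2 d hd.2
          (fun e => hrT (e ▸ ha.1)) (fun e => hrT (e ▸ hb.1)) (fun e => hrT (e ▸ hd.1))
        refine ⟨c₁, h₁, fun v hv hvC => ?_⟩
        rcases (hm v).1 ⟨hv, hvC⟩ with rfl | rfl | rfl
        exacts [n1.symm, n2.symm, n3.symm]
      obtain ⟨c₁, h₁, hk⟩ := hst
      obtain ⟨c, hc, hC⟩ := s.extend_perm h₁
      have hrW := (s.mem_iff r).2 (.inl hrC)
      exact finish c (c r) hc (fun v hv hvC => by rw [hC v hvC, hC r hrC]; exact hk v hv hvC)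
        (hc (hT hxT) hrW xr) (hc (hT hyT) hrW yr)
    by_cases hpT : p ∈ T
    · by_cases hqT : q ∈ T
      · exfalso
        have hsub : T.filter (· ∉ D) ∪ {p, q} ⊆ T.filter (· ∈ C) := by
          intro v hv
          simp only [Finset.mem_union, Finset.mem_filter, Finset.mem_insert,
            Finset.mem_singleton] at hv ⊢
          rcases hv with h | rfl | rfl
          exacts [⟨h.1, ((s.mem_iff v).1 (hT h.1)).resolve_right h.2⟩, ⟨hpT, s.pC⟩, ⟨hqT, s.qC⟩]
        have h1 := Finset.card_le_card hsub
        rw [Finset.card_union_of_disjoint, Finset.card_pair s.ne] at h1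
        · omega
        · rw [Finset.disjoint_left]
          intro v hv hv'
          rw [Finset.mem_filter] at hv
          rcases Finset.mem_insert.1 hv' with rfl | h
          · exact hv.2 s.pD
          · exact hv.2 (Finset.mem_singleton.1 h ▸ s.qD)
      · exact key q s.qC s.qD hqT xq yq
    · exact key p s.pC s.pD hpT xp yp

theorem missing_of_card_le (s : FlexSep G W C D p q) {T : Finset V} (hT : T ⊆ W)
    (hcard : T.card ≤ 5) (hle : (T.filter (· ∉ C)).card ≤ (T.filter (· ∉ D)).card) :
    ∃ c, ∃ k, ProperOn G W c ∧ ∀ v ∈ T, c v ≠ k := by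
  have hdisj : (T.filter (· ∉ C)).card + (T.filter (· ∉ D)).card ≤ T.card := by
    rw [← Finset.card_union_of_disjoint]
    · exact Finset.card_le_card
        (Finset.union_subset (Finset.filter_subset _ _) (Finset.filter_subset _ _))
    · rw [Finset.disjoint_left]
      intro v hv hv'
      rw [Finset.mem_filter] at hv hv'
      rcases (s.mem_iff v).1 (hT hv.1) with h | h
      exacts [hv.2 h, hv'.2 h]
  by_cases h1 : (T.filter (· ∉ C)).card ≤ 1
  · obtain ⟨b, hb, hbC⟩ := s.right
    rcases (T.filter (· ∉ C)).eq_empty_or_nonempty with h | ⟨t, ht⟩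
    · exact s.symm.missing_erase hcard (t := b) (by simp [h]) hb hbC
    · have htC := (Finset.mem_filter.1 ht)
      refine s.symm.missing_erase hcard (t := t) (fun v hv => ?_)
        (((s.mem_iff t).1 (hT htC.1)).resolve_left htC.2) htC.2
      exact Finset.mem_singleton.2 (Finset.card_le_one.1 h1 v hv t ht)
  · obtain ⟨x, y, hxy, e⟩ := Finset.card_eq_two.1 (by omega : (T.filter (· ∉ C)).card = 2)
    exact s.missing_pair hT hcard hxy e (by omega)

theorem missing (s : FlexSep G W C D p q) {T : Finset V} (hT : T ⊆ W) (hcard : T.card ≤ 5) :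
    ∃ c, ∃ k, ProperOn G W c ∧ ∀ v ∈ T, c v ≠ k := by
  rcases le_total (T.filter (· ∉ C)).card (T.filter (· ∉ D)).card with h | h
  · exact s.missing_of_card_le hT hcard h
  · exact s.symm.missing_of_card_le hT hcard h

theorem flexible (s : FlexSep G W C D p q) : Flexible G W where
  same _ hu _ hx := s.same hu hx
  same_ne _ hu _ hx _ hy := s.same_ne hu hx hy
  nbrs_same _ ha _ hb _ hx _ hy := s.nbrs_same ha hb hx hy
  triple _ hx _ hy _ hz := s.triple hx hy hz
  two_ne _ ha _ hb _ hx _ hy := s.two_ne ha hb hx hy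
  star _ hu _ hx _ hy _ hz := s.star hu hx hy hz
  missing _ hT hcard := s.missing hT hcard

end FlexSep

theorem ProperOn.of_injOn {G : SimpleGraph V} {W : Finset V} {c : V → Fin 4}
    (h : Set.InjOn c W) : ProperOn G W c :=
  fun _ ha _ hb hab e => hab.ne (h ha hb e)

theorem Flexible.of_card_le_three {G : SimpleGraph V} {W : Finset V} (hW : W.card ≤ 3) :
    Flexible G W := by
  classical
  obtain ⟨c, hc⟩ : ∃ c : V → Fin 4, Set.InjOn c W := by
    obtain ⟨f⟩ : Nonempty (W ↪ Fin 4) := by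
      rw [Function.Embedding.nonempty_iff_card_le]
      simp only [Fintype.card_coe, Fintype.card_fin]
      omega
    refine ⟨fun v => if h : v ∈ W then f ⟨v, h⟩ else 0, fun a ha b hb e => ?_⟩
    rw [Finset.mem_coe] at ha hb
    simpa [ha, hb] using e
  have ne : ∀ {a b}, a ∈ W → b ∈ W → a ≠ b → c a ≠ c b := fun ha hb h e => h (hc ha hb e)
  have pc : ProperOn G W c := .of_injOn hc
  have cover : ∀ {a b x}, a ∈ W → b ∈ W → x ∈ W → a ≠ b → a ≠ x → b ≠ x →
      ∀ v ∈ W, v = a ∨ v = b ∨ v = x := by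
    intro a b x ha hb hx h1 h2 h3 v hv
    by_contra! h
    have hsub : ({v, a, b, x} : Finset V) ⊆ W := by
      intro w; simp only [Finset.mem_insert, Finset.mem_singleton]
      rintro (rfl | rfl | rfl | rfl) <;> assumption
    have := Finset.card_le_card hsub
    have : ({v, a, b, x} : Finset V).card = 4 := by
      simp [Finset.card_insert_of_notMem, h, h1, h2, h3]
    omega
  have merge : ∀ {u x}, u ∈ W → x ∈ W → u ≠ x → ¬ G.Adj u x →
      ∃ c, ProperOn G W c ∧ c u = c x ∧ ∀ y ∈ W, y ≠ u → y ≠ x → c y ≠ c x := by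
    intro u x hu hx hux hn
    refine ⟨fun v => if v = x then c u else c v, fun a ha b hb hab => ?_, by simp,
      fun y hy yu yx => by simpa [yx] using ne hy hu yu⟩
    have := ne ha hb hab.ne
    have := ne ha hu
    have := ne hb hu
    have := hab.ne
    have := hab.symm
    grind
  exact
    { same := fun u hu x hx hux hn => by
        obtain ⟨c, h, e, -⟩ := merge hu hx hux hn
        exact ⟨c, h, e⟩
      same_ne := fun u hu x hx y hy hux hn yu yx => by
        obtain ⟨c, h, e, n⟩ := merge hu hx hux hn
        exact ⟨c, h, e, n y hy yu yx⟩
      nbrs_same := fun a ha b hb x hx y hy hab hn xa xb yx => by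
        obtain ⟨c, h, e, n⟩ := merge ha hb hab hn
        have := cover ha hb hx hab xa.ne.symm xb.ne.symm y hy
        have := h hx ha xa
        have := h hx hb xb
        exact ⟨c, h, e, by grind⟩
      triple := fun x hx y hy z hz xy xz yz _ _ _ =>
        ⟨c, pc, .inr ⟨ne hx hy xy, ne hx hz xz, ne hy hz yz⟩⟩
      two_ne := fun a ha b hb x hx y hy hab hxy => ⟨c, pc, ne ha hb hab, ne hx hy hxy⟩
      star := fun u hu x hx y hy z hz ux uy uz =>
        ⟨c, pc, ne hu hx ux, ne hu hy uy, ne hu hz uz⟩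
      missing := fun T hT _ => by
        have : ((T.image c)ᶜ).Nonempty := by
          rw [← Finset.card_pos, Finset.card_compl, Fintype.card_fin]
          have := (Finset.card_image_le (s := T) (f := c)).trans (Finset.card_le_card hT)
          omega
        obtain ⟨k, hk⟩ := this
        refine ⟨c, k, pc, fun t ht e => Finset.mem_compl.1 hk ?_⟩
        exact Finset.mem_image.2 ⟨t, ht, e⟩ }

theorem exists_separation_of_inter_card_add [DecidableEq V] {G : SimpleGraph V} (n : ℕ) :
    ∀ C D : Finset V, 4 ≤ (C ∪ D).card → (C ∩ D).card + n = 2 →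
    (∀ a ∈ C, a ∉ D → ∀ b ∈ D, b ∉ C → ¬ G.Adj a b) → (C \ D).Nonempty → (D \ C).Nonempty →
    ∃ C' D' p q, Separation G (C ∪ D) C' D' p q := by
  induction n with
  | zero =>
    intro C D _ hi hn hC hD
    obtain ⟨p, q, hpq, e⟩ := Finset.card_eq_two.1 hi
    refine ⟨C, D, p, q, fun v => Finset.mem_union, fun v => ?_, hpq, hn, ?_, ?_⟩
    · simpa using Finset.ext_iff.1 e v
    · obtain ⟨a, ha⟩ := hC
      exact ⟨a, Finset.mem_sdiff.1 ha⟩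
    · obtain ⟨a, ha⟩ := hD
      exact ⟨a, Finset.mem_sdiff.1 ha⟩
  | succ n ih =>
    have main : ∀ C D : Finset V, 4 ≤ (C ∪ D).card → (C ∩ D).card + (n + 1) = 2 →
        (∀ a ∈ C, a ∉ D → ∀ b ∈ D, b ∉ C → ¬ G.Adj a b) → 1 < (C \ D).card → (D \ C).Nonempty →
        ∃ C' D' p q, Separation G (C ∪ D) C' D' p q := by
      intro C D h4 hi hn hC hD
      obtain ⟨a, ha, b, hb, hab⟩ := Finset.one_lt_card.1 hC
      rw [Finset.mem_sdiff] at ha hb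
      have hU : C ∪ insert a D = C ∪ D := by
        rw [Finset.union_insert, Finset.insert_eq_self]
        exact Finset.mem_union_left _ ha.1
      rw [← hU] at h4 ⊢
      refine ih C (insert a D) h4 ?_ ?_ ⟨b, by simp [hb, hab.symm]⟩ ?_
      · rw [Finset.inter_insert_of_mem ha.1, Finset.card_insert_of_notMem (by simp [ha.2])]
        omega
      · intro u hu hu' v hv hv'
        rw [Finset.mem_insert, not_or] at hu'
        rcases Finset.mem_insert.1 hv with rfl | hv
        · exact absurd ha.1 hv'
        · exact hn u hu hu'.2 v hv hv'
      · rwa [Finset.insert_sdiff_of_mem _ ha.1]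
    intro C D h4 hi hn hC hD
    by_cases h : 1 < (C \ D).card
    · exact main C D h4 hi hn h hD
    · rw [Finset.union_comm] at h4 ⊢
      refine main D C h4 (by rwa [Finset.inter_comm])
        (fun a ha ha' b hb hb' hab => hn b hb hb' a ha ha' hab.symm) ?_ hC
      have h1 := Finset.card_sdiff_add_card D C
      have h2 := Finset.card_sdiff_add_card_inter C D
      omega

/-- A graph on at least four vertices without 3-connected subgraph has a cutset of two vertices. -/
theorem exists_separation {G : SimpleGraph V} (hG : G.Fragile) {W : Finset V} (hW : 4 ≤ W.card) :
    ∃ C D p q, Separation G W C D p q := by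
  classical
  let H : G.Subgraph := (⊤ : G.Subgraph).induce W
  have hcard : Nat.card H.verts = W.card := by
    simp [H]
  have hfin : Finite H.verts := W.finite_toSet
  have hH := hG H
  rw [SimpleGraph.IsKConnected, hcard] at hH
  push Not at hH
  obtain ⟨S, hS, hSc⟩ := hH hW
  have : ∃ u v : (Sᶜ : Set H.verts), ¬ (H.coe.induce Sᶜ).Reachable u v := by
    by_contra! h
    have hne : (Sᶜ).Nonempty := by
      by_contra hne
      rw [Set.not_nonempty_iff_eq_empty, Set.compl_empty_iff] at hne
      rw [hne, Set.ncard_univ, hcard] at hS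
      omega
    exact hSc ((SimpleGraph.connected_iff _).2 ⟨h, hne.to_subtype⟩)
  obtain ⟨u, v, huv⟩ := this
  let R : V → Prop := fun w => ∃ (h : w ∈ H.verts) (h' : ⟨w, h⟩ ∈ Sᶜ),
    (H.coe.induce Sᶜ).Reachable u ⟨⟨w, h⟩, h'⟩
  let S' : V → Prop := fun w => ∃ h : w ∈ H.verts, ⟨w, h⟩ ∈ S
  have hu : R u := ⟨u.1.2, u.2, .refl _⟩
  have hv : ¬ R v := fun ⟨_, _, h⟩ => huv h
  have hvS : ¬ S' v := fun ⟨_, h⟩ => v.2 h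
  have huW : (u : V) ∈ W := u.1.2
  have hvW : (v : V) ∈ W := v.1.2
  have hU : W.filter (fun w => R w ∨ S' w) ∪ W.filter (fun w => ¬ R w) = W := by
    ext w
    by_cases h : R w <;> simp +contextual [h]
  have hI : (W.filter (fun w => R w ∨ S' w) ∩ W.filter (fun w => ¬ R w)).card ≤ 2 := by
    refine le_trans ?_ hS
    rw [← Set.ncard_image_of_injective S Subtype.val_injective, ← Set.ncard_coe_finset]
    refine Set.ncard_le_ncard (fun w hw => ?_) (Set.toFinite _)
    simp only [Finset.coe_inter, Finset.coe_filter, Set.mem_inter_iff, Set.mem_ofPred_eq] at hw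
    obtain ⟨h, h'⟩ := hw.1.2.resolve_left hw.2.2
    exact ⟨_, h', rfl⟩
  have := exists_separation_of_inter_card_add (G := G) _ _ _ (hU.symm ▸ hW)
    (Nat.add_sub_cancel' hI) ?_ ⟨u, by simp [huW, hu]⟩ ⟨v, by simp [hvW, hv, hvS]⟩
  · rwa [hU] at this
  · intro a ha ha' b hb hb' hab
    simp only [Finset.mem_filter, not_and, not_not] at ha ha' hb hb'
    have hbS : ¬ S' b := fun h => hb' hb.1 (.inr h)
    obtain ⟨h1, h2, h3⟩ := ha' ha.1
    refine hb.2 ⟨hb.1, fun h => hbS ⟨_, h⟩, h3.trans (SimpleGraph.Adj.reachable ?_)⟩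
    simpa [H] using ⟨ha.1, hb.1, hab⟩

theorem flexible_of_fragile {G : SimpleGraph V} (hG : G.Fragile) (W : Finset V) :
    Flexible G W := by
  classical
  induction W using Finset.strongInduction with
  | H W ih =>
    by_cases hW : W.card ≤ 3
    · exact .of_card_le_three hW
    obtain ⟨C, D, p, q, h⟩ := exists_separation hG (by omega : 4 ≤ W.card)
    refine FlexSep.flexible ⟨h, ih C ?_, ih D ?_⟩
    · obtain ⟨b, hb, hbC⟩ := h.right
      exact Finset.ssubset_iff_of_subset (fun v hv => (h.mem_iff v).2 (.inl hv)) |>.2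
        ⟨b, (h.mem_iff b).2 (.inr hb), hbC⟩
    · obtain ⟨b, hb, hbD⟩ := h.left
      exact Finset.ssubset_iff_of_subset (fun v hv => (h.mem_iff v).2 (.inr hv)) |>.2
        ⟨b, (h.mem_iff b).2 (.inl hb), hbD⟩

end FragileColoring

/-- Every fragile graph has chromatic number at most 4. -/
theorem statement2 {V : Type*} [Fintype V] (G : SimpleGraph V) (hG : G.Fragile) :
    G.chromaticNumber ≤ 4 := by
  obtain ⟨c, -, hc, -⟩ := (FragileColoring.flexible_of_fragile hG Finset.univ).missing ∅
    (Finset.empty_subset _) (by simp)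
  have : G.Colorable 4 := ⟨SimpleGraph.Coloring.mk c fun {a b} hab =>
    hc (Finset.mem_univ a) (Finset.mem_univ b) hab⟩
  exact this.chromaticNumber_le
end

section
/- For every integer m ≥ 4, every m-fragile finite simple graph G satisfies: for all distinct non-adjacent vertices x, y of G, there exists a proper colouring c of G with colours from {1, …, m} such that c(x) = c(y). -/
namespace SimpleGraph

open Finset

variable {V : Type*} {G : SimpleGraph V} {m : ℕ}

/-- The map `c` is a proper colouring of the subgraph of `G` induced on `W`. -/
def IsColoringOn (G : SimpleGraph V) {K : Type*} (W : Finset V) (c : V → K) : Prop :=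
  ∀ u ∈ W, ∀ v ∈ W, G.Adj u v → c u ≠ c v

/-- Exactly two colours occur on `x`, `y`, `z`. -/
def TwoColored {K : Type*} (c : V → K) (x y z : V) : Prop :=
  (c x = c y ∧ c x ≠ c z) ∨ (c x = c z ∧ c x ≠ c y) ∨ (c y = c z ∧ c x ≠ c y)

/-- The induced subgraph on `W` has enough `m`-colourings to prescribe simple patterns on
pairs and triples of vertices. -/
structure Flexible_s3 (G : SimpleGraph V) (m : ℕ) (W : Finset V) : Prop where
  same : ∀ x ∈ W, ∀ y ∈ W, ¬ G.Adj x y → ∃ c : V → Fin m, G.IsColoringOn W c ∧ c x = c y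
  avoid : ∀ x ∈ W, ∀ u ∈ W, ∀ v ∈ W, x ≠ u → x ≠ v →
    ∃ c : V → Fin m, G.IsColoringOn W c ∧ c x ≠ c u ∧ c x ≠ c v
  two : ∀ x ∈ W, ∀ y ∈ W, ∀ z ∈ W, x ≠ y → x ≠ z → y ≠ z →
    ¬ (G.Adj x y ∧ G.Adj x z ∧ G.Adj y z) →
    ∃ c : V → Fin m, G.IsColoringOn W c ∧ TwoColored c x y z

/-- The sets `W₁` and `W₂` meet exactly in the two vertices `a`, `b`, and no edge joins the
two remaining parts. -/
structure IsTwoSeparation (G : SimpleGraph V) (W₁ W₂ : Finset V) (a b : V) : Prop where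
  ne : a ≠ b
  left_mem₁ : a ∈ W₁
  left_mem₂ : a ∈ W₂
  right_mem₁ : b ∈ W₁
  right_mem₂ : b ∈ W₂
  eq_or_eq : ∀ w ∈ W₁, w ∈ W₂ → w = a ∨ w = b
  not_adj : ∀ u ∈ W₁, u ∉ W₂ → ∀ v ∈ W₂, v ∉ W₁ → ¬ G.Adj u v

theorem exists_perm_extending {K : Type*} [DecidableEq K] {p₁ p₂ p₃ q₁ q₂ q₃ : K}
    (h₁₂ : p₁ = p₂ ↔ q₁ = q₂) (h₁₃ : p₁ = p₃ ↔ q₁ = q₃) (h₂₃ : p₂ = p₃ ↔ q₂ = q₃) :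
    ∃ σ : Equiv.Perm K, σ p₁ = q₁ ∧ σ p₂ = q₂ ∧ σ p₃ = q₃ := by
  have hpair : ∃ σ : Equiv.Perm K, σ p₁ = q₁ ∧ σ p₂ = q₂ := by
    by_cases h : p₁ = p₂
    · exact ⟨Equiv.swap p₁ q₁, by simp, by rw [← h, ← h₁₂.1 h]; simp⟩
    · refine ⟨(Equiv.swap p₁ q₁).trans (Equiv.swap (Equiv.swap p₁ q₁ p₂) q₂), ?_, by simp⟩
      have h' : Equiv.swap p₁ q₁ p₁ ≠ Equiv.swap p₁ q₁ p₂ :=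
        fun e => h ((Equiv.swap p₁ q₁).injective e)
      rw [Equiv.swap_apply_left] at h'
      simp only [Equiv.trans_apply, Equiv.swap_apply_left]
      exact Equiv.swap_apply_of_ne_of_ne h' (fun e => h (h₁₂.2 e))
  obtain ⟨σ, h₁, h₂⟩ := hpair
  by_cases h : p₁ = p₃
  · exact ⟨σ, h₁, h₂, by rw [← h, h₁, h₁₃.1 h]⟩
  by_cases h' : p₂ = p₃
  · exact ⟨σ, h₁, h₂, by rw [← h', h₂, h₂₃.1 h']⟩
  refine ⟨σ.trans (Equiv.swap (σ p₃) q₃), ?_, ?_, by simp⟩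
  · rw [Equiv.trans_apply, h₁]
    exact Equiv.swap_apply_of_ne_of_ne (fun e => h (σ.injective (h₁.trans e)))
      (fun e => h (h₁₃.2 e))
  · rw [Equiv.trans_apply, h₂]
    exact Equiv.swap_apply_of_ne_of_ne (fun e => h' (σ.injective (h₂.trans e)))
      (fun e => h' (h₂₃.2 e))

theorem exists_fresh_color (hm : 4 ≤ m) (p q r : Fin m) :
    ∃ s : Fin m, s ≠ p ∧ s ≠ q ∧ s ≠ r := by
  have hcard : #({p, q, r} : Finset (Fin m)) < #(univ : Finset (Fin m)) := by
    rw [card_univ, Fintype.card_fin]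
    exact lt_of_le_of_lt card_le_three hm
  obtain ⟨s, -, hs⟩ := exists_mem_notMem_of_card_lt_card hcard
  exact ⟨s, by simpa using hs⟩

namespace IsTwoSeparation

variable {W₁ W₂ : Finset V} {a b : V}

theorem symm (h : G.IsTwoSeparation W₁ W₂ a b) : G.IsTwoSeparation W₂ W₁ a b :=
  ⟨h.ne, h.left_mem₂, h.left_mem₁, h.right_mem₂, h.right_mem₁,
    fun w h₂ h₁ => h.eq_or_eq w h₁ h₂,
    fun u hu hu' v hv hv' e => h.not_adj v hv hv' u hu hu' e.symm⟩

theorem swap (h : G.IsTwoSeparation W₁ W₂ a b) : G.IsTwoSeparation W₁ W₂ b a :=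
  ⟨h.ne.symm, h.right_mem₁, h.right_mem₂, h.left_mem₁, h.left_mem₂,
    fun w h₁ h₂ => (h.eq_or_eq w h₁ h₂).symm, h.not_adj⟩

theorem exists_same_pattern (h : G.IsTwoSeparation W₁ W₂ a b) (f : G.Flexible_s3 m W₂)
    {c₁ : V → Fin m} (hc₁ : G.IsColoringOn W₁ c₁) :
    ∃ c₂ : V → Fin m, G.IsColoringOn W₂ c₂ ∧ (c₁ a = c₁ b ↔ c₂ a = c₂ b) := by
  by_cases hab : c₁ a = c₁ b
  · obtain ⟨c₂, hc₂, e⟩ := f.same a h.left_mem₂ b h.right_mem₂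
      (fun e => hc₁ a h.left_mem₁ b h.right_mem₁ e hab)
    exact ⟨c₂, hc₂, by grind⟩
  · obtain ⟨c₂, hc₂, e, -⟩ := f.avoid a h.left_mem₂ b h.right_mem₂ b h.right_mem₂ h.ne h.ne
    exact ⟨c₂, hc₂, by grind⟩

theorem not_adj_of_color_eq (h : G.IsTwoSeparation W₁ W₂ a b) {c₁ : V → Fin m}
    (hc₁ : G.IsColoringOn W₁ c₁) (e : c₁ a = c₁ b) : ¬ G.Adj a b :=
  fun e' => hc₁ a h.left_mem₁ b h.right_mem₁ e' e

theorem ne_of_notMem₁ (h : G.IsTwoSeparation W₁ W₂ a b) {z : V} (hz : z ∉ W₁) :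
    z ≠ a ∧ z ≠ b :=
  ⟨fun e => hz (e ▸ h.left_mem₁), fun e => hz (e ▸ h.right_mem₁)⟩

variable [DecidableEq V]

theorem glue (h : G.IsTwoSeparation W₁ W₂ a b) {c₁ c₂ : V → Fin m}
    (hc₁ : G.IsColoringOn W₁ c₁) (hc₂ : G.IsColoringOn W₂ c₂)
    {z : V} (hz : z ∈ W₂) (q : Fin m) (hab : c₁ a = c₁ b ↔ c₂ a = c₂ b)
    (hza : q = c₁ a ↔ c₂ z = c₂ a) (hzb : q = c₁ b ↔ c₂ z = c₂ b) :
    ∃ c : V → Fin m, G.IsColoringOn (W₁ ∪ W₂) c ∧ (∀ w ∈ W₁, c w = c₁ w) ∧ c z = q := by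
  obtain ⟨σ, ha, hb, hq⟩ := exists_perm_extending (p₁ := c₂ a) (p₂ := c₂ b) (p₃ := c₂ z)
    (q₁ := c₁ a) (q₂ := c₁ b) (q₃ := q) hab.symm
    (by rw [eq_comm, ← hza, eq_comm]) (by rw [eq_comm, ← hzb, eq_comm])
  let c : V → Fin m := fun w => if w ∈ W₁ then c₁ w else σ (c₂ w)
  have hc1 : ∀ w ∈ W₁, c w = c₁ w := fun w hw => if_pos hw
  have hc2 : ∀ w ∈ W₂, c w = σ (c₂ w) := by
    intro w hw
    by_cases hw₁ : w ∈ W₁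
    · rw [hc1 w hw₁]
      rcases h.eq_or_eq w hw₁ hw with rfl | rfl
      · exact ha.symm
      · exact hb.symm
    · exact if_neg hw₁
  refine ⟨c, ?_, hc1, (hc2 z hz).trans hq⟩
  intro u hu v hv huv
  by_cases hu₁ : u ∈ W₁ <;> by_cases hv₁ : v ∈ W₁
  · rw [hc1 u hu₁, hc1 v hv₁]
    exact hc₁ u hu₁ v hv₁ huv
  · have hv₂ : v ∈ W₂ := (mem_union.1 hv).resolve_left hv₁
    have hu₂ : u ∈ W₂ := by
      by_contra hu₂
      exact h.not_adj u hu₁ hu₂ v hv₂ hv₁ huv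
    rw [hc2 u hu₂, hc2 v hv₂]
    exact fun e => hc₂ u hu₂ v hv₂ huv (σ.injective e)
  · have hu₂ : u ∈ W₂ := (mem_union.1 hu).resolve_left hu₁
    have hv₂ : v ∈ W₂ := by
      by_contra hv₂
      exact h.not_adj v hv₁ hv₂ u hu₂ hu₁ huv.symm
    rw [hc2 u hu₂, hc2 v hv₂]
    exact fun e => hc₂ u hu₂ v hv₂ huv (σ.injective e)
  · have hu₂ : u ∈ W₂ := (mem_union.1 hu).resolve_left hu₁
    have hv₂ : v ∈ W₂ := (mem_union.1 hv).resolve_left hv₁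
    rw [hc2 u hu₂, hc2 v hv₂]
    exact fun e => hc₂ u hu₂ v hv₂ huv (σ.injective e)

theorem glue_ne (hm : 4 ≤ m) (h : G.IsTwoSeparation W₁ W₂ a b) {c₁ c₂ : V → Fin m}
    (hc₁ : G.IsColoringOn W₁ c₁) (hc₂ : G.IsColoringOn W₂ c₂)
    {z : V} (hz : z ∈ W₂) (r : Fin m) (hab : c₁ a = c₁ b ↔ c₂ a = c₂ b)
    (hra : r = c₁ a → c₂ z ≠ c₂ a) (hrb : r = c₁ b → c₂ z ≠ c₂ b) :
    ∃ c : V → Fin m, G.IsColoringOn (W₁ ∪ W₂) c ∧ (∀ w ∈ W₁, c w = c₁ w) ∧ c z ≠ r := by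
  have hq : ∃ q, q ≠ r ∧ (q = c₁ a ↔ c₂ z = c₂ a) ∧ (q = c₁ b ↔ c₂ z = c₂ b) := by
    by_cases ha : c₂ z = c₂ a
    · exact ⟨c₁ a, by grind⟩
    by_cases hb : c₂ z = c₂ b
    · exact ⟨c₁ b, by grind⟩
    obtain ⟨q, h₁, h₂, h₃⟩ := exists_fresh_color hm (c₁ a) (c₁ b) r
    exact ⟨q, by grind⟩
  obtain ⟨q, hqr, hqa, hqb⟩ := hq
  obtain ⟨c, hc, hcc, hcz⟩ := h.glue hc₁ hc₂ hz q hab hqa hqb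
  exact ⟨c, hc, hcc, hcz ▸ hqr⟩

theorem extend (h : G.IsTwoSeparation W₁ W₂ a b) (f : G.Flexible_s3 m W₂)
    {c₁ : V → Fin m} (hc₁ : G.IsColoringOn W₁ c₁) :
    ∃ c : V → Fin m, G.IsColoringOn (W₁ ∪ W₂) c ∧ (∀ w ∈ W₁, c w = c₁ w) := by
  obtain ⟨c₂, hc₂, hab⟩ := h.exists_same_pattern f hc₁
  obtain ⟨c, hc, hcc, -⟩ := h.glue hc₁ hc₂ h.left_mem₂ (c₁ a) hab (by simp) hab
  exact ⟨c, hc, hcc⟩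

end IsTwoSeparation

/-- Either some colouring is injective on the triple, or every one of the three partitions
of it into two classes is realised. -/
theorem Flexible_s3.rainbow_or {W : Finset V} (f : G.Flexible_s3 m W) {a b z : V}
    (ha : a ∈ W) (hb : b ∈ W) (hz : z ∈ W) (hab : a ≠ b) (hza : z ≠ a) (hzb : z ≠ b) :
    (∃ c : V → Fin m, G.IsColoringOn W c ∧ c a ≠ c b ∧ c z ≠ c a ∧ c z ≠ c b) ∨
    ((∃ c : V → Fin m, G.IsColoringOn W c ∧ c a ≠ c b ∧ c z = c a) ∧
      (∃ c : V → Fin m, G.IsColoringOn W c ∧ c a ≠ c b ∧ c z = c b) ∧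
      (∃ c : V → Fin m, G.IsColoringOn W c ∧ c a = c b ∧ c z ≠ c a)) := by
  rw [or_iff_not_imp_left]
  intro hno
  obtain ⟨c₁, h₁, h₁'⟩ := f.avoid a ha b hb z hz hab hza.symm
  obtain ⟨c₂, h₂, h₂'⟩ := f.avoid b hb a ha z hz hab.symm hzb.symm
  obtain ⟨c₃, h₃, h₃'⟩ := f.avoid z hz a ha b hb hza hzb
  exact ⟨⟨c₂, h₂, by grind⟩, ⟨c₁, h₁, by grind⟩, ⟨c₃, h₃, by grind⟩⟩

theorem Flexible_s3.two_patterns {W : Finset V} (f : G.Flexible_s3 m W) {a b z : V}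
    (ha : a ∈ W) (hb : b ∈ W) (hz : z ∈ W) (hab : a ≠ b) (hza : z ≠ a) (hzb : z ≠ b)
    (hadj : ¬ G.Adj a b) :
    (∃ c : V → Fin m, G.IsColoringOn W c ∧ c a ≠ c b ∧ c z = c a) ∨
      (∃ c : V → Fin m, G.IsColoringOn W c ∧ c a ≠ c b ∧ c z = c b) ∨
      (∃ c : V → Fin m, G.IsColoringOn W c ∧ c a = c b ∧ c z ≠ c a) := by
  obtain ⟨c, hc, h⟩ := f.two a ha b hb z hz hab hza.symm hzb.symm (fun e => hadj e.1)
  rcases h with h | h | h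
  · exact Or.inr (Or.inr ⟨c, hc, by grind⟩)
  · exact Or.inl ⟨c, hc, by grind⟩
  · exact Or.inr (Or.inl ⟨c, hc, by grind⟩)

namespace IsTwoSeparation

variable [DecidableEq V] {W₁ W₂ : Finset V} {a b : V}

theorem same_across (h : G.IsTwoSeparation W₁ W₂ a b) (f₁ : G.Flexible_s3 m W₁)
    (f₂ : G.Flexible_s3 m W₂) {x y : V} (hx : x ∈ W₁) (hx' : x ∉ W₂) (hy : y ∈ W₂)
    (hy' : y ∉ W₁) : ∃ c : V → Fin m, G.IsColoringOn (W₁ ∪ W₂) c ∧ c x = c y := by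
  obtain ⟨hxa, hxb⟩ := h.symm.ne_of_notMem₁ hx'
  obtain ⟨hya, hyb⟩ := h.ne_of_notMem₁ hy'
  suffices hs : ∃ c₁ c₂ : V → Fin m, G.IsColoringOn W₁ c₁ ∧ G.IsColoringOn W₂ c₂ ∧
      (c₁ a = c₁ b ↔ c₂ a = c₂ b) ∧ (c₁ x = c₁ a ↔ c₂ y = c₂ a) ∧
      (c₁ x = c₁ b ↔ c₂ y = c₂ b) by
    obtain ⟨c₁, c₂, hc₁, hc₂, h₁, h₂, h₃⟩ := hs
    obtain ⟨c, hc, hcc, hcz⟩ := h.glue hc₁ hc₂ hy (c₁ x) h₁ h₂ h₃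
    exact ⟨c, hc, by rw [hcc x hx, hcz]⟩
  rcases f₁.rainbow_or h.left_mem₁ h.right_mem₁ hx h.ne hxa hxb with
    ⟨c₁, h₁, h₁'⟩ | ⟨⟨d₁, k₁, k₁'⟩, ⟨d₂, k₂, k₂'⟩, ⟨d₃, k₃, k₃'⟩⟩
  · rcases f₂.rainbow_or h.left_mem₂ h.right_mem₂ hy h.ne hya hyb with
      ⟨c₂, h₂, h₂'⟩ | ⟨⟨e₁, l₁, l₁'⟩, ⟨e₂, l₂, l₂'⟩, ⟨e₃, l₃, l₃'⟩⟩
    · exact ⟨c₁, c₂, h₁, h₂, by grind⟩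
    · rcases f₁.two_patterns h.left_mem₁ h.right_mem₁ hx h.ne hxa hxb
        (h.symm.not_adj_of_color_eq l₃ l₃'.1) with ⟨c, hc, hc'⟩ | ⟨c, hc, hc'⟩ | ⟨c, hc, hc'⟩
      · exact ⟨c, e₁, hc, l₁, by grind⟩
      · exact ⟨c, e₂, hc, l₂, by grind⟩
      · exact ⟨c, e₃, hc, l₃, by grind⟩
  · rcases f₂.two_patterns h.left_mem₂ h.right_mem₂ hy h.ne hya hyb
      (h.not_adj_of_color_eq k₃ k₃'.1) with ⟨c, hc, hc'⟩ | ⟨c, hc, hc'⟩ | ⟨c, hc, hc'⟩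
    · exact ⟨d₁, c, k₁, hc, by grind⟩
    · exact ⟨d₂, c, k₂, hc, by grind⟩
    · exact ⟨d₃, c, k₃, hc, by grind⟩

theorem same_union (h : G.IsTwoSeparation W₁ W₂ a b) (f₁ : G.Flexible_s3 m W₁)
    (f₂ : G.Flexible_s3 m W₂) {x y : V} (hx : x ∈ W₁ ∪ W₂) (hy : y ∈ W₁ ∪ W₂)
    (hxy : ¬ G.Adj x y) : ∃ c : V → Fin m, G.IsColoringOn (W₁ ∪ W₂) c ∧ c x = c y := by
  by_cases h₁ : x ∈ W₁ ∧ y ∈ W₁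
  · obtain ⟨c₁, hc₁, e⟩ := f₁.same x h₁.1 y h₁.2 hxy
    obtain ⟨c, hc, hcc⟩ := h.extend f₂ hc₁
    exact ⟨c, hc, by rw [hcc x h₁.1, hcc y h₁.2, e]⟩
  by_cases h₂ : x ∈ W₂ ∧ y ∈ W₂
  · obtain ⟨c₁, hc₁, e⟩ := f₂.same x h₂.1 y h₂.2 hxy
    obtain ⟨c, hc, hcc⟩ := h.symm.extend f₁ hc₁
    exact ⟨c, by rwa [union_comm], by rw [hcc x h₂.1, hcc y h₂.2, e]⟩
  rw [mem_union] at hx hy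
  by_cases hx₁ : x ∈ W₁
  · exact h.same_across f₁ f₂ hx₁ (by tauto) (by tauto) (by tauto)
  · obtain ⟨c, hc, e⟩ := h.same_across f₁ f₂ (x := y) (y := x) (by tauto) (by tauto)
      (by tauto) (by tauto)
    exact ⟨c, hc, e.symm⟩

theorem avoid_of_eq_left (hm : 4 ≤ m) (h : G.IsTwoSeparation W₁ W₂ a b)
    (f₁ : G.Flexible_s3 m W₁) (f₂ : G.Flexible_s3 m W₂) {u v : V} (hu : u ∈ W₁)
    (hv : v ∈ W₂) (hv' : v ∉ W₁) (hau : a ≠ u) :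
    ∃ c : V → Fin m, G.IsColoringOn (W₁ ∪ W₂) c ∧ c a ≠ c u ∧ c a ≠ c v := by
  obtain ⟨hva, hvb⟩ := h.ne_of_notMem₁ hv'
  obtain ⟨c₁, hc₁, h₁, h₁'⟩ := f₁.avoid a h.left_mem₁ u hu b h.right_mem₁ hau h.ne
  obtain ⟨c₂, hc₂, h₂, h₂'⟩ := f₂.avoid a h.left_mem₂ v hv b h.right_mem₂ hva.symm h.ne
  obtain ⟨c, hc, hcc, hcv⟩ := h.glue_ne hm hc₁ hc₂ hv (c₁ a) (by grind) (by grind) (by grind)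
  exact ⟨c, hc, by rw [hcc a h.left_mem₁, hcc u hu]; exact h₁,
    by rw [hcc a h.left_mem₁]; exact hcv.symm⟩

theorem avoid_of_right (hm : 4 ≤ m) (h : G.IsTwoSeparation W₁ W₂ a b)
    (f₁ : G.Flexible_s3 m W₁) (f₂ : G.Flexible_s3 m W₂) {x u v : V} (hx : x ∈ W₁) (hu : u ∈ W₁)
    (hv : v ∈ W₂) (hv' : v ∉ W₁) (hxu : x ≠ u) :
    ∃ c : V → Fin m, G.IsColoringOn (W₁ ∪ W₂) c ∧ c x ≠ c u ∧ c x ≠ c v := by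
  by_cases hxa : x = a
  · subst hxa
    exact h.avoid_of_eq_left hm f₁ f₂ hu hv hv' hxu
  by_cases hxb : x = b
  · subst hxb
    exact h.swap.avoid_of_eq_left hm f₁ f₂ hu hv hv' hxu
  obtain ⟨hva, hvb⟩ := h.ne_of_notMem₁ hv'
  obtain ⟨c₁, hc₁, h₁, h₁'⟩ := f₁.avoid x hx u hu a h.left_mem₁ hxu hxa
  suffices hs : ∃ c₂ : V → Fin m, G.IsColoringOn W₂ c₂ ∧ (c₁ a = c₁ b ↔ c₂ a = c₂ b) ∧
      (c₁ x = c₁ b → c₂ v ≠ c₂ b) by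
    obtain ⟨c₂, hc₂, hab, hb⟩ := hs
    obtain ⟨c, hc, hcc, hcv⟩ := h.glue_ne hm hc₁ hc₂ hv (c₁ x) hab (by grind) hb
    exact ⟨c, hc, by rw [hcc x hx, hcc u hu]; exact h₁, by rw [hcc x hx]; exact hcv.symm⟩
  by_cases hb : c₁ x = c₁ b
  · obtain ⟨c₂, hc₂, h₂, h₂'⟩ := f₂.avoid b h.right_mem₂ a h.left_mem₂ v hv h.ne.symm hvb.symm
    exact ⟨c₂, hc₂, by grind⟩
  · obtain ⟨c₂, hc₂, h₂⟩ := h.exists_same_pattern f₂ hc₁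
    exact ⟨c₂, hc₂, h₂, fun e => absurd e hb⟩

/-- By `hK`, four pairwise adjacent vertices leave a free colour. -/
theorem avoid_across (hm : 4 ≤ m)
    (hK : ∀ p q r s : V, G.Adj p q → G.Adj p r → G.Adj p s → G.Adj q r → G.Adj q s →
      G.Adj r s → 5 ≤ m)
    (h : G.IsTwoSeparation W₁ W₂ a b)
    (f₁ : G.Flexible_s3 m W₁) (f₂ : G.Flexible_s3 m W₂) {x u v : V} (hx : x ∈ W₁) (hx' : x ∉ W₂)
    (hu : u ∈ W₂) (hv : v ∈ W₂) :
    ∃ c : V → Fin m, G.IsColoringOn (W₁ ∪ W₂) c ∧ c x ≠ c u ∧ c x ≠ c v := by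
  obtain ⟨hxa, hxb⟩ := h.symm.ne_of_notMem₁ hx'
  suffices hs : ∃ (c₁ c₂ : V → Fin m) (q : Fin m), G.IsColoringOn W₁ c₁ ∧
      G.IsColoringOn W₂ c₂ ∧ (c₂ a = c₂ b ↔ c₁ a = c₁ b) ∧ (q = c₂ a ↔ c₁ x = c₁ a) ∧
      (q = c₂ b ↔ c₁ x = c₁ b) ∧ q ≠ c₂ u ∧ q ≠ c₂ v by
    obtain ⟨c₁, c₂, q, hc₁, hc₂, h₁, h₂, h₃, hqu, hqv⟩ := hs
    obtain ⟨c, hc, hcc, hcx⟩ := h.symm.glue hc₂ hc₁ hx q h₁ h₂ h₃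
    exact ⟨c, by rwa [union_comm], by rw [hcx, hcc u hu]; exact hqu,
      by rw [hcx, hcc v hv]; exact hqv⟩
  by_cases hT : ∃ c : V → Fin m, G.IsColoringOn W₁ c ∧ c a = c b ∧ c x ≠ c a
  · obtain ⟨c₁, hc₁, h₁, h₁'⟩ := hT
    obtain ⟨c₂, hc₂, h₂⟩ := h.exists_same_pattern f₂ hc₁
    obtain ⟨q, hq⟩ := exists_fresh_color hm (c₂ a) (c₂ u) (c₂ v)
    exact ⟨c₁, c₂, q, hc₁, hc₂, by grind⟩
  have hR : ∃ c : V → Fin m, G.IsColoringOn W₁ c ∧ c a ≠ c b ∧ c x ≠ c a ∧ c x ≠ c b := by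
    rcases f₁.rainbow_or h.left_mem₁ h.right_mem₁ hx h.ne hxa hxb with hR | hR
    · exact hR
    · exact absurd hR.2.2 hT
  obtain ⟨c₁, hc₁, h₁, h₁a, h₁b⟩ := hR
  by_cases hF : ∃ (c₂ : V → Fin m) (q : Fin m), G.IsColoringOn W₂ c₂ ∧ c₂ a ≠ c₂ b ∧
      q ≠ c₂ a ∧ q ≠ c₂ b ∧ q ≠ c₂ u ∧ q ≠ c₂ v
  · obtain ⟨c₂, q, hc₂, hq⟩ := hF
    exact ⟨c₁, c₂, q, hc₁, hc₂, by grind⟩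
  have hinj : ∀ c₂ : V → Fin m, G.IsColoringOn W₂ c₂ → c₂ a ≠ c₂ b → c₂ a ≠ c₂ u ∧
      c₂ a ≠ c₂ v ∧ c₂ b ≠ c₂ u ∧ c₂ b ≠ c₂ v ∧ c₂ u ≠ c₂ v := by
    intro c₂ hc₂ hab
    obtain ⟨q₁, hq₁⟩ := exists_fresh_color hm (c₂ a) (c₂ b) (c₂ u)
    obtain ⟨q₂, hq₂⟩ := exists_fresh_color hm (c₂ a) (c₂ b) (c₂ v)
    have hF₁ := fun q hq => hF ⟨c₂, q, hc₂, hab, hq⟩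
    have h₁ := hF₁ q₁
    have h₂ := hF₁ q₂
    obtain ⟨q₃, hq₃⟩ := exists_fresh_color hm (c₂ b) (c₂ u) (c₂ v)
    obtain ⟨q₄, hq₄⟩ := exists_fresh_color hm (c₂ a) (c₂ u) (c₂ v)
    have h₃ := hF₁ q₃
    have h₄ := hF₁ q₄
    grind
  by_cases hab : G.Adj a b
  · exfalso
    have hne : ∀ c₂ : V → Fin m, G.IsColoringOn W₂ c₂ → c₂ a ≠ c₂ b :=
      fun c₂ hc₂ => hc₂ a h.left_mem₂ b h.right_mem₂ hab
    have hadj : ∀ p ∈ W₂, ∀ q ∈ W₂, (∀ c₂ : V → Fin m, G.IsColoringOn W₂ c₂ → c₂ p ≠ c₂ q) →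
        G.Adj p q := by
      intro p hp q hq hpq
      by_contra hn
      obtain ⟨c₂, hc₂, e⟩ := f₂.same p hp q hq hn
      exact hpq c₂ hc₂ e
    have hau := hadj a h.left_mem₂ u hu (fun c hc => (hinj c hc (hne c hc)).1)
    have hav := hadj a h.left_mem₂ v hv (fun c hc => (hinj c hc (hne c hc)).2.1)
    have hbu := hadj b h.right_mem₂ u hu (fun c hc => (hinj c hc (hne c hc)).2.2.1)
    have hbv := hadj b h.right_mem₂ v hv (fun c hc => (hinj c hc (hne c hc)).2.2.2.1)
    have huv := hadj u hu v hv (fun c hc => (hinj c hc (hne c hc)).2.2.2.2)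
    have hm₅ := hK a b u v hab hau hav hbu hbv huv
    obtain ⟨c₂, hc₂, e⟩ := h.exists_same_pattern f₂ hc₁
    have hcard : #({c₂ a, c₂ b, c₂ u, c₂ v} : Finset (Fin m)) < #(univ : Finset (Fin m)) := by
      rw [card_univ, Fintype.card_fin]
      exact lt_of_le_of_lt card_le_four hm₅
    obtain ⟨q, -, hq⟩ := exists_mem_notMem_of_card_lt_card hcard
    simp only [mem_insert, mem_singleton, not_or] at hq
    exact hF ⟨c₂, q, hc₂, hne c₂ hc₂, hq⟩
  · obtain ⟨c₂, hc₂, e⟩ := h.exists_same_pattern f₂ hc₁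
    have hi := hinj c₂ hc₂ (by grind)
    rcases f₁.two_patterns h.left_mem₁ h.right_mem₁ hx h.ne hxa hxb hab with
      ⟨d, hd, hd'⟩ | ⟨d, hd, hd'⟩ | hd
    · exact ⟨d, c₂, c₂ a, hd, hc₂, by grind⟩
    · exact ⟨d, c₂, c₂ b, hd, hc₂, by grind⟩
    · exact absurd hd hT

theorem avoid_of_left (hm : 4 ≤ m)
    (hK : ∀ p q r s : V, G.Adj p q → G.Adj p r → G.Adj p s → G.Adj q r → G.Adj q s →
      G.Adj r s → 5 ≤ m)
    (h : G.IsTwoSeparation W₁ W₂ a b)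
    (f₁ : G.Flexible_s3 m W₁) (f₂ : G.Flexible_s3 m W₂) {x u v : V} (hx : x ∈ W₁)
    (hu : u ∈ W₁ ∪ W₂) (hv : v ∈ W₁ ∪ W₂) (hxu : x ≠ u) (hxv : x ≠ v) :
    ∃ c : V → Fin m, G.IsColoringOn (W₁ ∪ W₂) c ∧ c x ≠ c u ∧ c x ≠ c v := by
  rw [mem_union] at hu hv
  by_cases hu₁ : u ∈ W₁ <;> by_cases hv₁ : v ∈ W₁
  · obtain ⟨c₁, hc₁, h₁, h₂⟩ := f₁.avoid x hx u hu₁ v hv₁ hxu hxv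
    obtain ⟨c, hc, hcc⟩ := h.extend f₂ hc₁
    exact ⟨c, hc, by rwa [hcc x hx, hcc u hu₁], by rwa [hcc x hx, hcc v hv₁]⟩
  · exact h.avoid_of_right hm f₁ f₂ hx hu₁ (by tauto) hv₁ hxu
  · obtain ⟨c, hc, h₁, h₂⟩ := h.avoid_of_right hm f₁ f₂ hx hv₁ (v := u) (by tauto) hu₁ hxv
    exact ⟨c, hc, h₂, h₁⟩
  have hu₂ : u ∈ W₂ := by tauto
  have hv₂ : v ∈ W₂ := by tauto
  by_cases hx₂ : x ∈ W₂
  · obtain ⟨c₁, hc₁, h₁, h₂⟩ := f₂.avoid x hx₂ u hu₂ v hv₂ hxu hxv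
    obtain ⟨c, hc, hcc⟩ := h.symm.extend f₁ hc₁
    exact ⟨c, by rwa [union_comm], by rwa [hcc x hx₂, hcc u hu₂],
      by rwa [hcc x hx₂, hcc v hv₂]⟩
  · exact h.avoid_across hm hK f₁ f₂ hx hx₂ hu₂ hv₂

end IsTwoSeparation

theorem TwoColored.swap₁₂ {K : Type*} {c : V → K} {x y z : V} (h : TwoColored c x y z) :
    TwoColored c y x z := by
  unfold TwoColored at *
  grind

theorem TwoColored.swap₂₃ {K : Type*} {c : V → K} {x y z : V} (h : TwoColored c x y z) :
    TwoColored c x z y := by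
  unfold TwoColored at *
  grind

namespace IsTwoSeparation

variable [DecidableEq V] {W₁ W₂ : Finset V} {a b : V}

theorem two_of_mem_cut (h : G.IsTwoSeparation W₁ W₂ a b)
    (f₁ : G.Flexible_s3 m W₁) (f₂ : G.Flexible_s3 m W₂) {y z : V}
    (hy : y ∈ W₁) (hy' : y ∉ W₂) (hz : z ∈ W₂) (hz' : z ∉ W₁) :
    ∃ c : V → Fin m, G.IsColoringOn (W₁ ∪ W₂) c ∧ TwoColored c a y z := by
  obtain ⟨hya, hyb⟩ := h.symm.ne_of_notMem₁ hy'
  obtain ⟨hza, hzb⟩ := h.ne_of_notMem₁ hz'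
  suffices hs : ∃ (c₁ c₂ : V → Fin m) (q : Fin m), G.IsColoringOn W₁ c₁ ∧
      G.IsColoringOn W₂ c₂ ∧ (c₁ a = c₁ b ↔ c₂ a = c₂ b) ∧ (q = c₁ a ↔ c₂ z = c₂ a) ∧
      (q = c₁ b ↔ c₂ z = c₂ b) ∧ ((c₁ a = c₁ y ∧ c₁ a ≠ q) ∨ (c₁ a = q ∧ c₁ a ≠ c₁ y) ∨
        (c₁ y = q ∧ c₁ a ≠ c₁ y)) by
    obtain ⟨c₁, c₂, q, hc₁, hc₂, h₁, h₂, h₃, hT⟩ := hs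
    obtain ⟨c, hc, hcc, hcz⟩ := h.glue hc₁ hc₂ hz q h₁ h₂ h₃
    refine ⟨c, hc, ?_⟩
    rw [TwoColored, hcc a h.left_mem₁, hcc y hy, hcz]
    exact hT
  rcases f₁.rainbow_or h.left_mem₁ h.right_mem₁ hy h.ne hya hyb with
    ⟨c₁, h₁, h₁'⟩ | ⟨⟨d₁, k₁, k₁'⟩, ⟨d₂, k₂, k₂'⟩, ⟨d₃, k₃, k₃'⟩⟩
  · rcases f₂.rainbow_or h.left_mem₂ h.right_mem₂ hz h.ne hza hzb with
      ⟨c₂, h₂, h₂'⟩ | ⟨⟨e₁, l₁, l₁'⟩, ⟨e₂, l₂, l₂'⟩, ⟨e₃, l₃, l₃'⟩⟩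
    · exact ⟨c₁, c₂, c₁ y, h₁, h₂, by grind⟩
    · exact ⟨c₁, e₁, c₁ a, h₁, l₁, by grind⟩
  · rcases f₂.two_patterns h.left_mem₂ h.right_mem₂ hz h.ne hza hzb
      (h.not_adj_of_color_eq k₃ k₃'.1) with ⟨c, hc, hc'⟩ | ⟨c, hc, hc'⟩ | ⟨c, hc, hc'⟩
    · exact ⟨d₂, c, d₂ a, k₂, hc, by grind⟩
    · exact ⟨d₂, c, d₂ b, k₂, hc, by grind⟩
    · exact ⟨d₃, c, d₃ y, k₃, hc, by grind⟩

theorem two_of_mem_side (hm : 4 ≤ m) (h : G.IsTwoSeparation W₁ W₂ a b)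
    (f₁ : G.Flexible_s3 m W₁) (f₂ : G.Flexible_s3 m W₂) {x y z : V}
    (hx : x ∈ W₁) (hx' : x ∉ W₂) (hy : y ∈ W₁) (hy' : y ∉ W₂) (hz : z ∈ W₂) (hz' : z ∉ W₁) :
    ∃ c : V → Fin m, G.IsColoringOn (W₁ ∪ W₂) c ∧ TwoColored c x y z := by
  obtain ⟨hxa, hxb⟩ := h.symm.ne_of_notMem₁ hx'
  obtain ⟨hya, hyb⟩ := h.symm.ne_of_notMem₁ hy'
  obtain ⟨hza, hzb⟩ := h.ne_of_notMem₁ hz'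
  suffices hs : ∃ (c₁ c₂ : V → Fin m) (q : Fin m), G.IsColoringOn W₁ c₁ ∧
      G.IsColoringOn W₂ c₂ ∧ (c₁ a = c₁ b ↔ c₂ a = c₂ b) ∧ (q = c₁ a ↔ c₂ z = c₂ a) ∧
      (q = c₁ b ↔ c₂ z = c₂ b) ∧ ((c₁ x = c₁ y ∧ c₁ x ≠ q) ∨ (c₁ x = q ∧ c₁ x ≠ c₁ y) ∨
        (c₁ y = q ∧ c₁ x ≠ c₁ y)) by
    obtain ⟨c₁, c₂, q, hc₁, hc₂, h₁, h₂, h₃, hT⟩ := hs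
    obtain ⟨c, hc, hcc, hcz⟩ := h.glue hc₁ hc₂ hz q h₁ h₂ h₃
    refine ⟨c, hc, ?_⟩
    rw [TwoColored, hcc x hx, hcc y hy, hcz]
    exact hT
  have hfour : ∀ c₁ c₂ : V → Fin m, G.IsColoringOn W₁ c₁ → G.IsColoringOn W₂ c₂ →
      c₁ a = c₁ b → c₂ a = c₂ b → c₂ z ≠ c₂ a →
      ∃ (c₁ c₂ : V → Fin m) (q : Fin m), G.IsColoringOn W₁ c₁ ∧
      G.IsColoringOn W₂ c₂ ∧ (c₁ a = c₁ b ↔ c₂ a = c₂ b) ∧ (q = c₁ a ↔ c₂ z = c₂ a) ∧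
      (q = c₁ b ↔ c₂ z = c₂ b) ∧ ((c₁ x = c₁ y ∧ c₁ x ≠ q) ∨ (c₁ x = q ∧ c₁ x ≠ c₁ y) ∨
        (c₁ y = q ∧ c₁ x ≠ c₁ y)) := by
    intro c₁ c₂ hc₁ hc₂ h₁ h₂ h₃
    by_cases hxy : c₁ x = c₁ y
    · obtain ⟨q, hq⟩ := exists_fresh_color hm (c₁ a) (c₁ x) (c₁ x)
      exact ⟨c₁, c₂, q, hc₁, hc₂, by grind⟩
    · by_cases hxa : c₁ x = c₁ a
      · exact ⟨c₁, c₂, c₁ y, hc₁, hc₂, by grind⟩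
      · exact ⟨c₁, c₂, c₁ x, hc₁, hc₂, by grind⟩
  rcases f₂.rainbow_or h.left_mem₂ h.right_mem₂ hz h.ne hza hzb with
      ⟨c₂, h₂, h₂'⟩ | ⟨-, -, ⟨e₃, l₃, l₃'⟩⟩
  · by_cases hP : ∃ c₁ : V → Fin m, G.IsColoringOn W₁ c₁ ∧ c₁ a ≠ c₁ b ∧
        ¬ ((c₁ x = c₁ a ∧ c₁ y = c₁ b) ∨ (c₁ x = c₁ b ∧ c₁ y = c₁ a))
    · obtain ⟨c₁, h₁, hab, hn⟩ := hP
      by_cases hxy : c₁ x = c₁ y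
      · obtain ⟨q, hq⟩ := exists_fresh_color hm (c₁ a) (c₁ b) (c₁ x)
        exact ⟨c₁, c₂, q, h₁, h₂, by grind⟩
      · by_cases hxc : c₁ x = c₁ a ∨ c₁ x = c₁ b
        · exact ⟨c₁, c₂, c₁ y, h₁, h₂, by grind⟩
        · exact ⟨c₁, c₂, c₁ x, h₁, h₂, by grind⟩
    obtain ⟨d₁, k₁, k₁'⟩ := f₁.avoid a h.left_mem₁ b h.right_mem₁ x hx h.ne hxa.symm
    obtain ⟨d₃, k₃, k₃'⟩ := f₁.avoid x hx a h.left_mem₁ b h.right_mem₁ hxa hxb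
    have hd₁ : ¬ _ := fun hn => hP ⟨d₁, k₁, k₁'.1, hn⟩
    have hd₃ : d₃ a = d₃ b := by
      by_contra hn
      exact hP ⟨d₃, k₃, hn, by grind⟩
    rcases f₂.two_patterns h.left_mem₂ h.right_mem₂ hz h.ne hza hzb
      (h.not_adj_of_color_eq k₃ hd₃) with ⟨c, hc, hc'⟩ | ⟨c, hc, hc'⟩ | ⟨c, hc, hc'⟩
    · exact ⟨d₁, c, d₁ a, k₁, hc, by grind⟩
    · exact ⟨d₁, c, d₁ b, k₁, hc, by grind⟩
    · exact hfour d₃ c k₃ hc hd₃ hc'.1 hc'.2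
  · obtain ⟨c₁, hc₁, e⟩ := h.symm.exists_same_pattern f₁ l₃
    exact hfour c₁ e₃ hc₁ l₃ (by grind) l₃'.1 l₃'.2

theorem two_across (hm : 4 ≤ m) (h : G.IsTwoSeparation W₁ W₂ a b)
    (f₁ : G.Flexible_s3 m W₁) (f₂ : G.Flexible_s3 m W₂) {x y z : V}
    (hx : x ∈ W₁) (hx' : x ∉ W₂) (hy : y ∈ W₁ ∪ W₂) (hz : z ∈ W₂) (hz' : z ∉ W₁) :
    ∃ c : V → Fin m, G.IsColoringOn (W₁ ∪ W₂) c ∧ TwoColored c x y z := by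
  by_cases hy₁ : y ∈ W₁
  · by_cases hy₂ : y ∈ W₂
    · rcases h.eq_or_eq y hy₁ hy₂ with rfl | rfl
      · obtain ⟨c, hc, hT⟩ := h.two_of_mem_cut f₁ f₂ hx hx' hz hz'
        exact ⟨c, hc, hT.swap₁₂⟩
      · obtain ⟨c, hc, hT⟩ := h.swap.two_of_mem_cut f₁ f₂ hx hx' hz hz'
        exact ⟨c, hc, hT.swap₁₂⟩
    · exact h.two_of_mem_side hm f₁ f₂ hx hx' hy₁ hy₂ hz hz'
  · have hy₂ : y ∈ W₂ := (mem_union.1 hy).resolve_left hy₁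
    obtain ⟨c, hc, hT⟩ := h.symm.two_of_mem_side hm f₂ f₁ hz hz' hy₂ hy₁ hx hx'
    exact ⟨c, by rwa [union_comm], hT.swap₁₂.swap₂₃.swap₁₂⟩

theorem two_union (hm : 4 ≤ m) (h : G.IsTwoSeparation W₁ W₂ a b)
    (f₁ : G.Flexible_s3 m W₁) (f₂ : G.Flexible_s3 m W₂) {x y z : V}
    (hx : x ∈ W₁ ∪ W₂) (hy : y ∈ W₁ ∪ W₂) (hz : z ∈ W₁ ∪ W₂)
    (hxy : x ≠ y) (hxz : x ≠ z) (hyz : y ≠ z)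
    (hadj : ¬ (G.Adj x y ∧ G.Adj x z ∧ G.Adj y z)) :
    ∃ c : V → Fin m, G.IsColoringOn (W₁ ∪ W₂) c ∧ TwoColored c x y z := by
  by_cases h₁ : x ∈ W₁ ∧ y ∈ W₁ ∧ z ∈ W₁
  · obtain ⟨c₁, hc₁, e⟩ := f₁.two x h₁.1 y h₁.2.1 z h₁.2.2 hxy hxz hyz hadj
    obtain ⟨c, hc, hcc⟩ := h.extend f₂ hc₁
    refine ⟨c, hc, ?_⟩
    rw [TwoColored, hcc x h₁.1, hcc y h₁.2.1, hcc z h₁.2.2]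
    exact e
  by_cases h₂ : x ∈ W₂ ∧ y ∈ W₂ ∧ z ∈ W₂
  · obtain ⟨c₁, hc₁, e⟩ := f₂.two x h₂.1 y h₂.2.1 z h₂.2.2 hxy hxz hyz hadj
    obtain ⟨c, hc, hcc⟩ := h.symm.extend f₁ hc₁
    refine ⟨c, by rwa [union_comm], ?_⟩
    rw [TwoColored, hcc x h₂.1, hcc y h₂.2.1, hcc z h₂.2.2]
    exact e
  have key : ∀ p q r : V, p ∈ W₁ ∪ W₂ → q ∈ W₁ ∪ W₂ → r ∈ W₁ ∪ W₂ → p ∉ W₂ → r ∉ W₁ →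
      ∃ c : V → Fin m, G.IsColoringOn (W₁ ∪ W₂) c ∧ TwoColored c p q r :=
    fun p q r hp hq hr hp' hr' => h.two_across hm f₁ f₂ ((mem_union.1 hp).resolve_right hp')
      hp' hq ((mem_union.1 hr).resolve_left hr') hr'
  have hx₁₂ := mem_union.1 hx
  have hy₁₂ := mem_union.1 hy
  have hz₁₂ := mem_union.1 hz
  by_cases hx₂ : x ∈ W₂
  · by_cases hy₂ : y ∈ W₂
    · have hz₂ : z ∉ W₂ := by tauto
      by_cases hx₁ : x ∈ W₁
      · obtain ⟨c, hc, hT⟩ := key z x y hz hx hy hz₂ (by tauto)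
        exact ⟨c, hc, hT.swap₁₂.swap₂₃⟩
      · obtain ⟨c, hc, hT⟩ := key z y x hz hy hx hz₂ hx₁
        exact ⟨c, hc, hT.swap₁₂.swap₂₃.swap₁₂⟩
    · by_cases hx₁ : x ∈ W₁
      · obtain ⟨c, hc, hT⟩ := key y x z hy hx hz hy₂ (by tauto)
        exact ⟨c, hc, hT.swap₁₂⟩
      · obtain ⟨c, hc, hT⟩ := key y z x hy hz hx hy₂ hx₁
        exact ⟨c, hc, hT.swap₂₃.swap₁₂⟩
  · by_cases hy₁ : y ∈ W₁
    · exact key x y z hx hy hz hx₂ (by tauto)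
    · obtain ⟨c, hc, hT⟩ := key x z y hx hz hy hx₂ hy₁
      exact ⟨c, hc, hT.swap₂₃⟩

theorem flexible_union (hm : 4 ≤ m)
    (hK : ∀ p q r s : V, G.Adj p q → G.Adj p r → G.Adj p s → G.Adj q r → G.Adj q s →
      G.Adj r s → 5 ≤ m)
    (h : G.IsTwoSeparation W₁ W₂ a b) (f₁ : G.Flexible_s3 m W₁) (f₂ : G.Flexible_s3 m W₂) :
    G.Flexible_s3 m (W₁ ∪ W₂) where
  same _ hx _ hy hxy := h.same_union f₁ f₂ hx hy hxy
  avoid x hx u hu v hv hxu hxv := by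
    rcases mem_union.1 hx with hx₁ | hx₂
    · exact h.avoid_of_left hm hK f₁ f₂ hx₁ hu hv hxu hxv
    · rw [union_comm] at hu hv ⊢
      exact h.symm.avoid_of_left hm hK f₂ f₁ hx₂ hu hv hxu hxv
  two _ hx _ hy _ hz hxy hxz hyz hadj := h.two_union hm f₁ f₂ hx hy hz hxy hxz hyz hadj

end IsTwoSeparation

/-- A proper colouring that misses a colour can be modified on an independent set. -/
theorem flexible_of_missing_color {W : Finset V} {c : V → Fin m} (hc : G.IsColoringOn W c)
    {k : Fin m} (hk : ∀ v ∈ W, c v ≠ k) : G.Flexible_s3 m W := by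
  classical
  have recolor : ∀ x y : V, ¬ G.Adj x y →
      G.IsColoringOn W (fun w => if w = x ∨ w = y then k else c w) := by
    intro x y hxy u hu v hv huv
    have hne := huv.ne
    have h₁ := hc u hu v hv huv
    have h₂ := hk u hu
    have h₃ := hk v hv
    have h₄ : ¬ G.Adj y x := fun e => hxy e.symm
    dsimp only
    grind
  refine ⟨?_, ?_, ?_⟩
  · intro x hx y hy hxy
    exact ⟨_, recolor x y hxy, by simp⟩
  · intro x hx u hu v hv hxu hxv
    have h₁ := hk u hu
    have h₂ := hk v hv
    exact ⟨_, recolor x x (G.irrefl), by grind⟩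
  · intro x hx y hy z hz hxy hxz hyz hadj
    have h₁ := hk x hx
    have h₂ := hk y hy
    have h₃ := hk z hz
    unfold TwoColored
    by_cases hxy' : G.Adj x y
    · by_cases hxz' : G.Adj x z
      · exact ⟨_, recolor y z (fun e => hadj ⟨hxy', hxz', e⟩), by grind⟩
      · exact ⟨_, recolor x z hxz', by grind⟩
    · exact ⟨_, recolor x y hxy', by grind⟩

/-- No edge joins `W₁ \ W₂` to `W₂ \ W₁`, both of these are nonempty, and the sides `W₁`, `W₂`
meet in exactly `k` vertices. -/
structure IsSeparationOfOrder (G : SimpleGraph V) [DecidableEq V] (k : ℕ)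
    (W₁ W₂ : Finset V) : Prop where
  card_inter : #(W₁ ∩ W₂) = k
  left : (W₁ \ W₂).Nonempty
  right : (W₂ \ W₁).Nonempty
  not_adj : ∀ u ∈ W₁, u ∉ W₂ → ∀ v ∈ W₂, v ∉ W₁ → ¬ G.Adj u v

namespace IsSeparationOfOrder

variable [DecidableEq V] {W₁ W₂ : Finset V} {k : ℕ}

theorem symm (h : G.IsSeparationOfOrder k W₁ W₂) : G.IsSeparationOfOrder k W₂ W₁ :=
  ⟨by rw [inter_comm]; exact h.card_inter, h.right, h.left,
    fun u hu hu' v hv hv' e => h.not_adj v hv hv' u hu hu' e.symm⟩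

theorem succ_of_one_lt_card (h : G.IsSeparationOfOrder k W₁ W₂) (hcard : 1 < #(W₁ \ W₂)) :
    ∃ W₃, G.IsSeparationOfOrder (k + 1) W₁ W₃ ∧ W₁ ∪ W₃ = W₁ ∪ W₂ := by
  obtain ⟨s, hs, t, ht, hst⟩ := one_lt_card.1 hcard
  rw [mem_sdiff] at hs ht
  refine ⟨insert s W₂, ⟨?_, ⟨t, ?_⟩, ?_, ?_⟩, ?_⟩
  · rw [inter_insert_of_mem hs.1, card_insert_of_notMem (by simp [hs.2]), h.card_inter]
  · rw [mem_sdiff, mem_insert]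
    exact ⟨ht.1, by rintro (e | e); exacts [hst e.symm, ht.2 e]⟩
  · rw [insert_sdiff_of_mem _ hs.1]
    exact h.right
  · intro u hu hu' v hv hv'
    rw [mem_insert, not_or] at hu'
    refine h.not_adj u hu hu'.2 v ((mem_insert.1 hv).resolve_left ?_) hv'
    rintro rfl
    exact hv' hs.1
  · rw [union_insert, insert_eq_of_mem (mem_union_left _ hs.1)]

theorem succ (h : G.IsSeparationOfOrder k W₁ W₂) (hcard : k + 3 ≤ #(W₁ ∪ W₂)) :
    ∃ W₃ W₄, G.IsSeparationOfOrder (k + 1) W₃ W₄ ∧ W₃ ∪ W₄ = W₁ ∪ W₂ := by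
  have e₁ := card_union_add_card_inter W₁ W₂
  have e₂ := card_sdiff_add_card_inter W₁ W₂
  have e₃ := card_sdiff_add_card_inter W₂ W₁
  rw [inter_comm W₂ W₁] at e₃
  have e₄ := h.card_inter
  by_cases h₁ : 1 < #(W₁ \ W₂)
  · obtain ⟨W₃, h₃, e⟩ := h.succ_of_one_lt_card h₁
    exact ⟨W₁, W₃, h₃, e⟩
  · obtain ⟨W₃, h₃, e⟩ := h.symm.succ_of_one_lt_card (by omega)
    exact ⟨W₂, W₃, h₃, by rw [e, union_comm]⟩

theorem exists_order_two (h : G.IsSeparationOfOrder k W₁ W₂) (hk : k ≤ 2)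
    (hcard : 4 ≤ #(W₁ ∪ W₂)) :
    ∃ W₃ W₄, G.IsSeparationOfOrder 2 W₃ W₄ ∧ W₃ ∪ W₄ = W₁ ∪ W₂ := by
  have one : ∀ W₁ W₂, G.IsSeparationOfOrder 1 W₁ W₂ → 4 ≤ #(W₁ ∪ W₂) →
      ∃ W₃ W₄, G.IsSeparationOfOrder 2 W₃ W₄ ∧ W₃ ∪ W₄ = W₁ ∪ W₂ :=
    fun W₁ W₂ h hcard => h.succ hcard
  interval_cases k
  · obtain ⟨W₃, W₄, h₃, e⟩ := h.succ (by omega)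
    rw [← e] at hcard ⊢
    exact one W₃ W₄ h₃ hcard
  · exact one W₁ W₂ h hcard
  · exact ⟨W₁, W₂, h, rfl⟩

theorem exists_isTwoSeparation (h : G.IsSeparationOfOrder 2 W₁ W₂) :
    ∃ a b, G.IsTwoSeparation W₁ W₂ a b := by
  obtain ⟨a, b, hab, e⟩ := card_eq_two.1 h.card_inter
  have ha : a ∈ W₁ ∩ W₂ := by simp [e]
  have hb : b ∈ W₁ ∩ W₂ := by simp [e]
  rw [mem_inter] at ha hb
  refine ⟨a, b, hab, ha.1, ha.2, hb.1, hb.2, fun w h₁ h₂ => ?_, h.not_adj⟩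
  have hw : w ∈ W₁ ∩ W₂ := mem_inter.2 ⟨h₁, h₂⟩
  simpa [e] using hw

end IsSeparationOfOrder

theorem isKConnected_three_or_separation [DecidableEq V] {W : Finset V} (hW : 4 ≤ #W) :
    ((⊤ : G.Subgraph).induce (W : Set V)).coe.IsKConnected 3 ∨
      ∃ W₁ W₂, G.IsSeparationOfOrder 2 W₁ W₂ ∧ W₁ ∪ W₂ = W := by
  classical
  set H := (⊤ : G.Subgraph).induce (W : Set V) with hH
  have hcardH : Nat.card H.verts = #W := by
    change Nat.card ((W : Set V) : Type _) = #W
    simp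
  have : Finite H.verts := Nat.finite_of_card_ne_zero (by omega)
  rw [or_iff_not_imp_right]
  intro hno
  refine ⟨by omega, fun S hS => ?_⟩
  have hne : Nonempty (Sᶜ : Set H.verts) := by
    by_contra hempty
    rw [Set.nonempty_coe_sort, Set.not_nonempty_iff_eq_empty, Set.compl_empty_iff] at hempty
    rw [hempty, Set.ncard_univ] at hS
    omega
  rw [connected_iff]
  refine ⟨fun p q => ?_, hne⟩
  by_contra hpq
  apply hno
  let R : V → Prop := fun w => ∃ (hw : w ∈ H.verts) (hs : (⟨w, hw⟩ : H.verts) ∈ Sᶜ),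
    (H.coe.induce Sᶜ).Reachable p ⟨⟨w, hw⟩, hs⟩
  let T : Finset V := W.filter fun w => ∃ hw : w ∈ H.verts, (⟨w, hw⟩ : H.verts) ∈ S
  have hT : ∀ w, w ∈ T ↔ ∃ hw : w ∈ H.verts, (⟨w, hw⟩ : H.verts) ∈ S := by
    intro w
    simp only [T, mem_filter, and_iff_right_iff_imp]
    rintro ⟨hw, -⟩
    exact hw
  have hTcard : #T ≤ 2 := by
    have e : (T : Set V) = Subtype.val '' S := by
      ext w
      rw [mem_coe, hT]
      simp
    rw [← Set.ncard_coe_finset, e]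
    exact (Set.ncard_image_le (Set.toFinite S)).trans hS
  have hRT : ∀ w, R w → w ∉ T := by
    rintro w ⟨hw, hs, -⟩ hwT
    exact hs ((hT w).1 hwT).2
  have hRW : ∀ w, R w → w ∈ W := fun w hw => hw.1
  have hTW : ∀ w ∈ T, w ∈ W := fun w hw => (mem_filter.1 hw).1
  have hpR : R p.1.1 := ⟨p.1.2, p.2, Reachable.refl _⟩
  have hqR : ¬ R q.1.1 := fun ⟨_, _, h⟩ => hpq h
  have hqT : q.1.1 ∉ T := fun h => q.2 ((hT _).1 h).2
  have hqW : q.1.1 ∈ W := q.1.2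
  have hinter : (W.filter fun w => R w ∨ w ∈ T) ∩ (W.filter fun w => ¬ R w) = T := by
    ext w
    simp only [mem_inter, mem_filter]
    have h₁ := hRT w
    have h₂ := hTW w
    clear_value R T
    tauto
  have hunion : (W.filter fun w => R w ∨ w ∈ T) ∪ (W.filter fun w => ¬ R w) = W := by
    ext w
    simp only [mem_union, mem_filter]
    clear hinter
    clear_value R T
    tauto
  have hsep : G.IsSeparationOfOrder #T (W.filter fun w => R w ∨ w ∈ T)
      (W.filter fun w => ¬ R w) := by
    refine ⟨by rw [hinter], ⟨p.1.1, ?_⟩, ⟨q.1.1, ?_⟩, ?_⟩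
    · simp only [mem_sdiff, mem_filter]
      exact ⟨⟨hRW _ hpR, Or.inl hpR⟩, fun h => h.2 hpR⟩
    · simp only [mem_sdiff, mem_filter]
      exact ⟨⟨hqW, hqR⟩, fun h => h.2.elim hqR hqT⟩
    · intro u hu hu' v hv hv' huv
      simp only [mem_filter, not_and, not_not, not_or] at hu hu' hv hv'
      obtain ⟨hu₁, hu₂, hu₃⟩ := hu' hu.1
      have hvT := (hv' hv.1).2
      refine hv.2 ⟨hv.1, fun h => hvT ((hT v).2 ⟨hv.1, h⟩), hu₃.trans (Adj.reachable ?_)⟩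
      simpa [hH, huv] using ⟨hu.1, hv.1⟩
  obtain ⟨W₃, W₄, h₃, e⟩ := hsep.exists_order_two hTcard (by rw [hunion]; exact hW)
  exact ⟨W₃, W₄, h₃, e.trans hunion⟩

theorem exists_missing_color_or_separation [DecidableEq V] (hm : 4 ≤ m) (hG : G.MFragile m)
    (W : Finset V) :
    (∃ (c : V → Fin m) (k : Fin m), G.IsColoringOn W c ∧ ∀ v ∈ W, c v ≠ k) ∨
      ∃ W₁ W₂, G.IsSeparationOfOrder 2 W₁ W₂ ∧ W₁ ∪ W₂ = W := by
  have hlt : m - 1 < m := by omega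
  suffices hs : (∃ c : W → Fin (m - 1), ∀ u v : W, G.Adj u v → c u ≠ c v) ∨
      ∃ W₁ W₂, G.IsSeparationOfOrder 2 W₁ W₂ ∧ W₁ ∪ W₂ = W by
    refine hs.imp_left fun ⟨c, hc⟩ => ?_
    refine ⟨fun w => if hw : w ∈ W then ⟨c ⟨w, hw⟩, (c ⟨w, hw⟩).2.trans hlt⟩ else ⟨m - 1, hlt⟩,
      ⟨m - 1, hlt⟩, ?_, ?_⟩
    · intro u hu v hv huv
      have := hc ⟨u, hu⟩ ⟨v, hv⟩ huv
      simpa [hu, hv, Fin.ext_iff] using this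
    · intro v hv
      have := (c ⟨v, hv⟩).2
      simp only [hv, dif_pos, ne_eq, Fin.mk.injEq]
      omega
  by_cases hW : 4 ≤ #W
  · refine (isKConnected_three_or_separation hW).imp_left fun h => ?_
    obtain ⟨C⟩ := hG _ h
    refine ⟨fun w => C ⟨w.1, w.2⟩, fun u v huv => C.valid ?_⟩
    simpa using huv
  · left
    have hcard : Fintype.card W ≤ Fintype.card (Fin (m - 1)) := by
      simp only [Fintype.card_coe, Fintype.card_fin]
      omega
    obtain ⟨f⟩ := Function.Embedding.nonempty_of_card_le hcard
    exact ⟨f, fun u v huv e => huv.ne (congrArg Subtype.val (f.injective e))⟩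

theorem MFragile.five_le_of_clique (hm : 4 ≤ m) (hG : G.MFragile m) (p q r s : V)
    (hpq : G.Adj p q) (hpr : G.Adj p r) (hps : G.Adj p s) (hqr : G.Adj q r) (hqs : G.Adj q s)
    (hrs : G.Adj r s) : 5 ≤ m := by
  classical
  rcases exists_missing_color_or_separation hm hG {p, q, r, s} with
    ⟨c, k, hc, hk⟩ | ⟨W₁, W₂, h, e⟩
  · have hcard : #({k, c p, c q, c r, c s} : Finset (Fin m)) = 5 := by
      have h₁ := hc p (by simp) q (by simp) hpq
      have h₂ := hc p (by simp) r (by simp) hpr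
      have h₃ := hc p (by simp) s (by simp) hps
      have h₄ := hc q (by simp) r (by simp) hqr
      have h₅ := hc q (by simp) s (by simp) hqs
      have h₆ := hc r (by simp) s (by simp) hrs
      have k₁ := (hk p (by simp)).symm
      have k₂ := (hk q (by simp)).symm
      have k₃ := (hk r (by simp)).symm
      have k₄ := (hk s (by simp)).symm
      simp [card_insert_of_notMem, *]
    rw [← hcard]
    exact (card_le_univ _).trans (by simp)
  · exfalso
    obtain ⟨u, hu⟩ := h.left
    obtain ⟨v, hv⟩ := h.right
    rw [mem_sdiff] at hu hv
    have hn := h.not_adj u hu.1 hu.2 v hv.1 hv.2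
    have huv : u ≠ v := by
      rintro rfl
      exact hu.2 hv.1
    have hu' : u ∈ ({p, q, r, s} : Finset V) := e ▸ mem_union_left _ hu.1
    have hv' : v ∈ ({p, q, r, s} : Finset V) := e ▸ mem_union_right _ hv.1
    simp only [mem_insert, mem_singleton] at hu' hv'
    have := G.adj_comm
    grind

theorem MFragile.flexible (hm : 4 ≤ m) (hG : G.MFragile m) (W : Finset V) :
    G.Flexible_s3 m W := by
  classical
  induction W using Finset.strongInduction with
  | H W ih =>
    rcases exists_missing_color_or_separation hm hG W with ⟨c, k, hc, hk⟩ | ⟨W₁, W₂, h, rfl⟩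
    · exact flexible_of_missing_color hc hk
    · obtain ⟨a, b, hab⟩ := h.exists_isTwoSeparation
      refine hab.flexible_union hm (hG.five_le_of_clique hm) (ih W₁ ?_) (ih W₂ ?_)
      · obtain ⟨v, hv⟩ := h.right
        rw [mem_sdiff] at hv
        exact (ssubset_iff_of_subset subset_union_left).2 ⟨v, mem_union_right _ hv.1, hv.2⟩
      · obtain ⟨v, hv⟩ := h.left
        rw [mem_sdiff] at hv
        exact (ssubset_iff_of_subset subset_union_right).2 ⟨v, mem_union_left _ hv.1, hv.2⟩

end SimpleGraph

/-- Every `m`-fragile graph admits an `m`-colouring identifying any two given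
distinct non-adjacent vertices. -/
theorem statement3 {V : Type*} [Fintype V] (G : SimpleGraph V) (m : ℕ) (hm : 4 ≤ m)
    (hG : G.MFragile m) (x y : V) (hxy : x ≠ y) (hadj : ¬ G.Adj x y) :
    ∃ c : V → ℕ, (∀ v, c v ∈ Finset.Icc 1 m) ∧ (∀ u v, G.Adj u v → c u ≠ c v) ∧
      c x = c y := by
  obtain ⟨c, hc, e⟩ := (hG.flexible hm Finset.univ).same x (Finset.mem_univ x) y
    (Finset.mem_univ y) hadj
  refine ⟨fun v => c v + 1, fun v => ?_, fun u v huv h => ?_, by simp [e]⟩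
  · have := (c v).2
    simp only [Finset.mem_Icc]
    omega
  · exact hc u (Finset.mem_univ u) v (Finset.mem_univ v) huv
      (Fin.ext (Nat.add_right_cancel h))
end
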